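/- arXiv:2510.22502 — 2 statements merged into one kernel-verified Lean document; each statement's English description precedes it below -/
import Mathlib

section
/- Let φ be a nonzero quadratic form of dimension ≥ 2 over F with i₀(φ) ≤ dim φ − 2 (so that the projective quadric X_φ is nonempty and integral). Then: (1) the function field extension F(φ)/F is separable if and only if φ is not quasilinear; (2) F(φ)/F is purely transcendental if and only if i_W(φ) > 0. -/
/-!  Common framework: quadratic forms over a field of characteristic 2, presented by
coefficient matrices, together with the standard invariants used in the paper
"Rationality of cycles modulo 2 on products of generically smooth quadrics in
characteristic 2" by S. Scully and G. Zhu. -/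

open scoped TensorProduct

/-- A quadratic form of dimension `n` over `F`, presented by an `n × n` coefficient
matrix `q`: the associated quadratic form is `x ↦ ∑ i j, q i j * x i * x j`. -/
abbrev QF (F : Type) (n : ℕ) := Matrix (Fin n) (Fin n) F

namespace QF

section Basic

variable {F : Type} [Field F]

/-- The value of a quadratic form at a vector. -/
def eval {n : ℕ} (q : QF F n) (x : Fin n → F) : F := ∑ i, ∑ j, q i j * x i * x j

/-- The polar bilinear form of `q`. -/
def polar {n : ℕ} (q : QF F n) (x y : Fin n → F) : F :=
  eval q (x + y) - eval q x - eval q y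

/-- `q` is isotropic: it vanishes at some nonzero vector. -/
def Isotropic {n : ℕ} (q : QF F n) : Prop := ∃ x, x ≠ 0 ∧ eval q x = 0

/-- `q` is anisotropic: it vanishes only at `0`. -/
def Anisotropic {n : ℕ} (q : QF F n) : Prop := ∀ x, eval q x = 0 → x = 0

/-- The zero form `d ⬝ ⟨0⟩` of dimension `d`. -/
def zeroForm (d : ℕ) : QF F d := 0

/-- Isometry of quadratic forms. -/
def Isom {n m : ℕ} (q : QF F n) (q' : QF F m) : Prop :=
  ∃ e : (Fin n → F) ≃ₗ[F] (Fin m → F), ∀ x, eval q' (e x) = eval q x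

/-- Orthogonal sum of quadratic forms. -/
def orthSum {n m : ℕ} (q : QF F n) (q' : QF F m) : QF F (n + m) :=
  Matrix.reindex finSumFinEquiv finSumFinEquiv (Matrix.fromBlocks q 0 0 q')

/-- The binary quadratic form `[a, b] : (x, y) ↦ a x² + x y + b y²`. -/
def binary (a b : F) : QF F 2 := !![a, 1; 0, b]

/-- The orthogonal sum of the binary forms `[a i, b i]`, `i = 0, …, r - 1`. -/
def binSum {r : ℕ} (a b : Fin r → F) : QF F (r + r) :=
  Matrix.reindex finSumFinEquiv finSumFinEquiv
    (Matrix.fromBlocks (Matrix.diagonal a) 1 0 (Matrix.diagonal b))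

/-- The split form `w ⬝ ℍ`, the orthogonal sum of `w` hyperbolic planes. -/
def hyper (w : ℕ) : QF F (w + w) := binSum 0 0

/-- The quasilinear (diagonal) quadratic form `⟨c 0, …, c (s - 1)⟩`. -/
def diag {s : ℕ} (c : Fin s → F) : QF F s := Matrix.diagonal c

/-- `q` has type `(r, s)` with quasilinear part `⟨c⟩`, i.e.
`q ≃ [a 0, b 0] ⊥ ⋯ ⊥ [a (r-1), b (r-1)] ⊥ ⟨c⟩` for some `a b`. -/
def HasTypeWith {n : ℕ} (q : QF F n) (r s : ℕ) (c : Fin s → F) : Prop :=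
  ∃ a b : Fin r → F, Isom q (orthSum (binSum a b) (diag c))

/-- `q` has type `(r, s)`. -/
def HasType {n : ℕ} (q : QF F n) (r s : ℕ) : Prop := ∃ c : Fin s → F, HasTypeWith q r s c

/-- `q` is quasilinear, i.e. isometric to a diagonal form. -/
def IsQuasilinear {n : ℕ} (q : QF F n) : Prop := ∃ c : Fin n → F, Isom q (diag c)

/-- The isotropy index `i₀(q)`: the maximal dimension of a totally isotropic subspace. -/
noncomputable def i0 {n : ℕ} (q : QF F n) : ℕ :=
  sSup {d | ∃ W : Submodule F (Fin n → F), Module.finrank F W = d ∧ ∀ x ∈ W, eval q x = 0}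

/-- The defect index `i_d(q)`: the maximal dimension of a totally isotropic subspace
contained in the radical of the polar form (equivalently, the isotropy index of the
quasilinear part of `q`, in characteristic 2). -/
noncomputable def defect {n : ℕ} (q : QF F n) : ℕ :=
  sSup {d | ∃ W : Submodule F (Fin n → F), Module.finrank F W = d ∧
    (∀ x ∈ W, eval q x = 0) ∧ ∀ x ∈ W, ∀ y, polar q x y = 0}

/-- `q` is nondefective. -/
def Nondefective {n : ℕ} (q : QF F n) : Prop := defect q = 0

/-- The Witt index `i_W(q)`: the maximal number of hyperbolic planes splitting off `q`. -/
noncomputable def wittIndex {n : ℕ} (q : QF F n) : ℕ :=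
  sSup {w | ∃ (m : ℕ) (q' : QF F m), Isom q (orthSum q' (hyper w))}

/-- `qa` is the anisotropic part of `q`: `qa` is anisotropic and
`q ≃ qa ⊥ w ⬝ ℍ ⊥ d ⬝ ⟨0⟩` (Witt decomposition). -/
def IsAnisotropicPart {n m : ℕ} (q : QF F n) (qa : QF F m) : Prop :=
  Anisotropic qa ∧ ∃ w d : ℕ, Isom q (orthSum (orthSum qa (hyper w)) (zeroForm d))

/-- Witt equivalence: `q` and `q'` have isometric anisotropic parts. -/
def WittEquiv {n m : ℕ} (q : QF F n) (q' : QF F m) : Prop :=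
  ∃ (k : ℕ) (qa : QF F k), IsAnisotropicPart q qa ∧ IsAnisotropicPart q' qa

/-- `p` is dominated by `q` (`p ≺ q`): `p` is isometric to the restriction of `q` to a
subspace of the underlying space of `q`. -/
def Dominated {m n : ℕ} (p : QF F m) (q : QF F n) : Prop :=
  ∃ f : (Fin m → F) →ₗ[F] (Fin n → F), Function.Injective f ∧ ∀ x, eval q (f x) = eval p x

/-- `p` is a subform (orthogonal direct summand) of `q`. -/
def Subform {m n : ℕ} (p : QF F m) (q : QF F n) : Prop :=
  ∃ (k : ℕ) (p' : QF F k), Isom q (orthSum p p')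

/-- Base change of a quadratic form along a field extension `K/F`. -/
def baseChange {n : ℕ} (q : QF F n) (K : Type) [Field K] [Algebra F K] : QF K n :=
  q.map (algebraMap F K)

/-- Transport a quadratic form along an equality of dimensions. -/
def castQF {n m : ℕ} (h : n = m) (q : QF F n) : QF F m :=
  Matrix.reindex (finCongr h) (finCongr h) q

/-- The orthogonal sum of the first `h` members of a family of quadratic forms. -/
noncomputable def sumFam {D : ℕ → ℕ} (f : ∀ i, QF F (D i)) :
    (h : ℕ) → QF F (∑ i ∈ Finset.range h, D i)
  | 0 => castQF (by simp) (zeroForm 0)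
  | h + 1 => castQF (Finset.sum_range_succ D h).symm (orthSum (sumFam f h) (f h))

/-- The Gram matrix of the `k`-fold bilinear Pfister form `⟪a 0, …, a (k-1)⟫_b`. -/
noncomputable def bPfister {k : ℕ} (a : Fin k → F) :
    Matrix (Fin (2 ^ k)) (Fin (2 ^ k)) F :=
  Matrix.reindex finFunctionFinEquiv finFunctionFinEquiv
    (Matrix.diagonal fun f : Fin k → Fin 2 => ∏ i, if f i = 1 then a i else 1)

/-- The `(k+1)`-fold quadratic Pfister form `⟪a 0, …, a (k-1)⟫_b ⊗ [1, c]`. -/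
noncomputable def qPfister {k : ℕ} (a : Fin k → F) (c : F) : QF F (2 ^ k * 2) :=
  Matrix.reindex finProdFinEquiv finProdFinEquiv
    (Matrix.kroneckerMap (· * ·) (bPfister a) (binary 1 c))

/-- `π` is a `(k+1)`-fold quadratic Pfister form. -/
def IsPfister {m : ℕ} (k : ℕ) (π : QF F m) : Prop :=
  ∃ (a : Fin k → F) (c : F), Isom π (qPfister a c)

/-- `π` is a general `(k+1)`-fold Pfister form: a nonzero scalar multiple of a
`(k+1)`-fold quadratic Pfister form. -/
def IsGenPfister {m : ℕ} (k : ℕ) (π : QF F m) : Prop :=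
  ∃ d : F, d ≠ 0 ∧ ∃ (a : Fin k → F) (c : F), Isom π (d • qPfister a c)

/-- `q` is a Pfister neighbour: `2 ^ k < dim q ≤ 2 ^ (k + 1)` and `q` is dominated by a
general `(k+1)`-fold Pfister form (domination forces `dim q ≤ 2 ^ (k + 1)`). -/
def IsPfisterNeighbour {n : ℕ} (q : QF F n) : Prop :=
  ∃ (k : ℕ) (π : QF F (2 ^ k * 2)), 2 ^ k < n ∧ IsGenPfister k π ∧ Dominated q π

/-- `qc` is the complementary form of the Pfister neighbour `q` in its ambient general
Pfister form `π`: it is the nondefective form of dimension `2 ^ (k + 1) - dim q` which is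
Witt equivalent to `q ⊥ π` (this pins down `qc` up to isometry). -/
def IsComplement {n k m : ℕ} (q : QF F n) (π : QF F (2 ^ k * 2)) (qc : QF F m) : Prop :=
  m = 2 ^ k * 2 - n ∧ Nondefective qc ∧ WittEquiv (orthSum q π) qc

/-- `qc` is the complementary form of the Pfister neighbour `q`. -/
def IsComplementOf {n m : ℕ} (q : QF F n) (qc : QF F m) : Prop :=
  ∃ (k : ℕ) (π : QF F (2 ^ k * 2)), 2 ^ k < n ∧ IsGenPfister k π ∧ Dominated q π ∧
    IsComplement q π qc

/-- The polynomial of the quadric `{q = 0}` in the affine chart where the last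
projective coordinate equals `1`. -/
noncomputable def affinePoly {n : ℕ} (q : QF F n) : MvPolynomial (Fin (n - 1)) F :=
  ∑ i : Fin n, ∑ j : Fin n,
    MvPolynomial.C (q i j) *
      (if h : (i : ℕ) < n - 1 then MvPolynomial.X (⟨(i : ℕ), h⟩ : Fin (n - 1)) else 1) *
      (if h : (j : ℕ) < n - 1 then MvPolynomial.X (⟨(j : ℕ), h⟩ : Fin (n - 1)) else 1)

/-- `K` is a model of the function field `F(q)` of the projective quadric `{q = 0}`:
`K` is the fraction field of the affine coordinate ring of the (dense) standard affine
chart of the quadric. -/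
def IsFunctionField {n : ℕ} (q : QF F n) (K : Type) [Field K] [Algebra F K] : Prop :=
  ∃ f : MvPolynomial (Fin (n - 1)) F →ₐ[F] K,
    RingHom.ker f = Ideal.span {affinePoly q} ∧
    IntermediateField.adjoin F (Set.range fun i => f (MvPolynomial.X i)) = ⊤

end Basic

/-- A bundled field extension of `F`. -/
structure FieldExt (F : Type) [Field F] : Type 1 where
  carrier : Type
  [fieldInst : Field carrier]
  [algInst : Algebra F carrier]

attribute [instance] FieldExt.fieldInst FieldExt.algInst

/-- `K/F` is a separable field extension (MacLane's criterion: `K ⊗_F L` is reduced for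
every purely inseparable extension `L/F`). -/
def IsSepExt (F : Type) [Field F] (K : Type) [Field K] [Algebra F K] : Prop :=
  ∀ (L : Type) [Field L] [Algebra F L], IsPurelyInseparable F L → IsReduced (K ⊗[F] L)

/-- `K/F` is purely transcendental: `K` is generated over `F` by an algebraically
independent subset. -/
def IsPurelyTranscendentalExt (F : Type) [Field F] (K : Type) [Field K] [Algebra F K] :
    Prop :=
  ∃ s : Set K, AlgebraicIndependent F (fun x : s => (x : K)) ∧
    IntermediateField.adjoin F s = ⊤

section Invariants

variable {F : Type} [Field F]

/-- `p` and `q` are stably birationally equivalent: over every field extension of `F`,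
`p` is isotropic if and only if `q` is (for anisotropic forms of dimension at least 2
this is equivalent to stable birationality of the associated projective quadrics). -/
def SBEquiv {m n : ℕ} (p : QF F m) (q : QF F n) : Prop :=
  ∀ (K : Type) [Field K] [Algebra F K],
    (Isotropic (baseChange p K) ↔ Isotropic (baseChange q K))

/-- The first higher isotropy index `i₁(q)` of an anisotropic form: the minimal positive
isotropy index attained over field extensions of `F`. -/
noncomputable def i1 {n : ℕ} (q : QF F n) : ℕ :=
  sInf {i | 0 < i ∧ ∃ K : FieldExt F, i0 (baseChange q K.carrier) = i}

/-- The Izhboldin dimension `dim q - i₁(q)`. -/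
noncomputable def izh {n : ℕ} (q : QF F n) : ℕ := n - i1 q

/-- The nondefective splitting pattern of a nondefective form `q`: the set of Witt
indices attained by `q` over separable field extensions of `F`. -/
def splittingPattern {n : ℕ} (q : QF F n) : Set ℕ :=
  {w | ∃ K : FieldExt F, IsSepExt F K.carrier ∧ wittIndex (baseChange q K.carrier) = w}

/-- The nondefective height `h_nd(q)`. -/
noncomputable def hnd {n : ℕ} (q : QF F n) : ℕ := (splittingPattern q).ncard - 1

/-- `jrel q t = j_t(q)`: the `t`-th value (in increasing order) of the nondefective
splitting pattern of `q`. -/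
noncomputable def jrel {n : ℕ} (q : QF F n) (t : ℕ) : ℕ :=
  sInf {w | w ∈ splittingPattern q ∧ {w' | w' ∈ splittingPattern q ∧ w' < w}.ncard = t}

/-- `irel q t = i_t(q) = j_t(q) - j_(t-1)(q)`: the `t`-th higher Witt index of `q`. -/
noncomputable def irel {n : ℕ} (q : QF F n) (t : ℕ) : ℕ := jrel q t - jrel q (t - 1)

/-- `q` is a virtual Pfister neighbour: it becomes an anisotropic Pfister neighbour
over some field extension of `F`. -/
def IsVirtualPfisterNeighbour {n : ℕ} (q : QF F n) : Prop :=
  ∃ K : FieldExt F, Anisotropic (baseChange q K.carrier) ∧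
    IsPfisterNeighbour (baseChange q K.carrier)

end Invariants

/-! ### The combinatorics of `Λ(X)` and the motivic decomposition type -/

/-- Formal symbols `i_lo` and `iᵘᵖ` indexing the Tate motives of a split quadric. -/
inductive Sym : Type
  | lo : ℤ → Sym
  | up : ℤ → Sym
  deriving DecidableEq

/-- Shift of a symbol by `j`. -/
def Sym.shift (j : ℤ) : Sym → Sym
  | .lo i => .lo (i + j)
  | .up i => .up (i + j)

/-- The shift `Λ[j]` of a set of symbols. -/
def shiftSet (Λ : Set Sym) (j : ℤ) : Set Sym := Sym.shift j '' Λ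

/-- The set `Λ(X)` for a quadric `X` of dimension `d` attached to a form of type
`(r, s)`: the symbols `i_lo` for `0 ≤ i < r` and `iᵘᵖ` for `d - r < i ≤ d`. -/
def LamSet (r d : ℤ) : Set Sym :=
  {x | (∃ i : ℤ, x = Sym.lo i ∧ 0 ≤ i ∧ i < r) ∨ ∃ i : ℤ, x = Sym.up i ∧ d - r < i ∧ i ≤ d}

/-- `a(Λ) = m`: `m` is the least index `i` with `i_lo ∈ Λ`. -/
def IsALower (Λ : Set Sym) (m : ℤ) : Prop :=
  Sym.lo m ∈ Λ ∧ ∀ i : ℤ, Sym.lo i ∈ Λ → m ≤ i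

/-- `b(Λ) = m`: `m` is the largest index `i` with `iᵘᵖ ∈ Λ`. -/
def IsBUpper (Λ : Set Sym) (m : ℤ) : Prop :=
  Sym.up m ∈ Λ ∧ ∀ i : ℤ, Sym.up i ∈ Λ → i ≤ m

/-- The member of a partition `M` of `Λ(X)` containing `0_lo`: the upper connected
component `Λᵁ(X)`. -/
def upperComp (M : Set (Set Sym)) : Set Sym := ⋃₀ {Λ | Λ ∈ M ∧ Sym.lo 0 ∈ Λ}

/-- An abstract theory of `F`-rational algebraic cycles modulo 2 of middle dimension on
the squares of generically smooth nondefective quadrics, as constructed in §§4–7 of the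
paper: `RatCyc K q` is the family of subsets `Λ ⊆ Λ(X_q)` whose associated cycle
`α_Λ = ∑_{λ ∈ Λ} α_λ` is an `F`-rational element of `Ch̄_{d_X}(X_q²)` (the image of
`CH_{d_X}(X_q²)/2 → CH_{d_X}((X_q²)_F̄)/2`).  The formal properties recorded here are
those established in the paper: the family is an `𝔽₂`-subspace (closed under symmetric
difference), is closed under intersections, consists of subsets of `Λ(X_q)`, and
contains `Λ(X_q)` itself. -/
structure MDTTheory : Type 1 where
  RatCyc : ∀ (K : Type) [Field K] {n : ℕ} (q : QF K n), Set (Set Sym)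
  inter_mem : ∀ (K : Type) [Field K] {n : ℕ} (q : QF K n),
    ∀ Λ₁ ∈ RatCyc K q, ∀ Λ₂ ∈ RatCyc K q, Λ₁ ∩ Λ₂ ∈ RatCyc K q
  symmDiff_mem : ∀ (K : Type) [Field K] {n : ℕ} (q : QF K n),
    ∀ Λ₁ ∈ RatCyc K q, ∀ Λ₂ ∈ RatCyc K q, symmDiff Λ₁ Λ₂ ∈ RatCyc K q
  subset_lam : ∀ (K : Type) [Field K] {n : ℕ} (q : QF K n) (r s : ℕ),
    HasType q r s → ∀ Λ ∈ RatCyc K q, Λ ⊆ LamSet (r : ℤ) ((n : ℤ) - 2)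
  lam_mem : ∀ (K : Type) [Field K] {n : ℕ} (q : QF K n) (r s : ℕ),
    HasType q r s → LamSet (r : ℤ) ((n : ℤ) - 2) ∈ RatCyc K q

/-- The motivic decomposition type `MDT(q)`: the partition of `Λ(X_q)` into the supports
of the indecomposable rational cycles, i.e. the minimal nonempty members of the family
of rational subsets. -/
def MDTTheory.MDT (T : MDTTheory) (K : Type) [Field K] {n : ℕ} (q : QF K n) :
    Set (Set Sym) :=
  {Λ | Λ ∈ T.RatCyc K q ∧ Λ.Nonempty ∧
    ∀ Λ' ∈ T.RatCyc K q, Λ' ⊆ Λ → Λ' = ∅ ∨ Λ' = Λ}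

end QF


open TensorProduct

theorem isDomain_ratFun_tensor (F : Type) [Field F] (ι : Type) (L : Type) [Field L] [Algebra F L] :
    IsDomain (FractionRing (MvPolynomial ι F) ⊗[F] L) := by
  let A := MvPolynomial ι F
  let B := FractionRing A
  let e : A ⊗[F] L ≃ₐ[F] MvPolynomial ι L :=
    (Algebra.TensorProduct.comm F A L).trans
      ((MvPolynomial.algebraTensorAlgEquiv F L).restrictScalars F)
  have : IsDomain (A ⊗[F] L) := e.toMulEquiv.isDomain (MvPolynomial ι L)
  let g : A ⊗[F] L →ₐ[F] B ⊗[F] L :=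
    Algebra.TensorProduct.map (IsScalarTower.toAlgHom F A B) (AlgHom.id F L)
  let : Algebra (A ⊗[F] L) (B ⊗[F] L) := g.toRingHom.toAlgebra
  have : IsScalarTower A (A ⊗[F] L) (B ⊗[F] L) := by
    refine IsScalarTower.of_algebraMap_eq (R := A) (S := A ⊗[F] L) (A := B ⊗[F] L) fun x => ?_
    change _ = g (x ⊗ₜ 1)
    simp [g]
    rfl
  have := IsLocalization.tensorProduct_tensorProduct F L (nonZeroDivisors A) B (by
    ext x
    change g (1 ⊗ₜ x) = 1 ⊗ₜ x
    simp [g])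
  refine IsLocalization.isDomain_of_le_nonZeroDivisors (M := Algebra.algebraMapSubmonoid (A ⊗[F] L) (nonZeroDivisors A)) _ ?_
  refine le_nonZeroDivisors_of_noZeroDivisors ?_
  rintro ⟨a, ha, h⟩
  have : (algebraMap A (A ⊗[F] L)) a = 0 := h
  have hinj : Function.Injective (algebraMap A (A ⊗[F] L)) :=
    FaithfulSMul.algebraMap_injective _ _
  rw [map_eq_zero_iff _ hinj] at this
  exact nonZeroDivisors.ne_zero ha this

theorem isReduced_tensor_aux (F E K L : Type) [Field F] [Field E] [Field K] [Field L]
    [Algebra F E] [Algebra F K] [Algebra E K] [IsScalarTower F E K] [Algebra F L]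
    [Algebra.IsSeparable E K] [Module.Finite E K] [IsDomain (E ⊗[F] L)] :
    IsReduced (K ⊗[F] L) := by
  let M := FractionRing (E ⊗[F] L)
  have : Algebra.FormallyUnramified E K := Algebra.FormallyUnramified.of_isSeparable E K
  have : IsReduced (M ⊗[E] K) := Algebra.FormallyUnramified.isReduced_of_field M _
  let g : E ⊗[F] L →ₐ[E] M := IsScalarTower.toAlgHom E (E ⊗[F] L) M
  have hg : Function.Injective g := IsFractionRing.injective (E ⊗[F] L) M
  let h : K ⊗[E] (E ⊗[F] L) →ₐ[E] K ⊗[E] M := Algebra.TensorProduct.map (AlgHom.id E K) g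
  have hh : Function.Injective h :=
    Module.Flat.lTensor_preserves_injective_linearMap (M := K) g.toLinearMap hg
  let c := Algebra.TensorProduct.comm E K M
  let k := (Algebra.TensorProduct.cancelBaseChange F E E K L).symm
  exact isReduced_of_injective (c.toAlgHom.comp (h.comp k.toAlgHom))
    (c.injective.comp (hh.comp k.injective))

theorem isReduced_tensor_of_sep (F : Type) [Field F] (K : Type) [Field K] [Algebra F K]
    {ι : Type} (v : ι → K) (hv : AlgebraicIndependent F v)
    (hs : Algebra.IsSeparable (IntermediateField.adjoin F (Set.range v)) K)
    (hf : Module.Finite (IntermediateField.adjoin F (Set.range v)) K)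
    (L : Type) [Field L] [Algebra F L] : IsReduced (K ⊗[F] L) := by
  set E := IntermediateField.adjoin F (Set.range v) with hE
  let e : E ≃ₐ[F] FractionRing (MvPolynomial ι F) := hv.aevalEquivField.symm
  have := isDomain_ratFun_tensor F ι L
  let e' : E ⊗[F] L ≃ₐ[F] FractionRing (MvPolynomial ι F) ⊗[F] L :=
    Algebra.TensorProduct.congr e AlgEquiv.refl
  have : IsDomain (E ⊗[F] L) := e'.toMulEquiv.isDomain _
  exact isReduced_tensor_aux F E K L

open scoped TensorProduct
namespace QF

/-- value of a form at a vector with entries in an algebra. -/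
def evR {F : Type} [Field F] {n : ℕ} {R : Type} [CommRing R] [Algebra F R] (q : QF F n)
    (x : Fin n → R) : R := ∑ i, ∑ j, algebraMap F R (q i j) * x i * x j

theorem eval_eq_evR {F : Type} [Field F] {n : ℕ} (q : QF F n) (x : Fin n → F) :
    eval q x = evR q x := rfl

/-- polar with entries in an algebra. -/
def poR {F : Type} [Field F] {n : ℕ} {R : Type} [CommRing R] [Algebra F R] (q : QF F n)
    (x y : Fin n → R) : R := ∑ i, ∑ j, algebraMap F R (q i j + q j i) * x i * y j

theorem poR_comm {F : Type} [Field F] {n : ℕ} {R : Type} [CommRing R] [Algebra F R] (q : QF F n)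
    (x y : Fin n → R) : poR q x y = poR q y x := by
  unfold poR
  rw [Finset.sum_comm]
  refine Finset.sum_congr rfl fun i _ => Finset.sum_congr rfl fun j _ => ?_
  rw [add_comm (q j i)]; ring

theorem poR_add_right {F : Type} [Field F] {n : ℕ} {R : Type} [CommRing R] [Algebra F R]
    (q : QF F n) (x y z : Fin n → R) : poR q x (y + z) = poR q x y + poR q x z := by
  simp only [poR, Pi.add_apply, mul_add, Finset.sum_add_distrib]

theorem poR_smul_right {F : Type} [Field F] {n : ℕ} {R : Type} [CommRing R] [Algebra F R]
    (q : QF F n) (x y : Fin n → R) (c : R) : poR q x (c • y) = c * poR q x y := by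
  simp only [poR, Pi.smul_apply, smul_eq_mul, Finset.mul_sum]
  refine Finset.sum_congr rfl fun i _ => Finset.sum_congr rfl fun j _ => ?_
  ring

theorem poR_smul_left {F : Type} [Field F] {n : ℕ} {R : Type} [CommRing R] [Algebra F R]
    (q : QF F n) (x y : Fin n → R) (c : R) : poR q (c • x) y = c * poR q x y := by
  rw [poR_comm, poR_smul_right, poR_comm]

theorem poR_add_left {F : Type} [Field F] {n : ℕ} {R : Type} [CommRing R] [Algebra F R]
    (q : QF F n) (x y z : Fin n → R) : poR q (x + y) z = poR q x z + poR q y z := by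
  rw [poR_comm, poR_add_right, poR_comm, poR_comm q z y]

theorem evR_add {F : Type} [Field F] {n : ℕ} {R : Type} [CommRing R] [Algebra F R] (q : QF F n)
    (x y : Fin n → R) : evR q (x + y) = evR q x + evR q y + poR q x y := by
  have h : poR q x y = ∑ i, ∑ j, algebraMap F R (q i j) * x i * y j +
      ∑ i, ∑ j, algebraMap F R (q i j) * y i * x j := by
    rw [Finset.sum_comm (f := fun i j => algebraMap F R (q i j) * y i * x j)]
    simp only [poR, ← Finset.sum_add_distrib, map_add]
    refine Finset.sum_congr rfl fun i _ => Finset.sum_congr rfl fun j _ => ?_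
    ring
  rw [h]
  simp only [evR, ← Finset.sum_add_distrib, Pi.add_apply]
  refine Finset.sum_congr rfl fun i _ => Finset.sum_congr rfl fun j _ => ?_
  ring

theorem evR_smul {F : Type} [Field F] {n : ℕ} {R : Type} [CommRing R] [Algebra F R] (q : QF F n)
    (c : R) (x : Fin n → R) : evR q (c • x) = c ^ 2 * evR q x := by
  simp only [evR, Pi.smul_apply, smul_eq_mul, Finset.mul_sum]
  refine Finset.sum_congr rfl fun i _ => Finset.sum_congr rfl fun j _ => ?_
  ring

theorem polar_eq_poR {F : Type} [Field F] {n : ℕ} (q : QF F n) (x y : Fin n → F) :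
    polar q x y = poR q x y := by
  rw [polar, eval_eq_evR, eval_eq_evR, eval_eq_evR, evR_add]; ring

theorem evR_single {F : Type} [Field F] {n : ℕ} (q : QF F n) (i : Fin n) :
    evR q (Pi.single i (1 : F)) = q i i := by
  simp [evR, Pi.single_apply]

theorem poR_single {F : Type} [Field F] {n : ℕ} (q : QF F n) (i j : Fin n) :
    poR q (Pi.single i (1 : F)) (Pi.single j (1 : F)) = q i j + q j i := by
  simp [poR, Pi.single_apply]

theorem evR_of_alt {F : Type} [Field F] {n : ℕ} {R : Type} [CommRing R] [Algebra F R] (q : QF F n)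
    (h : ∀ i j, i ≠ j → q i j + q j i = 0) (x : Fin n → R) :
    evR q x = ∑ i, algebraMap F R (q i i) * x i ^ 2 := by
  classical
  have h2 : ∀ i, ∑ j, algebraMap F R (q i j) * x i * x j = algebraMap F R (q i i) * x i ^ 2 +
      ∑ j, if i = j then 0 else algebraMap F R (q i j) * x i * x j := by
    intro i
    rw [← Finset.add_sum_erase _ _ (Finset.mem_univ i)]
    congr 1
    · ring
    · rw [← Finset.add_sum_erase Finset.univ _ (Finset.mem_univ i)]
      simp only [if_true, zero_add]
      refine Finset.sum_congr rfl fun j hj => ?_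
      rw [if_neg (Finset.ne_of_mem_erase hj).symm]
  simp only [evR, h2, Finset.sum_add_distrib]
  rw [add_eq_left, ← Finset.sum_product']
  refine Finset.sum_involution (fun p _ => (p.2, p.1)) ?_ ?_ ?_ ?_
  · rintro ⟨i, j⟩ _
    by_cases hij : i = j
    · simp [hij]
    · simp only [if_neg hij, if_neg (Ne.symm hij)]
      have := congrArg (algebraMap F R) (h i j hij)
      rw [map_add, map_zero] at this
      linear_combination x i * x j * this
  · rintro ⟨i, j⟩ _ hne heq
    simp only [Prod.mk.injEq] at heq
    simp [heq.1] at hne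
  · simp
  · simp

theorem isQuasilinear_iff {F : Type} [Field F] [CharP F 2] {n : ℕ} (q : QF F n) :
    IsQuasilinear q ↔ ∀ i j, i ≠ j → q i j + q j i = 0 := by
  constructor
  · rintro ⟨c, e, he⟩ i j hij
    have key : ∀ z, evR (diag c) z = ∑ i, c i * z i ^ 2 := by
      intro z
      rw [evR_of_alt]
      · simp [diag]
      · intro i j hij
        simp [diag, Matrix.diagonal_apply_ne _ hij, Matrix.diagonal_apply_ne _ hij.symm]
    have h0 : polar q (Pi.single i 1) (Pi.single j 1) = 0 := by
      unfold polar
      rw [← he, ← he, ← he, eval_eq_evR, eval_eq_evR, eval_eq_evR, key, key, key, map_add]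
      simp only [Pi.add_apply, CharTwo.add_sq, mul_add, Finset.sum_add_distrib]
      ring
    rw [polar_eq_poR, poR_single] at h0
    exact h0
  · intro h
    refine ⟨fun i => q i i, LinearEquiv.refl _ _, fun x => ?_⟩
    rw [eval_eq_evR, eval_eq_evR, evR_of_alt q h, evR_of_alt]
    · simp [diag]
    · intro i j hij
      simp [diag, Matrix.diagonal_apply_ne _ hij, Matrix.diagonal_apply_ne _ hij.symm]

/-- transport of a form along a matrix -/
def pull {F : Type} [Field F] {n k : ℕ} (q : QF F n) (N : Matrix (Fin n) (Fin k) F) : QF F k :=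
  N.transpose * q * N

theorem evR_pull {F : Type} [Field F] {n k : ℕ} {R : Type} [CommRing R] [Algebra F R]
    (q : QF F n) (N : Matrix (Fin n) (Fin k) F) (y : Fin k → R) :
    evR (pull q N) y = evR q ((N.map (algebraMap F R)).mulVec y) := by
  have h : ∀ {m : ℕ} (p : QF F m) (z : Fin m → R),
      evR p z = z ⬝ᵥ (p.map (algebraMap F R)).mulVec z := by
    intro m p z
    simp only [evR, dotProduct, Matrix.mulVec, Finset.mul_sum, Matrix.map_apply]
    refine Finset.sum_congr rfl fun i _ => Finset.sum_congr rfl fun j _ => ?_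
    ring
  rw [h, h, pull, Matrix.map_mul, Matrix.map_mul, Matrix.transpose_map, ← Matrix.mulVec_mulVec,
    ← Matrix.mulVec_mulVec, Matrix.dotProduct_mulVec, Matrix.vecMul_transpose]

end QF

namespace QF

theorem evR_orthSum_hyper {F : Type} [Field F] {m w : ℕ} (q : QF F m) (c : Fin m → F)
    (s t : Fin w → F) :
    evR (orthSum q (hyper w)) (Fin.append c (Fin.append s t)) = evR q c + ∑ i, s i * t i := by
  have h1 : ∀ {a b : ℕ} (q : QF F a) (q' : QF F b) (x : Fin a → F) (y : Fin b → F),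
      evR (orthSum q q') (Fin.append x y) = evR q x + evR q' y := by
    intro a b q q' x y
    simp [evR, orthSum, Fin.sum_univ_add]
  rw [h1]
  congr 1
  have h2 : ∀ i : Fin w, finSumFinEquiv.symm (Fin.natAdd w i) = (Sum.inr i : Fin w ⊕ Fin w) :=
    fun i => by rw [Equiv.symm_apply_eq]; rfl
  have h3 : ∀ i : Fin w, finSumFinEquiv.symm (Fin.castAdd w i) = (Sum.inl i : Fin w ⊕ Fin w) :=
    fun i => by rw [Equiv.symm_apply_eq]; rfl
  simp only [evR, hyper, binSum, Fin.sum_univ_add, Matrix.reindex_apply, Matrix.submatrix_apply,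
    h2, h3, Fin.append_left, Fin.append_right]
  simp [Matrix.one_apply]

theorem wittIndex_pos_iff {F : Type} [Field F] {n : ℕ} (q : QF F n) :
    0 < wittIndex q ↔ ∃ v w : Fin n → F, evR q v = 0 ∧ poR q v w ≠ 0 := by
  constructor
  · intro h
    have : ∃ w ∈ {w | ∃ (m : ℕ) (q' : QF F m), Isom q (orthSum q' (hyper w))}, 0 < w := by
      by_contra! hc
      have : wittIndex q ≤ 0 := csSup_le' hc
      omega
    obtain ⟨w, ⟨m, q', e, he⟩, hw⟩ := this
    let i0 : Fin w := ⟨0, hw⟩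
    have he' : ∀ y, evR q (e.symm y) = evR (orthSum q' (hyper w)) y := by
      intro y
      rw [← eval_eq_evR, ← he, LinearEquiv.apply_symm_apply, eval_eq_evR]
    let a := Fin.append (0 : Fin m → F) (Fin.append (Pi.single i0 1) (0 : Fin w → F))
    let b := Fin.append (0 : Fin m → F) (Fin.append (0 : Fin w → F) (Pi.single i0 1))
    have hab : a + b = Fin.append (0 : Fin m → F) (Fin.append (Pi.single i0 1) (Pi.single i0 1)) := by
      ext i
      refine Fin.addCases (fun i => ?_) (fun i => ?_) i
      · simp [a, b]
      · refine Fin.addCases (fun i => ?_) (fun i => ?_) i <;>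
          simp [a, b, -Fin.natAdd_eq_addNat]
    have e0 : evR q' (0 : Fin m → F) = 0 := by simp [evR]
    refine ⟨e.symm a, e.symm b, ?_, ?_⟩
    · rw [he', evR_orthSum_hyper, e0]; simp
    · have := evR_add q (e.symm a) (e.symm b)
      rw [← map_add, he', he', he', hab] at this
      simp only [a, b, evR_orthSum_hyper, e0] at this
      simp [Pi.single_apply] at this
      rw [← this]; exact one_ne_zero
  · rintro ⟨v, w₀, hv, hvw₀⟩
    obtain ⟨w, hw, hvw⟩ : ∃ w, evR q w = 0 ∧ poR q v w = 1 := by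
      let w₁ := (poR q v w₀)⁻¹ • w₀
      have h1 : poR q v w₁ = 1 := by
        simp only [w₁, poR_smul_right]; exact inv_mul_cancel₀ hvw₀
      have hvv : poR q v v = 0 := by
        have := evR_add q v v
        rw [hv, ← two_smul F v, evR_smul, hv] at this
        simpa using this.symm
      clear_value w₁
      refine ⟨w₁ + (-evR q w₁) • v, ?_, ?_⟩
      · rw [evR_add, evR_smul, hv, poR_smul_right, poR_comm, h1]; ring
      · rw [poR_add_right, poR_smul_right, hvv, h1]; ring
    have hvv : poR q v v = 0 := by
      have := evR_add q v v
      rw [hv, ← two_smul F v, evR_smul, hv] at this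
      simpa using this.symm
    have hww : poR q w w = 0 := by
      have := evR_add q w w
      rw [hw, ← two_smul F w, evR_smul, hw] at this
      simpa using this.symm
    let B : (Fin n → F) → (Fin n → F) →ₗ[F] F := fun a =>
      { toFun := fun z => poR q a z
        map_add' := fun x y => poR_add_right q a x y
        map_smul' := fun c x => poR_smul_right q a x c }
    let G : (Fin n → F) →ₗ[F] F × F := (B v).prod (B w)
    have hG : ∀ z, G z = (poR q v z, poR q w z) := fun z => rfl
    have hsurj : Function.Surjective G := by
      rintro ⟨s, t⟩
      refine ⟨t • v + s • w, ?_⟩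
      rw [hG, poR_add_right, poR_add_right, poR_smul_right, poR_smul_right, poR_smul_right,
        poR_smul_right, hvv, hww, poR_comm q w v, hvw]
      simp
    let W := LinearMap.ker G
    have hdim : 2 + Module.finrank F W = n := by
      have := LinearMap.finrank_range_add_finrank_ker G
      rw [LinearMap.range_eq_top.mpr hsurj, finrank_top] at this
      simpa using this
    let d := Module.finrank F W
    let bs : Module.Basis (Fin d) F W := Module.finBasis F W
    let N : Matrix (Fin n) (Fin d) F := fun i k => (bs k : Fin n → F) i
    have hN : ∀ c : Fin d → F, N.mulVec c = ((∑ k, c k • bs k : W) : Fin n → F) := by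
      intro c
      ext i
      simp [Matrix.mulVec, dotProduct, N, mul_comm]
    have hNW : ∀ c, N.mulVec c ∈ W := fun c => by rw [hN]; exact (∑ k, c k • bs k : W).2
    have hinjN : ∀ c, N.mulVec c = 0 → c = 0 := by
      intro c hc
      rw [hN] at hc
      have : (∑ k, c k • bs k : W) = 0 := Subtype.ext hc
      ext k
      exact (Fintype.linearIndependent_iff.mp bs.linearIndependent) c this k
    let T : (Fin (d + (1 + 1)) → F) →ₗ[F] (Fin n → F) :=
      { toFun := fun y => N.mulVec (fun k => y (Fin.castAdd _ k)) +
          (y (Fin.natAdd d 0) • v + y (Fin.natAdd d 1) • w)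
        map_add' := by
          intro x y
          have : (fun k => (x + y) (Fin.castAdd (1 + 1) k)) =
            (fun k => x (Fin.castAdd (1 + 1) k)) + (fun k => y (Fin.castAdd (1 + 1) k)) := rfl
          rw [this, Matrix.mulVec_add]
          simp only [Pi.add_apply]
          module
        map_smul' := by
          intro c y
          have : (fun k => (c • y) (Fin.castAdd (1 + 1) k)) =
            c • (fun k => y (Fin.castAdd (1 + 1) k)) := rfl
          rw [this, Matrix.mulVec_smul]
          simp only [Pi.smul_apply, RingHom.id_apply, smul_eq_mul]
          module }
    have hT : ∀ y, T y = N.mulVec (fun k => y (Fin.castAdd _ k)) +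
          (y (Fin.natAdd d 0) • v + y (Fin.natAdd d 1) • w) := fun y => rfl
    have hW : ∀ c, poR q v (N.mulVec c) = 0 ∧ poR q w (N.mulVec c) = 0 := by
      intro c
      have : G (N.mulVec c) = 0 := hNW c
      rw [hG] at this
      exact Prod.mk.inj this
    have hTinj : Function.Injective T := by
      rw [injective_iff_map_eq_zero]
      intro y hy
      have hv' : poR q v (T y) = y (Fin.natAdd d 1) := by
        rw [hT, poR_add_right, poR_add_right, poR_smul_right, poR_smul_right, hvv, hvw, (hW _).1]
        ring
      have hw' : poR q w (T y) = y (Fin.natAdd d 0) := by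
        rw [hT, poR_add_right, poR_add_right, poR_smul_right, poR_smul_right, hww, poR_comm q w v,
          hvw, (hW _).2]
        ring
      have z : ∀ a, poR q a (0 : Fin n → F) = 0 := by simp [poR]
      rw [hy, z] at hv' hw'
      rw [hT, ← hv', ← hw'] at hy
      simp only [zero_smul, add_zero] at hy
      have := hinjN _ hy
      ext i
      refine Fin.addCases (fun i => ?_) (fun i => ?_) i
      · exact congrFun this i
      · fin_cases i
        · exact hw'.symm
        · exact hv'.symm
    let e : (Fin (d + (1 + 1)) → F) ≃ₗ[F] (Fin n → F) :=
      LinearEquiv.ofInjectiveOfFinrankEq T hTinj (by simp; omega)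
    have hmem : 1 ∈ {w | ∃ (m : ℕ) (q' : QF F m), Isom q (orthSum q' (hyper w))} := by
      refine ⟨d, pull q N, e.symm, fun x => ?_⟩
      obtain ⟨y, rfl⟩ := e.surjective x
      rw [LinearEquiv.symm_apply_apply, eval_eq_evR, eval_eq_evR]
      have hy : y = Fin.append (fun k => y (Fin.castAdd _ k))
          (Fin.append (fun _ : Fin 1 => y (Fin.natAdd d 0)) (fun _ : Fin 1 => y (Fin.natAdd d 1))) := by
        ext i
        refine Fin.addCases (fun i => ?_) (fun i => ?_) i
        · simp
        · fin_cases i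
          · simp; rfl
          · simp; rfl
      have : e y = T y := rfl
      rw [this, hT]
      conv_lhs => rw [hy]
      rw [evR_orthSum_hyper, evR_pull, evR_add, evR_add q (_ • v), evR_smul, evR_smul, hv, hw,
        poR_add_right, poR_smul_right, poR_smul_right, poR_smul_right, poR_smul_left, hvw,
        poR_comm q _ v, poR_comm q _ w, (hW _).1, (hW _).2]
      have : N.map (algebraMap F F) = N := by ext; simp
      rw [this]
      simp
      ring
    have hb : BddAbove {w | ∃ (m : ℕ) (q' : QF F m), Isom q (orthSum q' (hyper w))} := by
      refine ⟨n, ?_⟩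
      rintro w ⟨m, q', e, -⟩
      have := e.finrank_eq
      simp at this
      omega
    have : 1 ≤ wittIndex q := le_csSup hb hmem
    omega
end QF

namespace QF

theorem evR_map {F : Type} [Field F] {n : ℕ} {R S : Type} [CommRing R] [Algebra F R]
    [CommRing S] [Algebra F S] (g : R →ₐ[F] S) (q : QF F n) (x : Fin n → R) :
    g (evR q x) = evR q (fun i => g (x i)) := by
  simp [evR]

theorem poR_map {F : Type} [Field F] {n : ℕ} {R S : Type} [CommRing R] [Algebra F R]
    [CommRing S] [Algebra F S] (g : R →ₐ[F] S) (q : QF F n) (x y : Fin n → R) :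
    g (poR q x y) = poR q (fun i => g (x i)) (fun i => g (y i)) := by
  simp [poR]

theorem evR_single' {F : Type} [Field F] {n : ℕ} {R : Type} [CommRing R] [Algebra F R]
    (q : QF F n) (i : Fin n) :
    evR q (Pi.single i (1 : R)) = algebraMap F R (q i i) := by
  simp [evR, Pi.single_apply]

theorem poR_single' {F : Type} [Field F] {n : ℕ} {R : Type} [CommRing R] [Algebra F R]
    (q : QF F n) (i : Fin n) (y : Fin n → R) :
    poR q (Pi.single i (1 : R)) y = ∑ j, algebraMap F R (q i j + q j i) * y j := by
  simp only [poR, Pi.single_apply, mul_ite, mul_one, mul_zero, ite_mul, zero_mul]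
  rw [Finset.sum_eq_single i]
  · simp
  · intro b _ hb
    simp [hb]
  · simp

theorem evR_mem {F : Type} [Field F] {n : ℕ} {K : Type} [Field K] [Algebra F K]
    (E : IntermediateField F K) (q : QF F n) (x : Fin n → K) (hx : ∀ i, x i ∈ E) :
    evR q x ∈ E :=
  sum_mem fun i _ => sum_mem fun j _ => mul_mem (mul_mem (E.algebraMap_mem _) (hx i)) (hx j)

theorem poR_mem {F : Type} [Field F] {n : ℕ} {K : Type} [Field K] [Algebra F K]
    (E : IntermediateField F K) (q : QF F n) (x y : Fin n → K) (hx : ∀ i, x i ∈ E)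
    (hy : ∀ i, y i ∈ E) : poR q x y ∈ E :=
  sum_mem fun i _ => sum_mem fun j _ => mul_mem (mul_mem (E.algebraMap_mem _) (hx i)) (hy j)

/-- affine coordinates -/
noncomputable def uu (F : Type) [Field F] (m : ℕ) : Fin (m + 1) → MvPolynomial (Fin m) F :=
  fun i => if h : (i : ℕ) < m then MvPolynomial.X (⟨(i : ℕ), h⟩ : Fin m) else 1

theorem uu_castSucc (F : Type) [Field F] (m : ℕ) (i : Fin m) :
    uu F m i.castSucc = MvPolynomial.X i := by
  simp [uu]

theorem uu_last (F : Type) [Field F] (m : ℕ) : uu F m (Fin.last m) = 1 := by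
  simp [uu]

theorem affinePoly_eq {F : Type} [Field F] {m : ℕ} (q : QF F (m + 1)) :
    affinePoly q = evR q (uu F m) := rfl

theorem uu_lin (F : Type) [Field F] (m : ℕ) (c : Fin (m + 1) → F)
    (h : ∑ i, MvPolynomial.C (c i) * uu F m i = 0) : c = 0 := by
  rw [Fin.sum_univ_castSucc, uu_last] at h
  simp only [uu_castSucc] at h
  have h0 : c (Fin.last m) = 0 := by
    have := congrArg (MvPolynomial.eval 0) h
    simpa using this
  have h1 : ∀ j : Fin m, c j.castSucc = 0 := by
    intro j
    have := congrArg (MvPolynomial.eval (Pi.single j 1)) h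
    simpa [h0, Pi.single_apply] using this
  funext i
  exact Fin.lastCases h0 h1 i

theorem uu_totalDegree (F : Type) [Field F] (m : ℕ) (c : Fin (m + 1) → F) :
    (∑ i, MvPolynomial.C (c i) * uu F m i).totalDegree ≤ 1 := by
  refine MvPolynomial.totalDegree_finsetSum_le fun i _ => ?_
  refine (MvPolynomial.totalDegree_mul _ _).trans ?_
  rw [MvPolynomial.totalDegree_C, zero_add]
  refine Fin.lastCases ?_ (fun j => ?_) i
  · rw [uu_last]; simp
  · rw [uu_castSucc]; simp

theorem ff_lin {F : Type} [Field F] {m : ℕ} (q : QF F (m + 1)) (hm : 1 ≤ m)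
    (hi : i0 q ≤ m + 1 - 2) {K : Type} [Field K] [Algebra F K]
    (f : MvPolynomial (Fin m) F →ₐ[F] K)
    (hf : RingHom.ker f = Ideal.span {evR q (uu F m)})
    (c : Fin (m + 1) → F) (hc : ∑ i, algebraMap F K (c i) * f (uu F m i) = 0) : c = 0 := by
  by_contra hne
  set l := ∑ i, MvPolynomial.C (c i) * uu F m i with hl
  have hl0 : l ≠ 0 := fun h => hne (uu_lin F m c h)
  have hfl : f l = 0 := by
    rw [hl, map_sum, ← hc]
    refine Finset.sum_congr rfl fun i _ => ?_
    rw [map_mul]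
    congr 1
    exact f.commutes (c i)
  have hmem : l ∈ RingHom.ker f := hfl
  rw [hf, Ideal.mem_span_singleton] at hmem
  obtain ⟨g, hg⟩ := hmem
  have hp0 : evR q (uu F m) ≠ 0 := fun h => hl0 (by rw [hg, h, zero_mul])
  have hg0 : g ≠ 0 := fun h => hl0 (by rw [hg, h, mul_zero])
  have hdeg : (evR q (uu F m)).totalDegree ≤ 1 := by
    have h1 := uu_totalDegree F m c
    rw [← hl, hg, MvPolynomial.totalDegree_mul_of_isDomain hp0 hg0] at h1
    omega
  have hvan : ∀ v : Fin (m + 1) → F, v (Fin.last m) = 0 → evR q v = 0 := by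
    intro v hv
    let Φ : MvPolynomial (Fin m) F →ₐ[F] Polynomial F :=
      MvPolynomial.aeval fun i => Polynomial.C (v i.castSucc) * Polynomial.X
    have hΦ : (Φ (evR q (uu F m))).natDegree ≤ 1 := by
      refine MvPolynomial.aeval_natDegree_le (m := 1) (n := 1) _ hdeg _ fun i => ?_
      exact (Polynomial.natDegree_C_mul_le _ _).trans Polynomial.natDegree_X_le
    have he : Φ (evR q (uu F m)) = Polynomial.X ^ 2 * Polynomial.C (evR q v) +
        Polynomial.C (q (Fin.last m) (Fin.last m)) +
        Polynomial.X * Polynomial.C (poR q v (Pi.single (Fin.last m) 1)) := by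
      have hC1 : Polynomial.C (evR q v) = evR q (fun i => Polynomial.C (v i)) :=
        evR_map (Algebra.ofId F (Polynomial F)) q v
      have hC2 : Polynomial.C (poR q v (Pi.single (Fin.last m) 1)) =
          poR q (fun i => Polynomial.C (v i)) (Pi.single (Fin.last m) 1) := by
        have := poR_map (Algebra.ofId F (Polynomial F)) q v (Pi.single (Fin.last m) 1)
        refine this.trans ?_
        congr 1
        funext i
        by_cases h : i = Fin.last m <;> simp [Pi.single_apply, h]
      have hu : (fun i => Φ (uu F m i)) =
          (Polynomial.X : Polynomial F) • (fun i => Polynomial.C (v i)) +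
            Pi.single (Fin.last m) 1 := by
        funext i
        refine Fin.lastCases ?_ (fun j => ?_) i
        · simp [uu_last, hv]
        · simp only [uu_castSucc, Φ, MvPolynomial.aeval_X]
          rw [Pi.add_apply, Pi.smul_apply, smul_eq_mul,
            Pi.single_eq_of_ne (Fin.castSucc_lt_last j).ne, add_zero, mul_comm]
      rw [evR_map, hu, evR_add, evR_smul, poR_smul_left, evR_single', hC1, hC2]
      rfl
    have := Polynomial.coeff_eq_zero_of_natDegree_lt (lt_of_le_of_lt hΦ (by norm_num : 1 < 2))
    rw [he] at this
    simpa [Polynomial.coeff_X, Polynomial.coeff_C] using this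
  have hle : m ≤ i0 q := by
    refine le_csSup ⟨m + 1, ?_⟩ ⟨LinearMap.ker (LinearMap.proj (R := F) (φ := fun _ => F) (Fin.last m)), ?_, ?_⟩
    · rintro d ⟨W, rfl, -⟩
      exact (Submodule.finrank_le W).trans (by simp)
    · have := LinearMap.finrank_range_add_finrank_ker
        (LinearMap.proj (R := F) (φ := fun _ => F) (Fin.last m))
      rw [LinearMap.range_eq_top.mpr (LinearMap.proj_surjective _), finrank_top] at this
      simp at this
      omega
    · intro x hx
      exact hvan x hx
  omega

end QF

namespace QF

theorem deriv_evR {F : Type} [Field F] {n : ℕ} {R : Type} [CommRing R] [Algebra F R]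
    (D : Derivation F R R) (q : QF F n) (x : Fin n → R) :
    D (evR q x) = poR q (fun i => D (x i)) x := by
  have : poR q (fun i => D (x i)) x = ∑ i, ∑ j, algebraMap F R (q i j) * D (x i) * x j
      + ∑ i, ∑ j, algebraMap F R (q j i) * D (x i) * x j := by
    simp only [poR, map_add, add_mul, Finset.sum_add_distrib]
  rw [this, Finset.sum_comm (f := fun i j => algebraMap F R (q j i) * D (x i) * x j)]
  simp only [evR, map_sum, ← Finset.sum_add_distrib]
  refine Finset.sum_congr rfl fun i _ => Finset.sum_congr rfl fun j _ => ?_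
  simp only [Derivation.leibniz, Derivation.map_algebraMap, smul_eq_mul, mul_zero]
  ring

theorem ff_algInd {F : Type} [Field F] {m : ℕ} (q : QF F (m + 1))
    {K : Type} [Field K] [Algebra F K]
    (f : MvPolynomial (Fin m) F →ₐ[F] K)
    (hf : RingHom.ker f = Ideal.span {evR q (uu F m)})
    (k : Fin m) (j : Fin (m + 1)) (hb : q k.castSucc j + q j k.castSucc ≠ 0) :
    AlgebraicIndependent F (fun l : {l : Fin m // l ≠ k} => f (MvPolynomial.X l.1)) := by
  rw [algebraicIndependent_iff]
  intro g hg
  by_contra hg0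
  have h1 : f (MvPolynomial.rename Subtype.val g) = 0 := by
    rw [← hg]
    have : f.comp (MvPolynomial.rename Subtype.val) =
        MvPolynomial.aeval (fun l : {l : Fin m // l ≠ k} => f (MvPolynomial.X l.1)) := by
      ext l
      simp
    rw [← this]; rfl
  have hmem : MvPolynomial.rename Subtype.val g ∈ RingHom.ker f := h1
  have hr0 : MvPolynomial.rename Subtype.val g ≠ 0 := fun h =>
    hg0 (MvPolynomial.rename_injective _ Subtype.val_injective (h.trans (map_zero _).symm))
  rw [hf, Ideal.mem_span_singleton] at hmem
  obtain ⟨h, hh⟩ := hmem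
  have hp0 : evR q (uu F m) ≠ 0 := fun h => hr0 (by rw [hh, h, zero_mul])
  have hh0 : h ≠ 0 := fun h => hr0 (by rw [hh, h, mul_zero])
  have hd : (MvPolynomial.rename Subtype.val g).degreeOf k = 0 := by
    by_contra hne
    rw [← ne_eq, ← MvPolynomial.mem_vars_iff_degreeOf_ne_zero] at hne
    obtain ⟨l, -, hl⟩ := MvPolynomial.mem_vars_rename _ _ hne
    exact l.2 hl
  rw [hh, MvPolynomial.degreeOf_mul_eq hp0 hh0] at hd
  have hd' : k ∉ (evR q (uu F m)).vars := by
    rw [MvPolynomial.mem_vars_iff_degreeOf_ne_zero]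
    omega
  have hpd := MvPolynomial.pderiv_eq_zero_of_notMem_vars hd'
  have hs : (fun i => MvPolynomial.pderiv k (uu F m i)) = Pi.single k.castSucc 1 := by
    classical
    funext i
    refine Fin.lastCases ?_ (fun l => ?_) i
    · rw [uu_last, Pi.single_eq_of_ne (Fin.castSucc_lt_last k).ne']
      simp
    · rw [uu_castSucc, MvPolynomial.pderiv_X]
      simp [Pi.single_apply]
  rw [deriv_evR, hs, poR_single'] at hpd
  exact hb (congrFun (uu_lin F m _ hpd) j)

theorem ff_sep {F : Type} [Field F] [CharP F 2] {m : ℕ} (q : QF F (m + 1)) (hm : 1 ≤ m)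
    (hi : i0 q ≤ m + 1 - 2) {K : Type} [Field K] [Algebra F K]
    (f : MvPolynomial (Fin m) F →ₐ[F] K)
    (hf : RingHom.ker f = Ideal.span {evR q (uu F m)})
    (ht : IntermediateField.adjoin F (Set.range fun i => f (MvPolynomial.X i)) = ⊤)
    (k : Fin m) (j : Fin (m + 1)) (hb : q k.castSucc j + q j k.castSucc ≠ 0) :
    let E := IntermediateField.adjoin F
      (Set.range (fun l : {l : Fin m // l ≠ k} => f (MvPolynomial.X l.1)))
    Algebra.IsSeparable E K ∧ Module.Finite E K := by
  intro E
  set x : Fin (m + 1) → K := fun i => f (uu F m i) with hx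
  have hqx : evR q x = 0 := by
    rw [hx, ← evR_map]
    have : evR q (uu F m) ∈ RingHom.ker f := by
      rw [hf]; exact Ideal.subset_span rfl
    exact this
  set k' := k.castSucc with hk'
  let x' : Fin (m + 1) → K := Function.update x k' 0
  have hxx : x = x k' • Pi.single k' 1 + x' := by
    funext i
    by_cases h : i = k'
    · subst h; simp [x']
    · simp [x', h]
  have hx'E : ∀ i, x' i ∈ E := by
    intro i
    by_cases h : i = k'
    · subst h; simp [x']
    · have : x' i = x i := by simp [x', h]
      rw [this]
      revert h
      refine Fin.lastCases (fun _ => ?_) (fun l h => ?_) i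
      · simp [hx, uu_last]
      · have hl : l ≠ k := fun e => h (by rw [e])
        simp only [hx, uu_castSucc]
        exact IntermediateField.subset_adjoin _ _ ⟨⟨l, hl⟩, rfl⟩
  have hsE : ∀ i, (Pi.single k' 1 : Fin (m + 1) → K) i ∈ E := by
    intro i
    by_cases h : i = k'
    · subst h; simp
    · simp [h]
  have hchar : (2 : F) = 0 := CharTwo.two_eq_zero
  have hb0 : poR q (Pi.single k' 1) x' ≠ 0 := by
    rw [poR_single']
    intro h0
    have hne : j ≠ k' := by
      intro e
      apply hb
      rw [e, ← two_mul, hchar, zero_mul]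
    have h1 : ∑ i, algebraMap F K (q k' i + q i k') * f (uu F m i) = 0 := by
      rw [← h0]
      refine Finset.sum_congr rfl fun i _ => ?_
      by_cases h : i = k'
      · subst h; rw [← two_mul, hchar, zero_mul, map_zero, zero_mul, zero_mul]
      · simp [x', h, hx]
    exact hb (congrFun (ff_lin q hm hi f hf _ h1) j)
  let b : E := ⟨poR q (Pi.single k' 1) x', poR_mem E q _ _ hsE hx'E⟩
  let c : E := ⟨evR q x', evR_mem E q _ hx'E⟩
  let P : Polynomial E := Polynomial.C (algebraMap F E (q k' k')) * Polynomial.X ^ 2 +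
    Polynomial.C b * Polynomial.X + Polynomial.C c
  have hbne : b ≠ 0 := fun h => hb0 (congrArg Subtype.val h)
  have hPx : Polynomial.aeval (x k') P = 0 := by
    have h1 := hqx
    rw [hxx, evR_add, evR_smul, evR_single', poR_smul_left] at h1
    simp only [P, map_add, map_mul, Polynomial.aeval_C, Polynomial.aeval_X, map_pow]
    rw [← h1]
    simp only [← IsScalarTower.algebraMap_apply]
    change _ * _ + poR q (Pi.single k' 1) x' * _ + evR q x' = _
    ring
  have h2E : (2 : E) = 0 := by
    rw [← map_ofNat (algebraMap F E) 2, hchar, map_zero]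
  have hder : P.derivative = Polynomial.C b := by
    simp [P, Polynomial.derivative_pow, h2E]
  have hPsep : P.Separable := by
    rw [Polynomial.separable_def, hder]
    exact ⟨0, Polynomial.C b⁻¹, by
      rw [zero_mul, zero_add, ← Polynomial.C_mul, inv_mul_cancel₀ hbne, Polynomial.C_1]⟩
  have hP0 : P ≠ 0 := hPsep.ne_zero
  have hxsep : IsSeparable E (x k') := hPsep.of_dvd (minpoly.dvd E _ hPx)
  have htop : IntermediateField.adjoin E {x k'} = ⊤ := by
    rw [eq_top_iff]
    intro y _
    have hy : y ∈ IntermediateField.adjoin F (Set.range fun i => f (MvPolynomial.X i)) := by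
      rw [ht]; trivial
    have hle : IntermediateField.adjoin F (Set.range fun i => f (MvPolynomial.X i)) ≤
        (IntermediateField.adjoin E {x k'}).restrictScalars F := by
      rw [IntermediateField.adjoin_le_iff]
      rintro _ ⟨l, rfl⟩
      by_cases h : l = k
      · subst h
        have : f (MvPolynomial.X l) = x k' := by simp [hx, hk', uu_castSucc]
        show f (MvPolynomial.X l) ∈ IntermediateField.adjoin E {x k'}
        rw [this]
        exact IntermediateField.mem_adjoin_simple_self E _
      · have hE : f (MvPolynomial.X l) ∈ E :=
          IntermediateField.subset_adjoin _ _ ⟨⟨l, h⟩, rfl⟩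
        exact (IntermediateField.adjoin E {x k'}).algebraMap_mem ⟨_, hE⟩
    exact hle hy
  constructor
  · have h1 := (IntermediateField.isSeparable_adjoin_simple_iff_isSeparable E K).2 hxsep
    rw [htop] at h1
    exact Algebra.IsSeparable.of_algHom E _ (IntermediateField.topEquiv (F := E) (E := K)).symm.toAlgHom
  · have h1 := IntermediateField.adjoin.finiteDimensional hxsep.isIntegral
    rw [htop] at h1
    exact Module.Finite.equiv (IntermediateField.topEquiv (F := E) (E := K)).toLinearEquiv

theorem sep_of_not_quasi {F : Type} [Field F] [CharP F 2] {m : ℕ} (q : QF F (m + 1)) (hm : 1 ≤ m)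
    (hi : i0 q ≤ m + 1 - 2) {K : Type} [Field K] [Algebra F K]
    (f : MvPolynomial (Fin m) F →ₐ[F] K)
    (hf : RingHom.ker f = Ideal.span {evR q (uu F m)})
    (ht : IntermediateField.adjoin F (Set.range fun i => f (MvPolynomial.X i)) = ⊤)
    (k : Fin m) (j : Fin (m + 1)) (hb : q k.castSucc j + q j k.castSucc ≠ 0) :
    IsSepExt F K := by
  intro L _ _ _
  obtain ⟨h1, h2⟩ := ff_sep q hm hi f hf ht k j hb
  exact isReduced_tensor_of_sep F K _ (ff_algInd q f hf k j hb) h1 h2 L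

theorem exists_castSucc {F : Type} [Field F] {m : ℕ} (q : QF F (m + 1))
    (i j : Fin (m + 1)) (hij : i ≠ j) (hb : q i j + q j i ≠ 0) :
    ∃ (k : Fin m) (j : Fin (m + 1)), q k.castSucc j + q j k.castSucc ≠ 0 := by
  by_cases h : i = Fin.last m
  · have hj : j ≠ Fin.last m := fun e => hij (h.trans e.symm)
    obtain ⟨k, rfl⟩ := Fin.exists_castSucc_eq.mpr hj
    exact ⟨k, i, by rwa [add_comm]⟩
  · obtain ⟨k, rfl⟩ := Fin.exists_castSucc_eq.mpr h
    exact ⟨k, j, hb⟩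

end QF

open TensorProduct
namespace QF

theorem not_sep_of_quasi {F : Type} [Field F] [CharP F 2] {n : ℕ} (q : QF F n)
    {K : Type} [Field K] [Algebra F K] (x : Fin n → K)
    (hlin : ∀ c : Fin n → F, ∑ i, algebraMap F K (c i) * x i = 0 → c = 0)
    (hx : evR q x = 0) (hq0 : ∃ v, QF.eval q v ≠ 0) (hs : IsSepExt F K)
    (hal : ∀ i j, i ≠ j → q i j + q j i = 0) : False := by
  have hex : ∀ i, ∃ s : perfectClosure F (AlgebraicClosure F), s ^ 2 = algebraMap F _ (q i i) := by
    intro i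
    obtain ⟨s, hs⟩ := IsAlgClosed.exists_pow_nat_eq
      (algebraMap F (AlgebraicClosure F) (q i i)) (n := 2) (by norm_num)
    have : ExpChar F 2 := ExpChar.prime Nat.prime_two
    refine ⟨⟨s, (mem_perfectClosure_iff_pow_mem (F := F) 2).2 ⟨1, q i i, ?_⟩⟩, ?_⟩
    · rw [← hs]; rfl
    · exact Subtype.ext hs
  choose s0 hs20 using hex
  obtain ⟨L, _, _, hL, s, hs2⟩ : ∃ (L : Type) (_ : Field L) (_ : Algebra F L)
      (_ : IsPurelyInseparable F L) (s : Fin n → L), ∀ i, s i ^ 2 = algebraMap F L (q i i) :=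
    ⟨perfectClosure F (AlgebraicClosure F), inferInstance, inferInstance, inferInstance, s0, hs20⟩
  have hred : IsReduced (K ⊗[F] L) :=
    hs L hL
  have hcp : CharP (K ⊗[F] L) 2 :=
    charP_of_injective_algebraMap
      (algebraMap F (K ⊗[F] L)).injective 2
  have ht2 : (∑ i, x i ⊗ₜ[F] s i) ^ 2 = 0 := by
    rw [sum_pow_char 2]
    have : ∀ i, (x i ⊗ₜ[F] s i) ^ 2 = (algebraMap F K (q i i) * x i ^ 2) ⊗ₜ[F]
        (1 : L) := by
      intro i
      rw [Algebra.TensorProduct.tmul_pow, hs2, Algebra.algebraMap_eq_smul_one,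
        TensorProduct.tmul_smul, TensorProduct.smul_tmul', Algebra.smul_def]
    rw [Finset.sum_congr rfl fun i _ => this i, ← TensorProduct.sum_tmul, ← evR_of_alt q hal, hx,
      TensorProduct.zero_tmul]
  have ht : (∑ i, x i ⊗ₜ[F] s i) = 0 := pow_eq_zero_iff (two_ne_zero) |>.1 ht2
  let X : (Fin n → F) →ₗ[F] K := Fintype.linearCombination F x
  have hX : LinearMap.ker X = ⊥ := by
    rw [LinearMap.ker_eq_bot']
    intro c hc
    apply hlin
    rw [← hc]
    simp [X, Fintype.linearCombination_apply, Algebra.smul_def]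
  obtain ⟨g, hg⟩ := X.exists_leftInverse_of_injective hX
  have hgx : ∀ i, g (x i) = Pi.single i 1 := by
    intro i
    have : X (Pi.single i 1) = x i := by
      simp [X]
    rw [← this]
    exact LinearMap.congr_fun hg _
  have hs0 : ∀ i, s i = 0 := by
    intro i
    have := congrArg (TensorProduct.lid F _ ∘
      (LinearMap.rTensor L (LinearMap.proj i ∘ₗ g))) ht
    simpa [hgx, Pi.single_apply] using this
  obtain ⟨v, hv⟩ := hq0
  apply hv
  rw [eval_eq_evR, evR_of_alt q hal]
  refine Finset.sum_eq_zero fun i _ => ?_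
  have h1 := hs2 i
  rw [hs0, zero_pow two_ne_zero] at h1
  have h2 : q i i = 0 := (algebraMap F L).injective
    (by rw [← h1, map_zero])
  rw [h2, map_zero, zero_mul]

end QF

namespace QF

theorem poR_const_zero {F : Type} [Field F] {n : ℕ} {R : Type} [CommRing R] [Algebra F R]
    (q : QF F n) (v : Fin n → F) (h : ∀ w, poR q v w = 0) (y : Fin n → R) :
    poR q (fun i => algebraMap F R (v i)) y = 0 := by
  rw [poR, Finset.sum_comm]
  refine Finset.sum_eq_zero fun j _ => ?_
  have h1 := h (Pi.single j 1)
  rw [poR_comm, poR_single'] at h1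
  rw [← Finset.sum_mul]
  have h2 := congrArg (algebraMap F R) h1
  rw [map_sum, map_zero] at h2
  rw [Finset.sum_congr rfl (g := fun i => algebraMap F R
    (algebraMap F F (q j i + q i j) * v i)), h2, zero_mul]
  intro i _
  rw [map_mul, add_comm]
  rfl

theorem coeff_evR {F : Type} [Field F] {n : ℕ} {σ : Type} (q : QF F n)
    (A : Finset (σ →₀ ℕ)) (e : σ →₀ ℕ) (hu : UniqueAdd A A e e)
    (P : Fin n → MvPolynomial σ F) (hP : ∀ i, (P i).support ⊆ A) :
    (evR q P).coeff (e + e) = evR q (fun i => (P i).coeff e) := by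
  classical
  simp only [evR, MvPolynomial.coeff_sum]
  refine Finset.sum_congr rfl fun i _ => Finset.sum_congr rfl fun j _ => ?_
  rw [mul_assoc]
  change MvPolynomial.coeff (e + e) (MvPolynomial.C (q i j) * (P i * P j)) = q i j * _ * _
  rw [MvPolynomial.coeff_C_mul, MvPolynomial.coeff_mul, Finset.sum_eq_single (e, e), mul_assoc]
  · rintro ⟨a, b⟩ hab hne
    by_contra h0
    have ha : a ∈ A := hP i (MvPolynomial.mem_support_iff.2 (left_ne_zero_of_mul h0))
    have hb : b ∈ A := hP j (MvPolynomial.mem_support_iff.2 (right_ne_zero_of_mul h0))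
    obtain ⟨rfl, rfl⟩ := hu ha hb (Finset.HasAntidiagonal.mem_antidiagonal.1 hab)
    exact hne rfl
  · intro h
    exact (h (by rw [Finset.HasAntidiagonal.mem_antidiagonal])).elim

theorem coeffs_isotropic {F : Type} [Field F] {n : ℕ} {σ : Type} (q : QF F n)
    (H : ∀ v : Fin n → F, evR q v = 0 → ∀ w, poR q v w = 0) (A : Finset (σ →₀ ℕ)) :
    ∀ P : Fin n → MvPolynomial σ F, (∀ i, (P i).support ⊆ A) → evR q P = 0 →
      ∀ e, evR q (fun i => (P i).coeff e) = 0 := by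
  classical
  induction A using Finset.strongInduction with
  | H A ih =>
    intro P hP h0 e'
    rcases A.eq_empty_or_nonempty with rfl | hA
    · have : ∀ i, P i = 0 := fun i => by
        rw [← MvPolynomial.support_eq_empty]
        exact Finset.subset_empty.1 (hP i)
      simp [this, evR]
    · obtain ⟨e, he, b, hb, hu⟩ := UniqueSums.uniqueAdd_of_nonempty hA hA
      have hbe : b = e := (hu hb he (add_comm b e)).1
      subst hbe
      set v : Fin n → F := fun i => (P i).coeff b with hv
      have hqv : evR q v = 0 := by
        rw [← coeff_evR q A b hu P hP, h0, MvPolynomial.coeff_zero]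
      by_cases hee : e' = b
      · rw [hee]; exact hqv
      set M : MvPolynomial σ F := MvPolynomial.monomial b 1 with hM
      set V : Fin n → MvPolynomial σ F := fun i => algebraMap F _ (v i) with hV
      set P' : Fin n → MvPolynomial σ F := P - M • V with hP'
      have hc : ∀ i d, (P' i).coeff d = if d = b then 0 else (P i).coeff d := by
        intro i d
        have : (M • V) i = MvPolynomial.monomial b (v i) := by
          change MvPolynomial.monomial b 1 * MvPolynomial.C (v i) = _
          rw [mul_comm, MvPolynomial.C_mul_monomial, mul_one]
        rw [hP', Pi.sub_apply, this, MvPolynomial.coeff_sub, MvPolynomial.coeff_monomial]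
        by_cases hd : d = b
        · subst hd; simp [hv]
        · rw [if_neg hd, if_neg (Ne.symm hd), sub_zero]
      have hPP : P = M • V + P' := by rw [hP']; abel
      have hVV : evR q V = 0 := by
        have := evR_map (Algebra.ofId F (MvPolynomial σ F)) q v
        rw [hqv, map_zero] at this
        exact this.symm
      have h0' : evR q P' = 0 := by
        rw [hPP, evR_add, evR_smul, poR_smul_left, hVV, poR_const_zero q v (H v hqv)] at h0
        simpa using h0
      have := ih (A.erase b) (Finset.erase_ssubset he) P' (by
        intro i d hd
        rw [MvPolynomial.mem_support_iff, hc] at hd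
        have hdb : d ≠ b := fun h => hd (if_pos h)
        rw [if_neg hdb] at hd
        exact Finset.mem_erase.2 ⟨hdb, hP i (MvPolynomial.mem_support_iff.2 hd)⟩) h0' e'
      simpa only [hc, if_neg hee] using this

theorem isotropic_of_purelyTrans {F : Type} [Field F] {n : ℕ} (q : QF F n)
    {K : Type} [Field K] [Algebra F K] (x : Fin n → K)
    (hlin : ∀ c : Fin n → F, ∑ i, algebraMap F K (c i) * x i = 0 → c = 0)
    (hx : evR q x = 0) (hq0 : ∃ v, QF.eval q v ≠ 0) (hs : IsPurelyTranscendentalExt F K) :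
    ∃ v w : Fin n → F, evR q v = 0 ∧ poR q v w ≠ 0 := by
  classical
  by_contra hcon
  push Not at hcon
  obtain ⟨s, hs, htop⟩ := hs
  have hinj : Function.Injective (MvPolynomial.aeval (R := F) (fun x : s => (x : K))) := hs
  have hrep : ∀ i, ∃ a b : MvPolynomial s F, MvPolynomial.aeval (fun x : s => (x : K)) b ≠ 0 ∧
      MvPolynomial.aeval (fun x : s => (x : K)) b * x i =
        MvPolynomial.aeval (fun x : s => (x : K)) a := by
    intro i
    have hm : x i ∈ IntermediateField.adjoin F s := by rw [htop]; trivial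
    obtain ⟨a, b, hab⟩ := (IntermediateField.mem_adjoin_iff F _).1 hm
    by_cases hb : MvPolynomial.aeval (fun x : s => (x : K)) b = 0
    · refine ⟨0, 1, by simp, ?_⟩
      have : x i = 0 := by rw [hab]; exact div_eq_zero_iff.2 (Or.inr hb)
      simp [this]
    · refine ⟨a, b, hb, ?_⟩
      rw [hab]
      exact mul_div_cancel₀ _ hb
  choose a b hb hab using hrep
  set φ := MvPolynomial.aeval (R := F) (fun x : s => (x : K)) with hφ
  let h : K := ∏ i, φ (b i)
  have hh : h ≠ 0 := Finset.prod_ne_zero_iff.2 fun i _ => hb i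
  let P : Fin n → MvPolynomial s F := fun i => a i * ∏ j ∈ Finset.univ.erase i, b j
  have hP : (fun i => φ (P i)) = h • x := by
    funext i
    have : h = φ (b i) * ∏ j ∈ Finset.univ.erase i, φ (b j) :=
      (Finset.mul_prod_erase Finset.univ (fun j => φ (b j)) (Finset.mem_univ i)).symm
    rw [Pi.smul_apply, smul_eq_mul, this, mul_right_comm, hab]
    simp only [P, map_mul, map_prod]
  have hP0 : evR q P = 0 := by
    apply hinj
    rw [evR_map, map_zero, hP, evR_smul, hx, mul_zero]
  have hco := coeffs_isotropic q (fun v hv w => hcon v w hv) (Finset.univ.biUnion fun i => (P i).support) P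
    (fun i => Finset.subset_biUnion_of_mem (fun i => (P i).support) (Finset.mem_univ i)) hP0
  let D : Submodule F (Fin n → F) :=
    { carrier := {v | evR q v = 0}
      zero_mem' := by simp [evR]
      add_mem' := by
        intro v w hv hw
        simp only [Set.mem_ofPred_eq] at *
        rw [evR_add, hv, hw, hcon v w hv]
        simp
      smul_mem' := by
        intro c v hv
        simp only [Set.mem_ofPred_eq] at *
        rw [evR_smul, hv, mul_zero] }
  have hD : D < ⊤ := by
    rw [lt_top_iff_ne_top]
    intro e
    obtain ⟨v, hv⟩ := hq0
    apply hv
    have : v ∈ D := by rw [e]; trivial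
    exact this
  obtain ⟨l, hl0, hl⟩ := D.exists_le_ker_of_lt_top hD
  have hlv : ∀ v : Fin n → F, l v = ∑ i, l (Pi.single i 1) * v i := by
    intro v
    rw [LinearMap.pi_apply_eq_sum_univ l v]
    refine Finset.sum_congr rfl fun i _ => ?_
    rw [smul_eq_mul, mul_comm]
    congr 2
    funext j
    simp [Pi.single_apply, eq_comm]
  have hz : ∑ i, MvPolynomial.C (l (Pi.single i 1)) * P i = 0 := by
    ext e
    rw [MvPolynomial.coeff_sum]
    simp only [MvPolynomial.coeff_C_mul, MvPolynomial.coeff_zero]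
    have := hlv (fun i => (P i).coeff e)
    rw [← this]
    exact hl (hco e)
  have hz2 := congrArg φ hz
  rw [map_sum, map_zero] at hz2
  have hz3 : h * ∑ i, algebraMap F K (l (Pi.single i 1)) * x i = 0 := by
    rw [← hz2, Finset.mul_sum]
    refine Finset.sum_congr rfl fun i _ => ?_
    have h1 := congrFun hP i
    simp only [Pi.smul_apply, smul_eq_mul] at h1
    rw [map_mul, h1, hφ, MvPolynomial.aeval_C]
    ring
  have hz4 := hlin _ ((mul_eq_zero.1 hz3).resolve_left hh)
  apply hl0
  ext i
  exact congrFun hz4 i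

end QF

namespace QF

theorem exists_offdiag {F : Type} [Field F] [CharP F 2] {n : ℕ} (q : QF F n) (v w : Fin n → F)
    (h : poR q v w ≠ 0) : ∃ i j, i ≠ j ∧ q i j + q j i ≠ 0 := by
  by_contra hcon
  push Not at hcon
  apply h
  refine Finset.sum_eq_zero fun i _ => Finset.sum_eq_zero fun j _ => ?_
  by_cases hij : i = j
  · subst hij
    rw [← two_mul, CharTwo.two_eq_zero, zero_mul, map_zero, zero_mul, zero_mul]
  · rw [hcon i j hij, map_zero, zero_mul, zero_mul]

theorem poR_self {F : Type} [Field F] [CharP F 2] {n : ℕ} (q : QF F n) {K : Type} [Field K]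
    [Algebra F K] (v : Fin n → K) : poR q v v = 0 := by
  have hchar : (2 : K) = 0 := by
    rw [← map_ofNat (algebraMap F K) 2, CharTwo.two_eq_zero, map_zero]
  have h1 := evR_add q v v
  rw [← two_smul K v, hchar, evR_smul, ← two_mul, hchar] at h1
  simpa using h1.symm

theorem purelyTrans_of_isotropic {F : Type} [Field F] [CharP F 2] {m : ℕ} (q : QF F (m + 1))
    (hm : 1 ≤ m) {K : Type} [Field K] [Algebra F K] (x : Fin (m + 1) → K)
    (hlin : ∀ c : Fin (m + 1) → F, ∑ i, algebraMap F K (c i) * x i = 0 → c = 0)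
    (hx : evR q x = 0) (hlast : x (Fin.last m) = 1)
    (htop : ∀ E : IntermediateField F K, (∀ i, x i ∈ E) → E = ⊤)
    (k : Fin m) (u : {l : Fin m // l ≠ k} → K) (hu : AlgebraicIndependent F u)
    (v w : Fin (m + 1) → F) (hv : evR q v = 0) (hvw : poR q v w ≠ 0) :
    IsPurelyTranscendentalExt F K := by
  classical
  set V : Fin (m + 1) → K := fun i => algebraMap F K (v i) with hV
  have hVq : evR q V = 0 := by
    have := evR_map (Algebra.ofId F K) q v
    rw [hv, map_zero] at this
    exact this.symm
  have hVx : poR q V x ≠ 0 := by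
    intro h0
    have h1 : ∑ j, algebraMap F K (poR q v (Pi.single j 1)) * x j = 0 := by
      rw [← h0, poR, Finset.sum_comm]
      refine Finset.sum_congr rfl fun j _ => ?_
      rw [poR_comm, poR_single', map_sum, Finset.sum_mul]
      refine Finset.sum_congr rfl fun i _ => ?_
      rw [map_mul, add_comm]
      rfl
    have h2 := hlin _ h1
    apply hvw
    have h3 : poR q v w = ∑ j, poR q v (Pi.single j 1) * w j := by
      rw [poR, Finset.sum_comm]
      refine Finset.sum_congr rfl fun j _ => ?_
      rw [poR_comm, poR_single', Finset.sum_mul]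
      refine Finset.sum_congr rfl fun i _ => ?_
      rw [add_comm]
    rw [h3]
    refine Finset.sum_eq_zero fun j _ => ?_
    rw [show poR q v (Pi.single j 1) = 0 from congrFun h2 j, zero_mul]
  obtain ⟨r, hr⟩ : ∃ r, v r ≠ 0 := by
    by_contra hcon
    push Not at hcon
    apply hvw
    simp [poR, hcon]
  have hVr : V r ≠ 0 := fun h => hr ((algebraMap F K).injective (h.trans (map_zero _).symm))
  set y : K := x r / V r with hy
  set y' : Fin (m + 1) → K := x - y • V with hy'
  have hxy : x = y • V + y' := by rw [hy']; abel
  have hy'r : y' r = 0 := by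
    simp [hy', hy, hVr]
  have hVy' : poR q V y' ≠ 0 := by
    intro h
    apply hVx
    rw [hxy, poR_add_right, poR_smul_right, poR_self, h]
    simp
  have heq : y * poR q V y' + evR q y' = 0 := by
    have h1 := hx
    rw [hxy, evR_add, evR_smul, poR_smul_left, hVq] at h1
    rw [← h1]; ring
  have : Nontrivial (Fin (m + 1)) := Fin.nontrivial_iff_two_le.2 (by omega)
  obtain ⟨t, htr⟩ := exists_ne r
  have hyt : y' t ≠ 0 := by
    intro h
    have h1 : ∑ i, algebraMap F K ((Pi.single t (v r) - Pi.single r (v t) : Fin (m + 1) → F) i)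
        * x i = V r * y' t := by
      simp only [Pi.sub_apply, map_sub, sub_mul, Finset.sum_sub_distrib]
      rw [Finset.sum_eq_single t, Finset.sum_eq_single r]
      · simp only [Pi.single_eq_same, hy', hy, Pi.sub_apply, Pi.smul_apply, smul_eq_mul]
        change V r * x t - V t * x r = _
        field_simp
      · intro b _ hb; simp [hb]
      · simp
      · intro b _ hb; simp [hb]
      · simp
    rw [h, mul_zero] at h1
    have h2 := congrFun (hlin _ h1) t
    simp [htr] at h2
    exact hr h2
  set z : Fin (m + 1) → K := (y' t)⁻¹ • y' with hz
  let g : {a : Fin (m + 1) // a ≠ r ∧ a ≠ t} → K := fun a => z a.1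
  have hzt : z t = 1 := by simp [hz, hyt]
  have hzr : z r = 0 := by simp [hz, hy'r]
  have hgtop : IntermediateField.adjoin F (Set.range g) = ⊤ := by
    set E := IntermediateField.adjoin F (Set.range g)
    have hzE : ∀ i, z i ∈ E := by
      intro i
      by_cases h1 : i = r
      · rw [h1, hzr]; exact zero_mem _
      by_cases h2 : i = t
      · rw [h2, hzt]; exact one_mem _
      exact IntermediateField.subset_adjoin _ _ ⟨⟨i, h1, h2⟩, rfl⟩
    have hVE : ∀ i, V i ∈ E := fun i => E.algebraMap_mem _
    have hyE : y * (y' t)⁻¹ ∈ E := by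
      have h1 : y * (y' t)⁻¹ = - evR q z / poR q V z := by
        rw [hz, evR_smul, poR_smul_right]
        have : evR q y' = - (y * poR q V y') := by linear_combination heq
        rw [this]
        field_simp
      rw [h1]
      exact div_mem (neg_mem (evR_mem E q _ hzE)) (poR_mem E q _ _ hVE hzE)
    have hxE : ∀ i, x i * (y' t)⁻¹ ∈ E := by
      intro i
      have : x i * (y' t)⁻¹ = y * (y' t)⁻¹ * V i + z i := by
        have h1 := congrFun hxy i
        simp only [Pi.add_apply, Pi.smul_apply, smul_eq_mul] at h1
        simp only [hz, Pi.smul_apply, smul_eq_mul]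
        rw [h1]; ring
      rw [this]
      exact add_mem (mul_mem hyE (hVE i)) (hzE i)
    have hinv : (y' t)⁻¹ ∈ E := by
      have := hxE (Fin.last m)
      rwa [hlast, one_mul] at this
    apply htop
    intro i
    have := div_mem (hxE i) hinv
    rwa [mul_div_cancel_right₀ _ (inv_ne_zero hyt)] at this
  have halg : Algebra.IsAlgebraic (Algebra.adjoin F (Set.range g)) K := by
    refine ⟨fun a => ?_⟩
    have ha : a ∈ IntermediateField.adjoin F (Set.range g) := by rw [hgtop]; trivial
    obtain ⟨p, s, hps⟩ := (IntermediateField.mem_adjoin_range_iff F g a).1 ha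
    have hmem : ∀ p : MvPolynomial {a : Fin (m + 1) // a ≠ r ∧ a ≠ t} F,
        IsAlgebraic (Algebra.adjoin F (Set.range g)) (MvPolynomial.aeval g p) := by
      intro p
      have h1 : MvPolynomial.aeval g p ∈ Algebra.adjoin F (Set.range g) := by
        rw [Algebra.adjoin_range_eq_range_aeval]
        exact ⟨p, rfl⟩
      exact isAlgebraic_algebraMap (⟨_, h1⟩ : Algebra.adjoin F (Set.range g))
    rw [hps, div_eq_mul_inv]
    exact (hmem p).mul (hmem s).inv
  have hcard : Cardinal.mk {a : Fin (m + 1) // a ≠ r ∧ a ≠ t} ≤ Algebra.trdeg F K := by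
    refine le_trans (le_of_eq ?_) hu.cardinalMk_le_trdeg
    rw [Cardinal.mk_fintype, Cardinal.mk_fintype]
    congr 1
    rw [Fintype.card_subtype_compl, Fintype.card_fin, Fintype.card_subtype_eq,
      Fintype.card_subtype]
    have : (Finset.univ.filter fun a : Fin (m + 1) => a ≠ r ∧ a ≠ t) =
        (Finset.univ.erase r).erase t := by
      ext a; simp [and_comm]
    rw [this, Finset.card_erase_of_mem (by simp [htr]), Finset.card_erase_of_mem (by simp)]
    simp
  have hbas := Algebra.IsAlgebraic.isTranscendenceBasis_of_le_trdeg_of_finite F g hcard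
  exact ⟨Set.range g, AlgebraicIndependent.coe_range hbas.1, hgtop⟩

end QF

/-- Lemma 2.2: let `φ` be a nonzero quadratic form of dimension `≥ 2` over
a field `F` of characteristic 2 with `i₀(φ) ≤ dim φ - 2` (so that the projective quadric
`X_φ` is nonempty and integral), and let `K` be (a model of) the function field `F(φ)`.
Then (1) `F(φ)/F` is separable iff `φ` is not quasilinear; (2) `F(φ)/F` is purely
transcendental iff `i_W(φ) > 0`. -/
theorem statement1 (F : Type) [Field F] [CharP F 2] {n : ℕ} (q : QF F n)
    (hn : 2 ≤ n) (hq0 : ∃ x, QF.eval q x ≠ 0) (hi : QF.i0 q ≤ n - 2) :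
    ∀ (K : Type) [Field K] [Algebra F K], QF.IsFunctionField q K →
      ((QF.IsSepExt F K ↔ ¬ QF.IsQuasilinear q) ∧
        (QF.IsPurelyTranscendentalExt F K ↔ 0 < QF.wittIndex q)) := by
  intro K _ _ hK
  obtain ⟨m, rfl⟩ : ∃ m, n = m + 1 := ⟨n - 1, by omega⟩
  have hm : 1 ≤ m := by omega
  obtain ⟨f, hf, ht⟩ := hK
  have hf' : RingHom.ker f = Ideal.span {QF.evR q (QF.uu F m)} := hf
  have hlin := QF.ff_lin q hm hi f hf'
  have hx : QF.evR q (fun i => f (QF.uu F m i)) = 0 := by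
    rw [← QF.evR_map]
    have : QF.evR q (QF.uu F m) ∈ RingHom.ker f := by
      rw [hf']; exact Ideal.subset_span rfl
    exact this
  refine ⟨⟨fun hs hq => ?_, fun hq => ?_⟩, ⟨fun hs => ?_, fun hw => ?_⟩⟩
  · exact QF.not_sep_of_quasi q _ hlin hx hq0 hs ((QF.isQuasilinear_iff q).1 hq)
  · rw [QF.isQuasilinear_iff] at hq
    push Not at hq
    obtain ⟨i, j, hij, hb⟩ := hq
    obtain ⟨k, j, hb⟩ := QF.exists_castSucc q i j hij hb
    exact QF.sep_of_not_quasi q hm hi f hf' ht k j hb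
  · exact (QF.wittIndex_pos_iff q).2 (QF.isotropic_of_purelyTrans q _ hlin hx hq0 hs)
  · obtain ⟨v, w, hv, hvw⟩ := (QF.wittIndex_pos_iff q).1 hw
    obtain ⟨i, j, hij, hb⟩ := QF.exists_offdiag q v w hvw
    obtain ⟨k, j, hb⟩ := QF.exists_castSucc q i j hij hb
    refine QF.purelyTrans_of_isotropic q hm _ hlin hx ?_ ?_ k _ (QF.ff_algInd q f hf' k j hb)
      v w hv hvw
    · rw [QF.uu_last, map_one]
    · intro E hE
      rw [eq_top_iff, ← ht]
      refine (IntermediateField.adjoin_le_iff).2 ?_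
      rintro _ ⟨i, rfl⟩
      have := hE i.castSucc
      rwa [QF.uu_castSucc] at this
end

section
/- Let φ be a nondefective quadratic form of type (r,s) over F. Then there exists a unique integer 0 ≤ h_nd ≤ h (where h is the Knebusch height of φ) such that j_{h_nd}(φ) = r. Moreover, {j_t(φ) : 0 ≤ t ≤ h_nd} = {i_W(φ_K) : K/F a separable field extension} = {i₀(φ_K) : K/F a field extension with i_d(φ_K) = 0}. -/
/-!  Common framework: quadratic forms over a field of characteristic 2, presented by
coefficient matrices, together with the standard invariants used in the paper
"Rationality of cycles modulo 2 on products of generically smooth quadrics in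
characteristic 2" by S. Scully and G. Zhu. -/

open scoped TensorProduct

namespace QF

/-- A Knebusch splitting tower `F = F₀ ⊆ F₁ ⊆ ⋯ ⊆ F_h` for the quadratic form `q` over
`F`: `F₀ = F`, `F_{t+1}` is the function field of the quadric of the anisotropic kernel
`φ_t = (q_{F_t})_an` over `F_t` (for `t < h`, where `dim φ_t ≥ 2`), and the tower
terminates at the first `h` with `dim φ_h ≤ 1`. -/
structure KnebuschTower {F : Type} [Field F] {n : ℕ} (q : QF F n) : Type 1 where
  h : ℕ
  Fld : ℕ → Type
  [fieldInst : ∀ t, Field (Fld t)]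
  [algInst : ∀ t, Algebra F (Fld t)]
  [stepInst : ∀ t, Algebra (Fld t) (Fld (t + 1))]
  [towerInst : ∀ t, IsScalarTower F (Fld t) (Fld (t + 1))]
  base_bij : Function.Bijective (algebraMap F (Fld 0))
  dims : ℕ → ℕ
  kern : ∀ t, QF (Fld t) (dims t)
  kern_spec : ∀ t, t ≤ h → IsAnisotropicPart (baseChange q (Fld t)) (kern t)
  dims_ge : ∀ t, t < h → 2 ≤ dims t
  step_ff : ∀ t, t < h → IsFunctionField (kern t) (Fld (t + 1))
  dims_last : dims h ≤ 1

attribute [instance] KnebuschTower.fieldInst KnebuschTower.algInst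
  KnebuschTower.stepInst KnebuschTower.towerInst

end QF

namespace QF

section Basics
variable {F : Type} [Field F]

lemma eval_eq_bl {n : ℕ} (q : QF F n) (x : Fin n → F) : eval q x = Matrix.toBilin' q x x := by
  rw [Matrix.toBilin'_apply]
  unfold eval
  exact Finset.sum_congr rfl fun i _ => Finset.sum_congr rfl fun j _ => by ring

lemma polar_eq_bl {n : ℕ} (q : QF F n) (x y : Fin n → F) :
    polar q x y = Matrix.toBilin' q x y + Matrix.toBilin' q y x := by
  unfold polar
  simp only [eval_eq_bl, map_add, LinearMap.add_apply]
  ring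

lemma eval_add {n : ℕ} (q : QF F n) (x y : Fin n → F) :
    eval q (x + y) = eval q x + eval q y + polar q x y := by
  unfold polar; ring

lemma eval_smul {n : ℕ} (q : QF F n) (a : F) (x : Fin n → F) :
    eval q (a • x) = a ^ 2 * eval q x := by
  simp only [eval_eq_bl, map_smul, LinearMap.smul_apply, smul_eq_mul]; ring

lemma eval_zero {n : ℕ} (q : QF F n) : eval q 0 = 0 := by
  simp [eval_eq_bl]

lemma polar_comm {n : ℕ} (q : QF F n) (x y : Fin n → F) : polar q x y = polar q y x := by
  simp only [polar_eq_bl]; ring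

/-- the polar form as a bilinear form -/
noncomputable def pb {n : ℕ} (q : QF F n) : LinearMap.BilinForm F (Fin n → F) :=
  Matrix.toBilin' q + LinearMap.flip (Matrix.toBilin' q)

lemma pb_apply {n : ℕ} (q : QF F n) (x y : Fin n → F) : pb q x y = polar q x y := by
  rw [polar_eq_bl]; rfl

lemma polar_self [CharP F 2] {n : ℕ} (q : QF F n) (x : Fin n → F) : polar q x x = 0 := by
  rw [polar_eq_bl, CharTwo.add_self_eq_zero]

lemma eval_orthSum {n m : ℕ} (q : QF F n) (q' : QF F m) (x : Fin (n + m) → F) :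
    eval (orthSum q q') x = eval q (fun i => x (Fin.castAdd m i)) +
      eval q' (fun i => x (Fin.natAdd n i)) := by
  unfold eval orthSum
  simp [Fin.sum_univ_add, Matrix.reindex_apply, Matrix.submatrix_apply]

lemma eval_binSum {r : ℕ} (a b : Fin r → F) (x : Fin (r + r) → F) :
    eval (binSum a b) x = ∑ i, (a i * x (Fin.castAdd r i) ^ 2 +
      x (Fin.castAdd r i) * x (Fin.natAdd r i) + b i * x (Fin.natAdd r i) ^ 2) := by
  unfold eval binSum
  simp [Fin.sum_univ_add, Matrix.reindex_apply, Matrix.submatrix_apply, Matrix.diagonal_apply,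
    Matrix.one_apply, Finset.sum_add_distrib, pow_two, mul_assoc, -Fin.natAdd_eq_addNat, add_assoc]

lemma eval_hyper {r : ℕ} (x : Fin (r + r) → F) :
    eval (hyper r) x = ∑ i, x (Fin.castAdd r i) * x (Fin.natAdd r i) := by
  unfold hyper
  simp [eval_binSum]

lemma eval_diag {s : ℕ} (c : Fin s → F) (x : Fin s → F) :
    eval (diag c) x = ∑ i, c i * x i ^ 2 := by
  unfold eval diag
  simp [Matrix.diagonal_apply, pow_two, mul_assoc]

lemma eval_zeroForm {d : ℕ} (x : Fin d → F) : eval (zeroForm d) x = 0 := by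
  simp [eval, zeroForm]

lemma polar_orthSum {n m : ℕ} (q : QF F n) (q' : QF F m) (x y : Fin (n + m) → F) :
    polar (orthSum q q') x y = polar q (fun i => x (Fin.castAdd m i)) (fun i => y (Fin.castAdd m i)) +
      polar q' (fun i => x (Fin.natAdd n i)) (fun i => y (Fin.natAdd n i)) := by
  unfold polar
  simp only [eval_orthSum]
  have h1 : (fun i => (x + y) (Fin.castAdd m i)) = (fun i => x (Fin.castAdd m i)) + fun i => y (Fin.castAdd m i) := rfl
  have h2 : (fun i => (x + y) (Fin.natAdd n i)) = (fun i => x (Fin.natAdd n i)) + fun i => y (Fin.natAdd n i) := rfl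
  rw [h1, h2]; ring

lemma polar_zeroForm {d : ℕ} (x y : Fin d → F) : polar (zeroForm d) x y = 0 := by
  simp [polar, eval_zeroForm]

lemma polar_binSum [CharP F 2] {r : ℕ} (a b : Fin r → F) (x y : Fin (r + r) → F) :
    polar (binSum a b) x y = ∑ i, (x (Fin.castAdd r i) * y (Fin.natAdd r i) +
      x (Fin.natAdd r i) * y (Fin.castAdd r i)) := by
  unfold polar
  simp only [eval_binSum, ← Finset.sum_sub_distrib, Pi.add_apply]
  refine Finset.sum_congr rfl fun i _ => ?_
  have h2 : (2 : F) = 0 := CharTwo.two_eq_zero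
  linear_combination (a i * x (Fin.castAdd r i) * y (Fin.castAdd r i) +
    b i * x (Fin.natAdd r i) * y (Fin.natAdd r i)) * h2

lemma polar_diag [CharP F 2] {s : ℕ} (c : Fin s → F) (x y : Fin s → F) :
    polar (diag c) x y = 0 := by
  unfold polar
  simp only [eval_diag, ← Finset.sum_sub_distrib, Pi.add_apply]
  refine Finset.sum_eq_zero fun i _ => ?_
  have h2 : (2 : F) = 0 := CharTwo.two_eq_zero
  linear_combination (c i * x i * y i) * h2

/-! isometries -/

lemma Isom.symm {n m : ℕ} {q : QF F n} {q' : QF F m} (h : Isom q q') : Isom q' q := by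
  obtain ⟨e, he⟩ := h
  exact ⟨e.symm, fun x => by rw [← he, e.apply_symm_apply]⟩

lemma Isom.trans {n m k : ℕ} {q : QF F n} {q' : QF F m} {q'' : QF F k} (h : Isom q q')
    (h' : Isom q' q'') : Isom q q'' := by
  obtain ⟨e, he⟩ := h
  obtain ⟨e', he'⟩ := h'
  exact ⟨e.trans e', fun x => by simp [he, he']⟩

lemma Isom.dim_eq {n m : ℕ} {q : QF F n} {q' : QF F m} (h : Isom q q') : n = m := by
  obtain ⟨e, _⟩ := h
  simpa using e.finrank_eq

lemma polar_isom {n m : ℕ} {q : QF F n} {q' : QF F m} {e : (Fin n → F) ≃ₗ[F] (Fin m → F)}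
    (he : ∀ x, eval q' (e x) = eval q x) (x y : Fin n → F) :
    polar q' (e x) (e y) = polar q x y := by
  unfold polar
  rw [← map_add, he, he, he]

lemma eval_map {n : ℕ} (q : QF F n) {K : Type} [Field K] (σ : F →+* K) (x : Fin n → F) :
    eval (q.map σ) (fun i => σ (x i)) = σ (eval q x) := by
  simp [eval, map_sum]

lemma map_orthSum {n m : ℕ} (q : QF F n) (q' : QF F m) {K : Type} [Field K] (σ : F →+* K) :
    (orthSum q q' : QF F (n + m)).map σ = orthSum (q.map σ) (q'.map σ) := by
  unfold orthSum
  ext i j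
  simp only [Matrix.map_apply, Matrix.reindex_apply, Matrix.submatrix_apply]
  rcases finSumFinEquiv.symm i with i | i <;> rcases finSumFinEquiv.symm j with j | j <;> simp

lemma map_binSum {r : ℕ} (a b : Fin r → F) {K : Type} [Field K] (σ : F →+* K) :
    (binSum a b).map σ = binSum (fun i => σ (a i)) (fun i => σ (b i)) := by
  unfold binSum
  ext i j
  simp only [Matrix.map_apply, Matrix.reindex_apply, Matrix.submatrix_apply]
  rcases finSumFinEquiv.symm i with i | i <;> rcases finSumFinEquiv.symm j with j | j <;>
    simp [Matrix.diagonal_apply, Matrix.one_apply, apply_ite σ]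

lemma map_hyper {r : ℕ} {K : Type} [Field K] (σ : F →+* K) :
    (hyper r : QF F (r + r)).map σ = hyper r := by
  unfold hyper
  rw [map_binSum]
  congr 1 <;> ext <;> simp

lemma map_diag {s : ℕ} (c : Fin s → F) {K : Type} [Field K] (σ : F →+* K) :
    (diag c).map σ = diag (fun i => σ (c i)) := by
  unfold diag
  ext i j
  simp [Matrix.diagonal_apply, apply_ite σ]

lemma map_zeroForm {s : ℕ} {K : Type} [Field K] (σ : F →+* K) :
    (zeroForm s : QF F s).map σ = zeroForm s := by
  unfold zeroForm
  ext i j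
  simp

/-- pull back of a form along a linear map, as a matrix -/
lemma exists_pullback {m n : ℕ} (q : QF F n) (g : (Fin m → F) →ₗ[F] (Fin n → F)) :
    ∃ q' : QF F m, ∀ x, eval q' x = eval q (g x) := by
  refine ⟨LinearMap.BilinForm.toMatrix' ((Matrix.toBilin' q).comp g g), fun x => ?_⟩
  rw [eval_eq_bl, Matrix.toBilin'_toMatrix', eval_eq_bl]
  rfl

lemma Isom.map {n m : ℕ} {q : QF F n} {q' : QF F m} (h : Isom q q') {K : Type} [Field K]
    (σ : F →+* K) : Isom (q.map σ : QF K n) (q'.map σ : QF K m) := by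
  obtain rfl := h.dim_eq
  obtain ⟨e, he⟩ := h
  -- matrix of e
  let A := LinearMap.toMatrix' (e : (Fin n → F) →ₗ[F] (Fin n → F))
  let B := LinearMap.toMatrix' (e.symm : (Fin n → F) →ₗ[F] (Fin n → F))
  have hAB : A * B = 1 := by
    simp only [A, B]; rw [← LinearMap.toMatrix'_comp]; simp
  have hBA : B * A = 1 := by
    simp only [A, B]; rw [← LinearMap.toMatrix'_comp]; simp
  have hA' : A.map σ * B.map σ = 1 := by
    rw [← Matrix.map_mul, hAB]; simp
  have hB' : B.map σ * A.map σ = 1 := by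
    rw [← Matrix.map_mul, hBA]; simp
  let E : (Fin n → K) ≃ₗ[K] (Fin n → K) := LinearEquiv.ofLinearMap
    (Matrix.toLin' (A.map σ)) (Matrix.toLin' (B.map σ))
    (by rw [← Matrix.toLin'_mul, hA', Matrix.toLin'_one])
    (by rw [← Matrix.toLin'_mul, hB', Matrix.toLin'_one])
  -- the symmetrised identity of matrices
  have h3 : ∀ i j, (A.transpose * q' * A) i j =
      Matrix.toBilin' q' (e (Pi.single i 1)) (e (Pi.single j 1)) := by
    intro i j
    have h2 : ∀ i k, e (Pi.single i 1) k = A k i := by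
      intro i k
      simp only [A]; rw [LinearMap.toMatrix'_apply]; simp [Pi.single_apply]
    rw [Matrix.toBilin'_apply]
    simp only [h2, Matrix.mul_apply, Matrix.transpose_apply, Finset.sum_mul]
    rw [Finset.sum_comm]
  have hdiag : ∀ i, (A.transpose * q' * A) i i = q i i := by
    intro i
    rw [h3, ← eval_eq_bl, he, eval_eq_bl, Matrix.toBilin'_single]
  have hoff : ∀ i j, (A.transpose * q' * A) i j + (A.transpose * q' * A) j i = q i j + q j i := by
    intro i j
    have h1 := polar_isom he (Pi.single i 1) (Pi.single j 1)
    rw [h3, h3, ← polar_eq_bl, h1, polar_eq_bl, Matrix.toBilin'_single, Matrix.toBilin'_single]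
  have key : ∀ (P Q : QF K n), (∀ i, P i i = Q i i) → (∀ i j, P i j + P j i = Q i j + Q j i) →
      ∀ x, eval P x = eval Q x := by
    intro P Q h1 h2 x
    suffices H : eval (P - Q) x = 0 by
      have : eval (P - Q) x = eval P x - eval Q x := by
        simp [eval, sub_mul, Finset.sum_sub_distrib]
      rw [this] at H
      exact sub_eq_zero.mp H
    have hz : ∀ i, (P - Q) i i = 0 := fun i => by simp [h1]
    have hs : ∀ i j, (P - Q) i j = - (P - Q) j i := fun i j => by
      simp only [Matrix.sub_apply]; linear_combination h2 i j
    unfold eval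
    rw [← Finset.sum_product']
    refine Finset.sum_involution (fun p _ => (p.2, p.1)) ?_ ?_ ?_ ?_
    · rintro ⟨i, j⟩ _
      simp only
      rw [hs i j]; ring
    · rintro ⟨i, j⟩ _ hne heq
      simp only [Prod.mk.injEq] at heq
      apply hne
      simp [heq.1, ← Matrix.sub_apply, -Matrix.sub_apply, hz]
    · simp
    · simp
  refine ⟨E, fun x => ?_⟩
  have hE : eval (q'.map σ) (E x) = eval ((A.map σ).transpose * (q'.map σ) * A.map σ) x := by
    rw [eval_eq_bl, eval_eq_bl, Matrix.toBilin'_apply', Matrix.toBilin'_apply']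
    change (A.map σ).mulVec x ⬝ᵥ (q'.map σ).mulVec ((A.map σ).mulVec x) = _
    rw [← Matrix.mulVec_mulVec, ← Matrix.mulVec_mulVec, Matrix.dotProduct_mulVec x, Matrix.vecMul_transpose]
  rw [hE]
  have hm : (A.map σ).transpose * (q'.map σ) * A.map σ = (A.transpose * q' * A).map σ := by
    rw [Matrix.map_mul, Matrix.map_mul, Matrix.transpose_map]
  rw [hm]
  apply key
  · intro i; rw [Matrix.map_apply, Matrix.map_apply, hdiag]
  · intro i j; simp only [Matrix.map_apply]; rw [← map_add, hoff, map_add]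

end Basics
end QF

namespace QF

section Index
variable {F : Type} [Field F]

/-- concatenation of vectors -/
def appL (F : Type) [Field F] (n m : ℕ) : ((Fin n → F) × (Fin m → F)) ≃ₗ[F] (Fin (n + m) → F) :=
  (LinearEquiv.sumArrowLequivProdArrow (Fin n) (Fin m) F F).symm.trans
    (LinearEquiv.funCongrLeft F F finSumFinEquiv.symm)

lemma appL_castAdd {n m : ℕ} (p : (Fin n → F) × (Fin m → F)) (i : Fin n) :
    appL F n m p (Fin.castAdd m i) = p.1 i := by
  rw [appL, LinearEquiv.trans_apply, LinearEquiv.funCongrLeft_apply, LinearMap.funLeft_apply]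
  simp only [finSumFinEquiv_symm_apply_castAdd]
  rfl

lemma appL_natAdd {n m : ℕ} (p : (Fin n → F) × (Fin m → F)) (i : Fin m) :
    appL F n m p (Fin.natAdd n i) = p.2 i := by
  rw [appL, LinearEquiv.trans_apply, LinearEquiv.funCongrLeft_apply, LinearMap.funLeft_apply]
  simp only [finSumFinEquiv_symm_apply_natAdd]
  rfl

lemma eval_orthSum_app {n m : ℕ} (q : QF F n) (q' : QF F m) (p) :
    eval (orthSum q q') (appL F n m p) = eval q p.1 + eval q' p.2 := by
  simp only [eval_orthSum, appL_castAdd, appL_natAdd]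

lemma polar_orthSum_app {n m : ℕ} (q : QF F n) (q' : QF F m) (p p') :
    polar (orthSum q q') (appL F n m p) (appL F n m p') = polar q p.1 p'.1 + polar q' p.2 p'.2 := by
  simp only [polar_orthSum, appL_castAdd, appL_natAdd]

lemma eval_hyper_app {w : ℕ} (p : (Fin w → F) × (Fin w → F)) :
    eval (hyper w) (appL F w w p) = ∑ i, p.1 i * p.2 i := by
  simp only [eval_hyper, appL_castAdd, appL_natAdd]

lemma bddAbove_aux {n : ℕ} (P : Submodule F (Fin n → F) → Prop) :
    BddAbove {d | ∃ W : Submodule F (Fin n → F), Module.finrank F W = d ∧ P W} := by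
  refine ⟨n, ?_⟩
  rintro d ⟨W, rfl, _⟩
  simpa using W.finrank_le

lemma le_i0 {n : ℕ} (q : QF F n) {U : Type*} [AddCommGroup U] [Module F U]
    (g : U →ₗ[F] (Fin n → F)) (hg : Function.Injective g) (h0 : ∀ u, eval q (g u) = 0) :
    Module.finrank F U ≤ i0 q := by
  refine le_csSup (bddAbove_aux _) ⟨LinearMap.range g, LinearMap.finrank_range_of_inj hg, ?_⟩
  rintro _ ⟨u, rfl⟩
  exact h0 u

lemma exists_i0 {n : ℕ} (q : QF F n) : ∃ W : Submodule F (Fin n → F),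
    Module.finrank F W = i0 q ∧ ∀ x ∈ W, eval q x = 0 := by
  refine Nat.sSup_mem (s := {d | ∃ W : Submodule F (Fin n → F), Module.finrank F W = d ∧
    ∀ x ∈ W, eval q x = 0}) ⟨0, ⊥, by simp, ?_⟩ (bddAbove_aux _)
  intro x hx
  rw [(Submodule.mem_bot F).mp hx, eval_zero]

lemma Isom.i0_le {n m : ℕ} {q : QF F n} {q' : QF F m} (h : Isom q q') : i0 q ≤ i0 q' := by
  obtain ⟨e, he⟩ := h
  obtain ⟨W, hW, h0⟩ := exists_i0 q
  rw [← hW]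
  refine le_i0 q' (e.toLinearMap ∘ₗ W.subtype) (e.injective.comp W.injective_subtype) ?_
  intro u
  simp [he, h0]

/-- Nondefectivity without suprema. -/
def ND {n : ℕ} (q : QF F n) : Prop :=
  ∀ x, eval q x = 0 → (∀ y, polar q x y = 0) → x = 0

lemma polar_smul_left {n : ℕ} (q : QF F n) (a : F) (x y : Fin n → F) :
    polar q (a • x) y = a * polar q x y := by
  rw [← pb_apply, ← pb_apply, map_smul]; rfl

lemma polar_smul_right {n : ℕ} (q : QF F n) (a : F) (x y : Fin n → F) :
    polar q x (a • y) = a * polar q x y := by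
  rw [← pb_apply, ← pb_apply, map_smul]; rfl

lemma defect_eq_zero_iff {n : ℕ} (q : QF F n) : defect q = 0 ↔ ND q := by
  constructor
  · intro h x hx hy
    by_contra hne
    have : 1 ≤ defect q := by
      refine le_csSup (bddAbove_aux _) ⟨F ∙ x, finrank_span_singleton hne, ?_, ?_⟩
      · intro z hz
        obtain ⟨a, rfl⟩ := Submodule.mem_span_singleton.mp hz
        rw [eval_smul, hx, mul_zero]
      · intro z hz y
        obtain ⟨a, rfl⟩ := Submodule.mem_span_singleton.mp hz
        rw [polar_smul_left, hy, mul_zero]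
    omega
  · intro h
    have : defect q ≤ 0 := by
      refine csSup_le' ?_
      rintro d ⟨W, rfl, h1, h2⟩
      have : W = ⊥ := by
        rw [Submodule.eq_bot_iff]
        exact fun x hx => h x (h1 x hx) (h2 x hx)
      simp [this]
    omega

lemma dot_bound {k : ℕ} (U U' : Submodule F (Fin k → F))
    (h : ∀ x ∈ U, ∀ y ∈ U', ∑ i, x i * y i = 0) :
    Module.finrank F U + Module.finrank F U' ≤ k := by
  have h1 := Subspace.finrank_add_finrank_dualAnnihilator_eq U
  have h2 : U'.map (dotProductEquiv F (Fin k)).toLinearMap ≤ U.dualAnnihilator := by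
    rintro _ ⟨y, hy, rfl⟩
    rw [Submodule.mem_dualAnnihilator]
    intro x hx
    rw [LinearEquiv.coe_coe, dotProductEquiv_apply_apply, ← h x hx y hy]
    exact Finset.sum_congr rfl fun i _ => mul_comm _ _
  have h3 := Submodule.finrank_mono h2
  rw [LinearEquiv.finrank_map_eq] at h3
  simp only [Module.finrank_fin_fun] at h1
  omega

lemma exists_decomp {n m w d : ℕ} {q : QF F n} {qa : QF F m}
    (h : Isom q (orthSum (orthSum qa (hyper w)) (zeroForm d))) :
    ∃ E : (Fin n → F) ≃ₗ[F] (((Fin m → F) × ((Fin w → F) × (Fin w → F))) × (Fin d → F)),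
      ∀ x, eval q x = eval qa (E x).1.1 + ∑ i, (E x).1.2.1 i * (E x).1.2.2 i := by
  obtain ⟨e, he⟩ := h
  let G := (((LinearEquiv.refl F (Fin m → F)).prodCongr (appL F w w)).prodCongr
    (LinearEquiv.refl F (Fin d → F))).trans
    (((appL F m (w + w)).prodCongr (LinearEquiv.refl F (Fin d → F))).trans (appL F (m + (w + w)) d))
  have hG : ∀ p, eval (orthSum (orthSum qa (hyper w)) (zeroForm d)) (G p) =
      eval qa p.1.1 + ∑ i, p.1.2.1 i * p.1.2.2 i := by
    intro p
    simp [G, eval_orthSum_app, eval_hyper_app, eval_zeroForm]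
  refine ⟨e.trans G.symm, fun x => ?_⟩
  rw [← hG, ← he]
  simp

lemma i0_le_decomp {n m w d : ℕ} {q : QF F n} {qa : QF F m} (ha : Anisotropic qa)
    (h : Isom q (orthSum (orthSum qa (hyper w)) (zeroForm d))) : i0 q ≤ w + d := by
  obtain ⟨E, hE⟩ := exists_decomp h
  obtain ⟨W, hW, h0⟩ := exists_i0 q
  rw [← hW]
  let L' : W →ₗ[F] (Fin w → F) := LinearMap.snd F _ _ ∘ₗ LinearMap.snd F _ _ ∘ₗ LinearMap.fst F _ _ ∘ₗ
    E.toLinearMap ∘ₗ W.subtype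
  let L : W →ₗ[F] (Fin w → F) := LinearMap.fst F _ _ ∘ₗ LinearMap.snd F _ _ ∘ₗ LinearMap.fst F _ _ ∘ₗ
    E.toLinearMap ∘ₗ W.subtype
  let Z : W →ₗ[F] (Fin d → F) := LinearMap.snd F _ _ ∘ₗ E.toLinearMap ∘ₗ W.subtype
  let A : W →ₗ[F] (Fin m → F) := LinearMap.fst F _ _ ∘ₗ LinearMap.fst F _ _ ∘ₗ
    E.toLinearMap ∘ₗ W.subtype
  have hev : ∀ x : W, eval qa (A x) + ∑ i, L x i * L' x i = 0 := by
    intro x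
    rw [← h0 x x.2, hE]
    rfl
  have hinj : ∀ x : W, A x = 0 → L x = 0 → L' x = 0 → Z x = 0 → x = 0 := by
    intro x h1 h2 h3 h4
    have : E x = 0 := Prod.ext (Prod.ext h1 (Prod.ext h2 h3)) h4
    exact Subtype.ext (E.map_eq_zero_iff.mp this)
  have hA : ∀ x : W, L' x = 0 → A x = 0 := by
    intro x hx
    apply ha
    have := hev x
    simpa [hx] using this
  let K0 := LinearMap.ker L'
  let LK := L.domRestrict K0
  have r1 := L'.finrank_range_add_finrank_ker
  have r2 := LinearMap.finrank_range_add_finrank_ker (K := F) (V := K0) LK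
  have r3 : Module.finrank F (LinearMap.ker LK) ≤ d := by
    let ZK : LinearMap.ker LK →ₗ[F] (Fin d → F) := Z ∘ₗ K0.subtype ∘ₗ (LinearMap.ker LK).subtype
    have : Function.Injective ZK := by
      rintro ⟨⟨x, hx⟩, hx2⟩ ⟨⟨y, hy⟩, hy2⟩ hz
      have hx' : L' x = 0 := hx
      have hx2' : L x = 0 := hx2
      have hy' : L' y = 0 := hy
      have hy2' : L y = 0 := hy2
      have hz' : Z x = Z y := hz
      have := hinj (x - y) (by rw [map_sub, hA x hx', hA y hy', sub_zero])
        (by rw [map_sub, hx2', hy2', sub_zero]) (by rw [map_sub, hx', hy', sub_zero])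
        (by rw [map_sub, hz', sub_self])
      have hxy : x = y := sub_eq_zero.mp this
      subst hxy
      rfl
    simpa using LinearMap.finrank_le_finrank_of_injective this
  have r4 : Module.finrank F (LinearMap.range LK) + Module.finrank F (LinearMap.range L') ≤ w := by
    apply dot_bound
    rintro _ ⟨⟨y, hy⟩, rfl⟩ _ ⟨x, rfl⟩
    have hy' : L' y = 0 := hy
    have e1 := hev x
    have e2 := hev (x + y)
    simp only [map_add, hy', hA y hy', add_zero, Pi.add_apply, Pi.zero_apply, add_mul, Finset.sum_add_distrib] at e2
    change ∑ i, L y i * L' x i = 0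
    linear_combination e2 - e1
  have r1' : Module.finrank F (LinearMap.ker L') = Module.finrank F K0 := rfl
  omega

lemma le_i0_decomp {n m w d : ℕ} {q : QF F n} {qa : QF F m}
    (h : Isom q (orthSum (orthSum qa (hyper w)) (zeroForm d))) : w + d ≤ i0 q := by
  obtain ⟨E, hE⟩ := exists_decomp h
  have := le_i0 q (U := (Fin w → F) × (Fin d → F))
    (E.symm.toLinearMap ∘ₗ LinearMap.prod (LinearMap.prod 0
      (LinearMap.prod (LinearMap.fst F _ _) 0)) (LinearMap.snd F _ _)) ?_ ?_
  · simpa using this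
  · rw [LinearMap.coe_comp]
    refine E.symm.injective.comp ?_
    rintro ⟨a, b⟩ ⟨a', b'⟩ h
    simp at h
    simp [h]
  · intro u
    simp [hE, eval_zero]

lemma le_i0_decomp_iso {n m w d : ℕ} {q : QF F n} {qa : QF F m} (ha : Isotropic qa)
    (h : Isom q (orthSum (orthSum qa (hyper w)) (zeroForm d))) : w + d + 1 ≤ i0 q := by
  obtain ⟨E, hE⟩ := exists_decomp h
  obtain ⟨v, hv, hv0⟩ := ha
  have := le_i0 q (U := ((Fin w → F) × (Fin d → F)) × F)
    (E.symm.toLinearMap ∘ₗ LinearMap.prod (LinearMap.prod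
      ((LinearMap.toSpanSingleton F _ v) ∘ₗ LinearMap.snd F _ _)
      (LinearMap.prod (LinearMap.fst F _ _ ∘ₗ LinearMap.fst F _ _) 0))
      (LinearMap.snd F _ _ ∘ₗ LinearMap.fst F _ _)) ?_ ?_
  · simpa using this
  · rw [LinearMap.coe_comp]
    refine E.symm.injective.comp ?_
    rintro ⟨⟨a, b⟩, c⟩ ⟨⟨a', b'⟩, c'⟩ h
    simp at h
    obtain ⟨⟨h1, h2⟩, h3⟩ := h
    have h1 : c • v = c' • v := h1
    simp [h2, h3, smul_left_injective F hv h1]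
  · intro u
    simp [hE, eval_smul, hv0]

lemma isom_orthSum_zero {n m : ℕ} {q : QF F n} {q' : QF F m} (h : Isom q q') :
    Isom q (orthSum q' (zeroForm 0)) := by
  obtain ⟨e, he⟩ := h
  refine ⟨e, fun x => ?_⟩
  rw [← he, eval_orthSum, eval_zeroForm, add_zero]
  rfl

/-- Splitting off hyperbolic planes. -/
lemma exists_split {n : ℕ} {q : QF F n} (hq : ND q) {w : ℕ} (W : Submodule F (Fin n → F))
    (hW : Module.finrank F W = w) (h0 : ∀ x ∈ W, eval q x = 0) :
    ∃ (m : ℕ) (q' : QF F m), Isom q (orthSum q' (hyper w)) := by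
  -- coordinates on W
  let bs := Module.finBasisOfFinrankEq F W hW
  let ω : (Fin w → F) →ₗ[F] (Fin n → F) := W.subtype ∘ₗ bs.equivFun.symm.toLinearMap
  have hω0 : ∀ p, eval q (ω p) = 0 := fun p => h0 _ (bs.equivFun.symm p).2
  have hωi : Function.Injective ω := W.injective_subtype.comp bs.equivFun.symm.injective
  have hωω : ∀ p p', polar q (ω p) (ω p') = 0 := by
    intro p p'
    unfold polar
    rw [← map_add, hω0, hω0, hω0]; simp
  -- dual functionals
  let Φ : (Fin n → F) →ₗ[F] (Fin w → F) :=
    LinearMap.pi fun i => (pb q) (ω (Pi.single i 1))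
  have hΦ : ∀ p x, polar q (ω p) x = ∑ i, p i * Φ x i := by
    intro p x
    have : p = ∑ i, p i • (Pi.single i 1 : Fin w → F) := by
      ext j; simp [Finset.sum_apply, Pi.single_apply]
    conv_lhs => rw [this]
    rw [← pb_apply]
    simp [Φ]
  have hΦs : Function.Surjective Φ := by
    rw [← LinearMap.range_eq_top]
    by_contra hne
    have hlt : Module.finrank F (LinearMap.range Φ) < w := by
      simpa using Submodule.finrank_lt hne
    have h1 := Subspace.finrank_add_finrank_dualAnnihilator_eq (LinearMap.range Φ)
    have h2 : 0 < Module.finrank F (LinearMap.range Φ).dualAnnihilator := by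
      simp only [Module.finrank_fin_fun] at h1; omega
    obtain ⟨⟨f, hf⟩, hfne⟩ := (Module.finrank_pos_iff_exists_ne_zero (R := F)
      (M := (LinearMap.range Φ).dualAnnihilator)).mp h2
    obtain ⟨p, rfl⟩ := (dotProductEquiv F (Fin w)).surjective f
    rw [Submodule.mem_dualAnnihilator] at hf
    have hp : ω p = 0 := by
      apply hq _ (hω0 p)
      intro y
      rw [hΦ]
      exact hf (Φ y) ⟨y, rfl⟩
    have : p = 0 := hωi (by rw [hp, map_zero])
    apply hfne
    simp [this]
  obtain ⟨y, hy⟩ := LinearMap.exists_rightInverse_of_surjective Φ (LinearMap.range_eq_top.mpr hΦs)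
  have hy' : ∀ p, Φ (y p) = p := fun p => by
    have := LinearMap.congr_fun hy p
    simpa using this
  -- correction of y
  let C : (Fin w → F) →ₗ[F] (Fin w → F) :=
    LinearMap.pi fun i => (LinearMap.flip (Matrix.toBilin' q) (y (Pi.single i 1))) ∘ₗ y
  have hC : ∀ p p', ∑ i, p' i * C p i = Matrix.toBilin' q (y p) (y p') := by
    intro p p'
    have : p' = ∑ i, p' i • (Pi.single i 1 : Fin w → F) := by
      ext j; simp [Finset.sum_apply, Pi.single_apply]
    conv_rhs => rw [this]
    simp [C, map_sum]
  let z : (Fin w → F) →ₗ[F] (Fin n → F) := y - ω ∘ₗ C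
  have hωz : ∀ p p', polar q (ω p) (z p') = ∑ i, p i * p' i := by
    intro p p'
    have : polar q (ω p) (z p') = polar q (ω p) (y p') - polar q (ω p) (ω (C p')) := by
      simp only [← pb_apply, z, LinearMap.sub_apply, map_sub, LinearMap.comp_apply]
    rw [this, hωω, hΦ, hy', sub_zero]
  have hz0 : ∀ p, eval q (z p) = 0 := by
    intro p
    have e1 : y p = z p + ω (C p) := by simp [z]
    have e2 := eval_add q (z p) (ω (C p))
    rw [← e1, hω0, polar_comm, hωz] at e2
    have e3 := hC p p
    rw [← eval_eq_bl] at e3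
    have e4 : ∑ i, C p i * p i = ∑ i, p i * C p i := Finset.sum_congr rfl fun i _ => mul_comm _ _
    rw [e4, e3] at e2
    linear_combination -e2
  have hzz : ∀ p p', polar q (z p) (z p') = 0 := by
    intro p p'
    unfold polar
    rw [← map_add, hz0, hz0, hz0]; simp
  -- orthogonal complement
  let Ψ : (Fin n → F) →ₗ[F] (Fin w → F) := LinearMap.pi fun i => (pb q) (z (Pi.single i 1))
  have hΨ : ∀ p x, polar q (z p) x = ∑ i, p i * Ψ x i := by
    intro p x
    have : p = ∑ i, p i • (Pi.single i 1 : Fin w → F) := by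
      ext j; simp [Finset.sum_apply, Pi.single_apply]
    conv_lhs => rw [this]
    rw [← pb_apply]
    simp [Ψ]
  have hΦz : ∀ p, Φ (z p) = p := by
    intro p; ext i
    simp only [Φ, LinearMap.pi_apply, pb_apply, hωz]
    simp [Pi.single_apply]
  have hΦω : ∀ p, Φ (ω p) = 0 := by
    intro p; ext i
    simp only [Φ, LinearMap.pi_apply, pb_apply, hωω]; rfl
  have hΨz : ∀ p, Ψ (z p) = 0 := by
    intro p; ext i
    simp only [Ψ, LinearMap.pi_apply, pb_apply, hzz]; rfl
  have hΨω : ∀ p, Ψ (ω p) = p := by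
    intro p; ext i
    simp only [Ψ, LinearMap.pi_apply, pb_apply]
    rw [polar_comm, hωz]
    simp [Pi.single_apply]
  let U := LinearMap.ker Φ ⊓ LinearMap.ker Ψ
  let bU := Module.finBasis F U
  let g : (Fin (Module.finrank F U) → F) →ₗ[F] (Fin n → F) := U.subtype ∘ₗ bU.equivFun.symm.toLinearMap
  have hgi : Function.Injective g := U.injective_subtype.comp bU.equivFun.symm.injective
  have hgU : ∀ a, Φ (g a) = 0 ∧ Ψ (g a) = 0 := fun a => (bU.equivFun.symm a).2
  obtain ⟨q', hq'⟩ := exists_pullback q g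
  refine ⟨_, q', Isom.symm ?_⟩
  let Θ : ((Fin (Module.finrank F U) → F) × ((Fin w → F) × (Fin w → F))) →ₗ[F] (Fin n → F) :=
    LinearMap.coprod g (LinearMap.coprod ω z)
  have hΘ : ∀ a p p', Θ (a, p, p') = g a + (ω p + z p') := fun a p p' => rfl
  have hΘi : Function.Injective Θ := by
    rw [← LinearMap.ker_eq_bot, LinearMap.ker_eq_bot']
    rintro ⟨a, p, p'⟩ h
    rw [hΘ] at h
    have h1 := congrArg Φ h
    have h2 := congrArg Ψ h
    simp only [map_add, (hgU a).1, (hgU a).2, hΦω, hΦz, hΨω, hΨz, map_zero, zero_add, add_zero] at h1 h2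
    subst h1; subst h2
    simp only [map_zero, add_zero] at h
    have : a = 0 := hgi (by rw [h, map_zero])
    simp [this]
  have hΘs : Function.Surjective Θ := by
    intro x
    let u := x - (ω (Ψ x) + z (Φ x))
    have hu : u ∈ U := by
      constructor
      · simp [u, hΦω, hΦz]
      · simp [u, hΨω, hΨz]
    refine ⟨(bU.equivFun ⟨u, hu⟩, Ψ x, Φ x), ?_⟩
    rw [hΘ]
    have : g (bU.equivFun ⟨u, hu⟩) = u := by simp [g]
    rw [this]
    simp [u]
  let Θe := LinearEquiv.ofBijective Θ ⟨hΘi, hΘs⟩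
  let G := (((LinearEquiv.refl F (Fin (Module.finrank F U) → F)).prodCongr (appL F w w))).trans
    (appL F (Module.finrank F U) (w + w))
  refine ⟨G.symm.trans Θe, fun x => ?_⟩
  obtain ⟨⟨a, p, p'⟩, rfl⟩ := G.surjective x
  have e1 : (G.symm.trans Θe) (G (a, p, p')) = g a + (ω p + z p') := by
    rw [LinearEquiv.trans_apply, LinearEquiv.symm_apply_apply]
    exact hΘ a p p'
  rw [e1]
  have e2 : eval (orthSum q' (hyper w)) (G (a, p, p')) = eval q (g a) + ∑ i, p i * p' i := by
    simp [G, eval_orthSum_app, eval_hyper_app, hq']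
  rw [e2, eval_add, eval_add q (ω p), hω0, hz0, hωz]
  have e3 : polar q (g a) (ω p + z p') = 0 := by
    rw [polar_comm, ← pb_apply, map_add, LinearMap.add_apply, pb_apply, pb_apply, hΦ, hΨ,
      (hgU a).1, (hgU a).2]
    simp
  rw [e3]; ring

lemma wittIndex_eq_i0 {n : ℕ} {q : QF F n} (hq : ND q) : wittIndex q = i0 q := by
  have hub : ∀ w ∈ {w | ∃ (m : ℕ) (q' : QF F m), Isom q (orthSum q' (hyper w))}, w ≤ i0 q := by
    rintro w ⟨m, q', h⟩
    simpa using le_i0_decomp (isom_orthSum_zero h)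
  apply le_antisymm
  · exact csSup_le' hub
  · obtain ⟨W, hW, h0⟩ := exists_i0 q
    exact le_csSup ⟨_, hub⟩ (exists_split hq W hW h0)

lemma exists_aniso_split {n : ℕ} {q : QF F n} (hq : ND q) :
    ∃ (m : ℕ) (q' : QF F m), Anisotropic q' ∧
      Isom q (orthSum (orthSum q' (hyper (i0 q))) (zeroForm 0)) := by
  obtain ⟨W, hW, h0⟩ := exists_i0 q
  obtain ⟨m, q', h⟩ := exists_split hq W hW h0
  refine ⟨m, q', ?_, isom_orthSum_zero h⟩
  by_contra hne
  have : Isotropic q' := by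
    unfold Anisotropic at hne
    push Not at hne
    obtain ⟨x, h1, h2⟩ := hne
    exact ⟨x, h2, h1⟩
  have := le_i0_decomp_iso this (isom_orthSum_zero h)
  omega

end Index
end QF

namespace QF

section TypeSec
variable {F : Type} [Field F]

lemma HasTypeWith.map {n r s : ℕ} {q : QF F n} {c : Fin s → F} (h : HasTypeWith q r s c)
    {K : Type} [Field K] (σ : F →+* K) :
    HasTypeWith (q.map σ : QF K n) r s (fun i => σ (c i)) := by
  obtain ⟨a, b, h⟩ := h
  refine ⟨fun i => σ (a i), fun i => σ (b i), ?_⟩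
  have := h.map σ
  rwa [map_orthSum, map_binSum, map_diag] at this

lemma HasTypeWith.dim {n r s : ℕ} {q : QF F n} {c : Fin s → F} (h : HasTypeWith q r s c) :
    n = r + r + s := by
  obtain ⟨a, b, h⟩ := h
  exact h.dim_eq

lemma HasTypeWith.exists_coord [CharP F 2] {n r s : ℕ} {q : QF F n} {c : Fin s → F}
    (h : HasTypeWith q r s c) :
    ∃ (E : (Fin n → F) ≃ₗ[F] ((Fin r → F) × (Fin r → F)) × (Fin s → F)),
      (∀ z, eval q (E.symm (0, z)) = eval (diag c) z) ∧
      ∀ x y, polar q x y = ∑ i, ((E x).1.1 i * (E y).1.2 i + (E x).1.2 i * (E y).1.1 i) := by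
  obtain ⟨a, b, e, he⟩ := h
  let G := ((appL F r r).prodCongr (LinearEquiv.refl F (Fin s → F))).trans (appL F (r + r) s)
  refine ⟨e.trans G.symm, fun z => ?_, fun x y => ?_⟩
  · rw [← he]
    simp [G, eval_orthSum_app, eval_zero]
  · rw [← polar_isom he]
    obtain ⟨x', hx⟩ := G.surjective (e x)
    obtain ⟨y', hy⟩ := G.surjective (e y)
    simp only [LinearEquiv.trans_apply, ← hx, ← hy, LinearEquiv.symm_apply_apply]
    simp only [G, LinearEquiv.trans_apply, polar_orthSum_app, polar_diag, add_zero,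
      LinearEquiv.prodCongr_apply, polar_binSum, appL_castAdd, appL_natAdd]

lemma HasTypeWith.rad [CharP F 2] {n r s : ℕ} {q : QF F n}
    {E : (Fin n → F) ≃ₗ[F] ((Fin r → F) × (Fin r → F)) × (Fin s → F)}
    (hE : ∀ x y, polar q x y = ∑ i, ((E x).1.1 i * (E y).1.2 i + (E x).1.2 i * (E y).1.1 i))
    (x : Fin n → F) : (∀ y, polar q x y = 0) ↔ (E x).1 = 0 := by
  constructor
  · intro h
    refine Prod.ext ?_ ?_
    · ext i
      have := h (E.symm ((0, Pi.single i 1), 0))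
      rw [hE] at this
      simpa [Pi.single_apply] using this
    · ext i
      have := h (E.symm ((Pi.single i 1, 0), 0))
      rw [hE] at this
      simpa [Pi.single_apply] using this
  · intro h y
    rw [hE, h]
    simp

lemma HasTypeWith.nd_iff [CharP F 2] {n r s : ℕ} {q : QF F n} {c : Fin s → F}
    (h : HasTypeWith q r s c) : ND q ↔ Anisotropic (diag c) := by
  obtain ⟨E, h1, h2⟩ := h.exists_coord
  constructor
  · intro hq z hz
    have := hq (E.symm (0, z)) (by rw [h1, hz]) ((HasTypeWith.rad h2 _).mpr (by simp))
    have := congrArg E this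
    simpa using this
  · intro hc x hx hy
    rw [HasTypeWith.rad h2] at hy
    have hx' : x = E.symm (0, (E x).2) := by
      rw [LinearEquiv.eq_symm_apply]
      exact Prod.ext hy rfl
    rw [hx', h1] at hx
    rw [hx', hc _ hx]
    exact map_zero E.symm

lemma HasTypeWith.i0_le [CharP F 2] {n r s : ℕ} {q : QF F n} {c : Fin s → F}
    (h : HasTypeWith q r s c) (hq : ND q) : i0 q ≤ r := by
  obtain ⟨E, h1, h2⟩ := h.exists_coord
  obtain ⟨W, hW, h0⟩ := exists_i0 q
  have hpol : ∀ x ∈ W, ∀ y ∈ W, polar q x y = 0 := by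
    intro x hx y hy
    unfold polar
    rw [h0 _ (W.add_mem hx hy), h0 _ hx, h0 _ hy]; simp
  let P : W →ₗ[F] (Fin (r + r) → F) :=
    (appL F r r).toLinearMap ∘ₗ LinearMap.fst F _ _ ∘ₗ E.toLinearMap ∘ₗ W.subtype
  let P' : W →ₗ[F] (Fin (r + r) → F) :=
    (appL F r r).toLinearMap ∘ₗ (LinearEquiv.prodComm F _ _).toLinearMap ∘ₗ
      LinearMap.fst F _ _ ∘ₗ E.toLinearMap ∘ₗ W.subtype
  have inj : ∀ x : W, (E x).1 = 0 → x = 0 := by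
    intro x hx
    exact Subtype.ext (hq x (h0 x x.2) ((HasTypeWith.rad h2 _).mpr hx))
  have i1 : Function.Injective P := by
    refine (injective_iff_map_eq_zero P).mpr fun x hx => inj x ?_
    exact (appL F r r).map_eq_zero_iff.mp hx
  have i2 : Function.Injective P' := by
    refine (injective_iff_map_eq_zero P').mpr fun x hx => inj x ?_
    exact (LinearEquiv.prodComm F _ _).map_eq_zero_iff.mp ((appL F r r).map_eq_zero_iff.mp hx)
  have := dot_bound (LinearMap.range P) (LinearMap.range P') ?_
  · rw [LinearMap.finrank_range_of_inj i1, LinearMap.finrank_range_of_inj i2, hW] at this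
    omega
  · rintro _ ⟨x, rfl⟩ _ ⟨y, rfl⟩
    rw [← hpol x x.2 y y.2, h2, Fin.sum_univ_add, Finset.sum_add_distrib]
    simp only [P, P', LinearMap.comp_apply, LinearEquiv.coe_coe, appL_castAdd, appL_natAdd]
    rfl

lemma polar_decomp {n m w d : ℕ} {q : QF F n} {qa : QF F m}
    {E : (Fin n → F) ≃ₗ[F] (((Fin m → F) × ((Fin w → F) × (Fin w → F))) × (Fin d → F))}
    (hE : ∀ x, eval q x = eval qa (E x).1.1 + ∑ i, (E x).1.2.1 i * (E x).1.2.2 i) (v z y) :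
    polar q (E.symm ((v, 0), z)) y = polar qa v (E y).1.1 := by
  unfold polar
  simp only [hE, map_add, LinearEquiv.apply_symm_apply, Prod.fst_add, Prod.snd_add]
  simp only [Prod.snd_zero, Prod.fst_zero, zero_add, Pi.zero_apply, zero_mul, Finset.sum_const_zero, add_zero]
  ring

lemma nd_decomp {n m w d : ℕ} {q : QF F n} {qa : QF F m} (hq : ND q)
    (h : Isom q (orthSum (orthSum qa (hyper w)) (zeroForm d))) : d = 0 ∧ ND qa := by
  obtain ⟨E, hE⟩ := exists_decomp h
  have key : ∀ v (z : Fin d → F), eval qa v = 0 → (∀ y, polar qa v y = 0) → v = 0 ∧ z = 0 := by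
    intro v z hv hy
    have := hq (E.symm ((v, 0), z)) (by rw [hE]; simp [hv]) (fun y => by rw [polar_decomp hE, hy])
    have := congrArg E this
    simpa using this
  refine ⟨?_, fun v hv hy => (key v 0 hv hy).1⟩
  by_contra hd
  have h1 := (key 0 (fun _ => 1) (eval_zero _) (fun y => by
    rw [← pb_apply, map_zero]; rfl)).2
  have := congrFun h1 ⟨0, by omega⟩
  simp at this

lemma HasTypeWith.kern_le [CharP F 2] {n r s : ℕ} {q : QF F n} {c : Fin s → F}
    (ht : HasTypeWith q r s c) {m w d : ℕ} {qa : QF F m}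
    (h : Isom q (orthSum (orthSum qa (hyper w)) (zeroForm d))) (h0 : ∀ x y, polar qa x y = 0) :
    m ≤ s := by
  obtain ⟨E, hE⟩ := exists_decomp h
  obtain ⟨E', h1, h2⟩ := ht.exists_coord
  let g : (Fin m → F) →ₗ[F] (Fin s → F) := LinearMap.snd F _ _ ∘ₗ E'.toLinearMap ∘ₗ E.symm.toLinearMap ∘ₗ
    LinearMap.inl F _ _ ∘ₗ LinearMap.inl F _ _
  have hg : Function.Injective g := by
    refine (injective_iff_map_eq_zero g).mpr fun v hv => ?_
    have h3 : (E' (E.symm ((v, 0), 0))).1 = 0 := by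
      rw [← HasTypeWith.rad h2]
      intro y
      rw [polar_decomp hE, h0]
    have h4 : E' (E.symm ((v, 0), 0)) = 0 := Prod.ext h3 hv
    simpa using h4
  simpa using LinearMap.finrank_le_finrank_of_injective hg

end TypeSec
end QF

namespace QF
open scoped TensorProduct

section FF
variable {F : Type} [Field F]

/-- exponent of the generic point -/
noncomputable def dl (m : ℕ) (i : Fin m) : Fin (m - 1) →₀ ℕ :=
  if h : (i : ℕ) < m - 1 then Finsupp.single ⟨i, h⟩ 1 else 0

/-- the generic affine point -/
noncomputable def gp (R : Type) [CommSemiring R] (m : ℕ) (i : Fin m) : MvPolynomial (Fin (m - 1)) R :=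
  if h : (i : ℕ) < m - 1 then MvPolynomial.X ⟨i, h⟩ else 1

lemma gp_eq (R : Type) [CommSemiring R] (m : ℕ) (i : Fin m) :
    gp R m i = MvPolynomial.monomial (dl m i) 1 := by
  unfold gp dl
  split_ifs <;> rfl

lemma dl_inj {m : ℕ} {i j : Fin m} (h : dl m i = dl m j) : i = j := by
  unfold dl at h
  have hi := i.2
  have hj := j.2
  split_ifs at h with h1 h2 h2
  · have := Finsupp.single_left_injective (one_ne_zero) h
    simpa [Fin.ext_iff] using this
  · have h3 := DFunLike.congr_fun h ⟨i, h1⟩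
    simp at h3
  · have h3 := DFunLike.congr_fun h ⟨j, h2⟩
    simp at h3
  · ext; omega

lemma dl_apply {m : ℕ} (i : Fin m) (k : Fin (m - 1)) :
    dl m i k = if (i : ℕ) = k then 1 else 0 := by
  unfold dl
  split_ifs with h1 h2 h2
  · simp [Finsupp.single_apply, Fin.ext_iff, h2]
  · simp [Finsupp.single_apply, Fin.ext_iff, h2]
  · omega
  · rfl

/-- linear forms in the generic point -/
noncomputable def lf {m : ℕ} (a : Fin m → F) : MvPolynomial (Fin (m - 1)) F :=
  ∑ i, MvPolynomial.C (a i) * gp F m i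

lemma lf_coeff {m : ℕ} (a : Fin m → F) (i : Fin m) : (lf a).coeff (dl m i) = a i := by
  unfold lf
  simp only [MvPolynomial.coeff_sum, MvPolynomial.coeff_C_mul, gp_eq, MvPolynomial.coeff_monomial]
  rw [Finset.sum_eq_single i]
  · simp
  · intro j _ hj
    rw [if_neg, mul_zero]
    exact fun h => hj (dl_inj h)
  · simp

lemma lf_ne_zero {m : ℕ} (a : Fin m → F) (h : a ≠ 0) : lf a ≠ 0 := by
  intro h0
  apply h
  ext i
  rw [← lf_coeff a i, h0]; simp

lemma gp_totalDegree (m : ℕ) (i : Fin m) : (gp F m i).totalDegree ≤ 1 := by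
  unfold gp
  split_ifs
  · simp
  · simp

lemma lf_totalDegree {m : ℕ} (a : Fin m → F) : (lf a).totalDegree ≤ 1 := by
  unfold lf
  refine MvPolynomial.totalDegree_finsetSum_le fun i _ => ?_
  refine (MvPolynomial.totalDegree_mul _ _).trans ?_
  simpa using gp_totalDegree m i

lemma affinePoly_eq_s2 {m : ℕ} (q : QF F m) :
    affinePoly q = ∑ i, ∑ j, MvPolynomial.C (q i j) * gp F m i * gp F m j := rfl

lemma affinePoly_map {m : ℕ} (q : QF F m) {L : Type} [Field L] (σ : F →+* L) :
    MvPolynomial.map σ (affinePoly q) = affinePoly (q.map σ : QF L m) := by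
  have : ∀ i, MvPolynomial.map σ (gp F m i) = gp L m i := by
    intro i; simp [gp_eq]
  simp [affinePoly_eq_s2, this]

lemma affinePoly_coeff {m : ℕ} (q : QF F m) (k : Fin (m - 1)) :
    (affinePoly q).coeff (Finsupp.single k 2) = q ⟨k, by omega⟩ ⟨k, by omega⟩ := by
  have h1 : ∀ i j : Fin m, (MvPolynomial.C (q i j) * gp F m i * gp F m j).coeff (Finsupp.single k 2) =
      if dl m i + dl m j = Finsupp.single k 2 then q i j else 0 := by
    intro i j
    rw [gp_eq, gp_eq, MvPolynomial.C_mul_monomial, MvPolynomial.monomial_mul,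
      MvPolynomial.coeff_monomial]
    simp
  have h2 : ∀ i j : Fin m, dl m i + dl m j = Finsupp.single k 2 → (i : ℕ) = k ∧ (j : ℕ) = k := by
    intro i j h
    have := DFunLike.congr_fun h k
    rw [Finsupp.add_apply, dl_apply, dl_apply, Finsupp.single_eq_same] at this
    split_ifs at this with h3 h4 <;> first | exact ⟨h3, h4⟩ | omega
  rw [affinePoly_eq_s2]
  simp only [MvPolynomial.coeff_sum, h1]
  rw [Finset.sum_eq_single ⟨k, by omega⟩, Finset.sum_eq_single ⟨k, by omega⟩, if_pos]
  · unfold dl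
    rw [dif_pos (by simp), ← Finsupp.single_add]
  · intro j _ hj
    rw [if_neg]
    exact fun h => hj (Fin.ext (h2 _ _ h).2)
  · simp
  · intro i _ hi
    refine Finset.sum_eq_zero fun j _ => ?_
    rw [if_neg]
    exact fun h => hi (Fin.ext (h2 _ _ h).1)
  · simp

lemma affinePoly_totalDegree {m : ℕ} (hm : 2 ≤ m) (q : QF F m)
    (h : q ⟨0, by omega⟩ ⟨0, by omega⟩ ≠ 0) : 2 ≤ (affinePoly q).totalDegree := by
  have h1 := affinePoly_coeff q ⟨0, by omega⟩
  have := MvPolynomial.le_totalDegree (p := affinePoly q) (s := Finsupp.single ⟨0, by omega⟩ 2)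
    (by rw [MvPolynomial.mem_support_iff, h1]; exact h)
  simpa using this

lemma pderiv_gp {m : ℕ} (k : Fin (m - 1)) (i : Fin m) :
    MvPolynomial.pderiv k (gp F m i) = if (i : ℕ) = k then 1 else 0 := by
  unfold gp
  split_ifs with h1 h2 h2
  · rw [MvPolynomial.pderiv_X]; simp [Pi.single_apply, Fin.ext_iff, h2]
  · rw [MvPolynomial.pderiv_X]; simp [Pi.single_apply, Fin.ext_iff, h2]
  · omega
  · simp

lemma pderiv_affinePoly {m : ℕ} (q : QF F m) (k : Fin (m - 1)) :
    MvPolynomial.pderiv k (affinePoly q) =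
      lf (fun j => q ⟨k, by omega⟩ j + q j ⟨k, by omega⟩) := by
  have hk : ∀ i : Fin m, ((i : ℕ) = k) ↔ i = ⟨k, by omega⟩ := fun i => by simp [Fin.ext_iff]
  rw [affinePoly_eq_s2, lf]
  simp only [map_sum, Derivation.leibniz, MvPolynomial.pderiv_C, pderiv_gp, hk]
  simp only [smul_eq_mul, mul_zero, add_zero, map_add, add_mul, Finset.sum_add_distrib, mul_ite, mul_one]
  rw [add_comm]
  congr 1
  · rw [Finset.sum_comm]
    simp [mul_comm]
  · simp

lemma affinePoly_squarefree [CharP F 2] {m : ℕ} (q : QF F m) (hq : ∃ x y, polar q x y ≠ 0) :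
    Squarefree (affinePoly q) := by
  -- some partial derivative is nonzero
  have hk : ∃ k : Fin (m - 1), (fun j => q ⟨k, by omega⟩ j + q j ⟨k, by omega⟩) ≠ 0 := by
    by_contra hne
    push Not at hne
    have hne' : ∀ i j : Fin m, q i j + q j i = 0 := by
      have h1 : ∀ i j : Fin m, (i : ℕ) < m - 1 → q i j + q j i = 0 := by
        intro i j hi
        exact congrFun (hne ⟨i, hi⟩) j
      intro i j
      by_cases hi : (i : ℕ) < m - 1
      · exact h1 i j hi
      by_cases hj : (j : ℕ) < m - 1
      · rw [add_comm]; exact h1 j i hj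
      have : i = j := by ext; omega
      rw [this, CharTwo.add_self_eq_zero]
    obtain ⟨x, y, hxy⟩ := hq
    apply hxy
    rw [polar_eq_bl, Matrix.toBilin'_apply, Matrix.toBilin'_apply]
    rw [Finset.sum_comm (f := fun i j => y i * q i j * x j), ← Finset.sum_add_distrib]
    refine Finset.sum_eq_zero fun i _ => ?_
    rw [← Finset.sum_add_distrib]
    refine Finset.sum_eq_zero fun j _ => ?_
    linear_combination x i * y j * hne' i j
  obtain ⟨k, hk⟩ := hk
  rintro g ⟨h, hg⟩
  have hd := pderiv_affinePoly q k
  have h2 : (2 : MvPolynomial (Fin (m - 1)) F) = 0 := by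
    have : (MvPolynomial.C (2 : F) : MvPolynomial (Fin (m - 1)) F) = 0 := by
      rw [CharTwo.two_eq_zero, map_zero]
    exact (map_ofNat MvPolynomial.C 2).symm.trans this
  have hd2 : MvPolynomial.pderiv k (affinePoly q) = g * g * MvPolynomial.pderiv k h := by
    rw [hg]
    simp only [Derivation.leibniz, smul_eq_mul]
    linear_combination h * g * (MvPolynomial.pderiv k g) * h2
  rw [hd] at hd2
  have hne := lf_ne_zero _ hk
  have hdeg := lf_totalDegree (fun j => q ⟨k, by omega⟩ j + q j ⟨k, by omega⟩)
  rw [hd2] at hne hdeg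
  have hg0 : g ≠ 0 := fun h => hne (by simp [h])
  have hh0 : MvPolynomial.pderiv k h ≠ 0 := fun h => hne (by simp [h])
  rw [MvPolynomial.totalDegree_mul_of_isDomain (mul_ne_zero hg0 hg0) hh0,
    MvPolynomial.totalDegree_mul_of_isDomain hg0 hg0] at hdeg
  have h0 : g.totalDegree = 0 := by omega
  rw [MvPolynomial.totalDegree_eq_zero_iff_eq_C] at h0
  rw [h0]
  apply IsUnit.map
  rw [isUnit_iff_ne_zero]
  intro hc
  rw [hc, map_zero] at h0
  exact hg0 h0

end FF
end QF

namespace QF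
open scoped TensorProduct

section FF2
variable {F : Type} [Field F] {m : ℕ} {E : Type} [Field E] [Algebra F E]

noncomputable def Phi (f : MvPolynomial (Fin (m - 1)) F →ₐ[F] E) (L : Type) [Field L] [Algebra F L] :
    MvPolynomial (Fin (m - 1)) L →ₐ[L] L ⊗[F] E :=
  (Algebra.TensorProduct.map (AlgHom.id L L) f).comp
    (MvPolynomial.algebraTensorAlgEquiv F L).symm.toAlgHom

variable (f : MvPolynomial (Fin (m - 1)) F →ₐ[F] E) (L : Type) [Field L] [Algebra F L]

lemma Phi_map (g : MvPolynomial (Fin (m - 1)) F) :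
    Phi f L (MvPolynomial.map (algebraMap F L) g) = 1 ⊗ₜ f g := by
  simp [Phi, MvPolynomial.algebraTensorAlgEquiv_symm_map]

lemma Phi_C (l : L) : Phi f L (MvPolynomial.C l) = l ⊗ₜ 1 := by
  have := (Phi f L).commutes l
  rw [MvPolynomial.algebraMap_eq] at this
  rw [this]; simp

variable {f} in
lemma Phi_eq_zero {φ : QF F m} (hker : RingHom.ker f = Ideal.span {affinePoly φ})
    (g : MvPolynomial (Fin (m - 1)) L) :
    Phi f L g = 0 ↔ affinePoly (φ.map (algebraMap F L) : QF L m) ∣ g := by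
  have hz : f (affinePoly φ) = 0 := by
    have : affinePoly φ ∈ RingHom.ker f := by rw [hker]; exact Ideal.mem_span_singleton_self _
    exact this
  constructor
  · intro h
    have hex : Function.Exact (LinearMap.mulLeft F (affinePoly φ)) f.toLinearMap := by
      intro y
      have : f y = 0 ↔ y ∈ RingHom.ker f := Iff.rfl
      rw [AlgHom.toLinearMap_apply, this, hker, Ideal.mem_span_singleton]
      constructor
      · rintro ⟨c, rfl⟩; exact ⟨c, rfl⟩
      · rintro ⟨c, rfl⟩; exact ⟨c, rfl⟩
    have hex2 := Module.Flat.lTensor_exact L hex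
    have h1 : (LinearMap.lTensor L f.toLinearMap) ((MvPolynomial.algebraTensorAlgEquiv F L).symm g) = 0 := h
    obtain ⟨y, hy⟩ := (hex2 _).1 h1
    have h2 : ∀ y : L ⊗[F] MvPolynomial (Fin (m - 1)) F,
        LinearMap.lTensor L (LinearMap.mulLeft F (affinePoly φ)) y = (1 ⊗ₜ affinePoly φ) * y := by
      intro y
      induction y with
      | zero => simp
      | add a b ha hb => rw [map_add, ha, hb, mul_add]
      | tmul a b => simp
    rw [h2] at hy
    refine ⟨MvPolynomial.algebraTensorAlgEquiv F L y, ?_⟩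
    have h3 := congrArg (MvPolynomial.algebraTensorAlgEquiv F L) hy
    rw [map_mul, AlgEquiv.apply_symm_apply] at h3
    rw [← h3, ← affinePoly_map]
    simp
  · rintro ⟨c, rfl⟩
    rw [map_mul, ← affinePoly_map, Phi_map, hz]; simp

variable {f} in
lemma exists_frac (hadj : IntermediateField.adjoin F (Set.range fun i => f (MvPolynomial.X i)) = ⊤)
    (e : E) : ∃ a b, f b ≠ 0 ∧ e * f b = f a := by
  have he : e ∈ IntermediateField.adjoin F (Set.range fun i => f (MvPolynomial.X i)) := by
    rw [hadj]; trivial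
  rw [IntermediateField.mem_adjoin_range_iff] at he
  obtain ⟨a, b, hab⟩ := he
  have hf : ∀ p, MvPolynomial.aeval (fun i => f (MvPolynomial.X i)) p = f p := fun p =>
    (MvPolynomial.comp_aeval_apply (MvPolynomial.X) f p).symm.trans (by simp)
  rw [hf, hf] at hab
  by_cases hb : f b = 0
  · exact ⟨0, 1, by simp, by simp [hab, hb]⟩
  · exact ⟨a, b, hb, by rw [hab]; field_simp⟩

variable {f} in
lemma clear_denom (hadj : IntermediateField.adjoin F (Set.range fun i => f (MvPolynomial.X i)) = ⊤)
    (y : L ⊗[F] E) : ∃ b g, f b ≠ 0 ∧ y * (1 ⊗ₜ f b) = Phi f L g := by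
  induction y with
  | zero => exact ⟨1, 0, by simp, by simp⟩
  | tmul l e =>
    obtain ⟨a, b, hb, hab⟩ := exists_frac hadj e
    refine ⟨b, MvPolynomial.C l * MvPolynomial.map (algebraMap F L) a, hb, ?_⟩
    rw [map_mul, Phi_map, Phi_C]
    simp [hab]
  | add y z hy hz =>
    obtain ⟨b, g, hb, hg⟩ := hy
    obtain ⟨c, k, hc, hk⟩ := hz
    refine ⟨b * c, g * MvPolynomial.map (algebraMap F L) c + k * MvPolynomial.map (algebraMap F L) b,
      by simp [hb, hc], ?_⟩
    rw [map_add, map_mul, map_mul, map_mul, Phi_map, Phi_map, ← hg, ← hk]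
    have : (1 : L) ⊗ₜ[F] (f b * f c) = (1 ⊗ₜ f b) * (1 ⊗ₜ f c) := by simp
    rw [this]; ring

lemma isUnit_one_tmul {e : E} (he : e ≠ 0) : IsUnit ((1 : L) ⊗ₜ[F] e) := by
  have : (1 : L) ⊗ₜ[F] e = Algebra.TensorProduct.includeRight (R := F) (A := L) e := rfl
  rw [this]
  exact (isUnit_iff_ne_zero.2 he).map _

lemma polar_map (φ : QF F m) {L : Type} [Field L] (σ : F →+* L) (x y : Fin m → F) :
    polar (φ.map σ : QF L m) (fun i => σ (x i)) (fun i => σ (y i)) = σ (polar φ x y) := by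
  unfold polar
  have h1 : ((fun i => σ (x i)) + fun i => σ (y i)) = fun i => σ ((x + y) i) := by ext; simp
  rw [h1, eval_map, eval_map, eval_map, map_sub, map_sub]

variable {f} in
lemma reduced_tensor {φ : QF F m} (hker : RingHom.ker f = Ideal.span {affinePoly φ})
    (hadj : IntermediateField.adjoin F (Set.range fun i => f (MvPolynomial.X i)) = ⊤)
    [CharP L 2] (hφ : ∃ x y, polar (φ.map (algebraMap F L) : QF L m) x y ≠ 0) : IsReduced (L ⊗[F] E) := by
  constructor
  rintro y ⟨k, hk⟩
  obtain ⟨b, g, hb, hg⟩ := clear_denom L hadj y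
  have hsq : Squarefree (affinePoly (φ.map (algebraMap F L) : QF L m)) :=
    affinePoly_squarefree _ hφ
  have h0 : Phi f L (g ^ k) = 0 := by
    rw [map_pow, ← hg, mul_pow, hk, zero_mul]
  rw [Phi_eq_zero L hker] at h0
  have h1 := hsq.isRadical k g h0
  rw [← Phi_eq_zero L hker, ← hg] at h1
  exact ((isUnit_one_tmul L hb).mul_left_eq_zero).1 h1

lemma IsFunctionField.isSepExt [CharP F 2] {φ : QF F m} (h : IsFunctionField φ E)
    (hφ : ∃ x y, polar φ x y ≠ 0) : IsSepExt F E := by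
  intro L _ _ _
  obtain ⟨f, hker, hadj⟩ := h
  have : CharP L 2 := charP_of_injective_algebraMap (algebraMap F L).injective 2
  have := reduced_tensor L hker hadj (by
    obtain ⟨x, y, hxy⟩ := hφ
    refine ⟨fun i => algebraMap F L (x i), fun i => algebraMap F L (y i), ?_⟩
    rw [polar_map]
    simpa using hxy)
  exact isReduced_of_injective (Algebra.TensorProduct.comm F E L) (AlgEquiv.injective _)

end FF2
end QF

namespace QF
open scoped TensorProduct

section Sep

lemma sep_aux {E G R : Type} [Field E] [Field G] [Algebra E G] [CharP E 2] [CommRing R] [Algebra E R]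
    (hsep : IsSepExt E G) (hR : IsField R)
    (hpi : ∀ y : R, ∃ n : ℕ, y ^ 2 ^ n ∈ (algebraMap E R).range) : IsReduced (G ⊗[E] R) := by
  letI := hR.toField
  refine hsep R ?_
  rw [isPurelyInseparable_iff_pow_mem E 2]
  exact hpi

lemma IsSepExt.trans' {F E G : Type} [Field F] [Field E] [Field G] [Algebra F E] [Algebra F G]
    [Algebra E G] [IsScalarTower F E G] [CharP F 2] (h1 : IsSepExt F E) (h2 : IsSepExt E G) :
    IsSepExt F G := by
  intro L _ _ hL
  have hc : CharP E 2 := charP_of_injective_algebraMap (algebraMap F E).injective 2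
  have hred := h1 L hL
  rw [isPurelyInseparable_iff_pow_mem F 2] at hL
  have hcR : CharP (E ⊗[F] L) 2 := charP_of_injective_algebraMap (algebraMap E (E ⊗[F] L)).injective 2
  have hpi : ∀ y : E ⊗[F] L, ∃ n : ℕ, y ^ 2 ^ n ∈ (algebraMap E (E ⊗[F] L)).range := by
    intro y
    induction y with
    | zero => exact ⟨0, 0, by simp⟩
    | tmul e l =>
      obtain ⟨n, a, ha⟩ := hL l
      refine ⟨n, e ^ 2 ^ n * algebraMap F E a, ?_⟩
      rw [Algebra.TensorProduct.tmul_pow, ← ha, Algebra.TensorProduct.algebraMap_apply,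
        Algebra.algebraMap_eq_smul_one a, Algebra.algebraMap_eq_smul_one (R := F) (A := L) a,
        ← TensorProduct.smul_tmul]
      simp
    | add y z hy hz =>
      obtain ⟨n, a, ha⟩ := hy
      obtain ⟨k, b, hb⟩ := hz
      refine ⟨n + k, a ^ 2 ^ k + b ^ 2 ^ n, ?_⟩
      rw [add_pow_char_pow, map_add, map_pow, map_pow, ha, hb, pow_add, pow_mul, mul_comm (2 ^ n), pow_mul]
  have hF : IsField (E ⊗[F] L) := by
    refine ⟨exists_pair_ne _, mul_comm, ?_⟩
    intro y hy
    obtain ⟨n, e, he⟩ := hpi y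
    have he0 : e ≠ 0 := by
      rintro rfl
      rw [map_zero] at he
      exact hy (eq_zero_of_pow_eq_zero he.symm)
    have hu : IsUnit (y ^ 2 ^ n) := by
      rw [← he]; exact (isUnit_iff_ne_zero.2 he0).map _
    have hu2 : IsUnit y := (isUnit_pow_iff (by positivity)).1 hu
    exact hu2.exists_right_inv
  have := sep_aux (G := G) h2 hF hpi
  exact isReduced_of_injective (Algebra.TensorProduct.cancelBaseChange F E E G L).symm
    (AlgEquiv.injective _)

lemma isSepExt_of_bij {F E : Type} [Field F] [Field E] [Algebra F E]
    (h : Function.Bijective (algebraMap F E)) : IsSepExt F E := by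
  intro L _ _ _
  let e : F ≃ₐ[F] E := AlgEquiv.ofBijective (Algebra.ofId F E) h
  let g : E ⊗[F] L ≃ₐ[F] L :=
    (Algebra.TensorProduct.congr e.symm AlgEquiv.refl).trans (Algebra.TensorProduct.lid F L)
  exact isReduced_of_injective g (AlgEquiv.injective _)

lemma IsSepExt.diag_aniso {F K : Type} [Field F] [Field K] [Algebra F K] [CharP F 2]
    (hK : IsSepExt F K) {s : ℕ} {c : Fin s → F} (hc : Anisotropic (diag c)) :
    Anisotropic (diag fun i => algebraMap F K (c i)) := by
  intro x hx
  rw [eval_diag] at hx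
  let L := perfectClosure F (AlgebraicClosure F)
  have hcL : CharP L 2 := charP_of_injective_algebraMap (algebraMap F L).injective 2
  have hcK : CharP K 2 := charP_of_injective_algebraMap (algebraMap F K).injective 2
  have hcT : CharP (K ⊗[F] L) 2 := charP_of_injective_algebraMap (algebraMap K (K ⊗[F] L)).injective 2
  have hroot : ∀ i, ∃ z : L, z ^ 2 = algebraMap F L (c i) := by
    intro i
    obtain ⟨z, hz⟩ := IsAlgClosed.exists_pow_nat_eq (algebraMap F (AlgebraicClosure F) (c i)) (n := 2) (by norm_num)
    refine ⟨⟨z, ?_⟩, ?_⟩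
    · rw [mem_perfectClosure_iff_pow_mem 2]
      exact ⟨1, c i, by simp [hz]⟩
    · apply Subtype.ext
      exact hz
  choose z hz using hroot
  have hli : LinearIndependent F z := by
    rw [Fintype.linearIndependent_iff]
    intro g hg
    have h1 : eval (diag c) g = 0 := by
      rw [eval_diag]
      apply (algebraMap F L).injective
      have := congrArg (· ^ 2) hg
      simp only [CharTwo.sum_sq] at this
      rw [map_sum, map_zero, ← zero_pow (two_ne_zero), ← this]
      refine Finset.sum_congr rfl fun i _ => ?_
      rw [Algebra.smul_def, mul_pow, hz]; simp [mul_comm]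
    exact fun i => congrFun (hc g h1) i
  have hred : IsReduced (K ⊗[F] L) := hK L inferInstance
  have h0 : ∑ i, x i ⊗ₜ[F] z i = 0 := by
    have : (∑ i, x i ⊗ₜ[F] z i) ^ 2 = 0 := by
      refine (CharTwo.sum_sq (R := K ⊗[F] L) _ _).trans ?_
      have h2 : ∀ i, (x i ⊗ₜ[F] z i) ^ 2 = (algebraMap F K (c i) * x i ^ 2) ⊗ₜ[F] (1 : L) := by
        intro i
        rw [Algebra.TensorProduct.tmul_pow, hz, Algebra.algebraMap_eq_smul_one,
          ← TensorProduct.smul_tmul, Algebra.smul_def]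
      simp only [h2]
      rw [← TensorProduct.sum_tmul, hx, TensorProduct.zero_tmul]
    exact eq_zero_of_pow_eq_zero this
  -- linear independence
  have hli2 : LinearIndependent K (fun i => (1 : K) ⊗ₜ[F] z i) := by
    have := Module.Flat.linearIndependent_one_tmul (S := K) hli
    exact this
  rw [Fintype.linearIndependent_iff] at hli2
  ext i
  refine hli2 x ?_ i
  rw [← h0]
  refine Finset.sum_congr rfl fun i _ => ?_
  simp [TensorProduct.smul_tmul']

end Sep
end QF

namespace QF
open scoped TensorProduct

section PT

lemma Anisotropic.poly {M : Type} [Field M] {m k : ℕ} {φ : QF M m} (h : Anisotropic φ)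
    (x : Fin m → MvPolynomial (Fin k) M)
    (hx : ∑ i, ∑ j, MvPolynomial.C (φ i j) * x i * x j = 0) : x = 0 := by
  classical
  by_contra hne
  let o : MonomialOrder (Fin k) := MonomialOrder.lex
  have hne' : (Finset.univ.filter fun i => x i ≠ 0).Nonempty := by
    obtain ⟨i, hi⟩ := Function.ne_iff.1 hne
    exact ⟨i, by simpa using hi⟩
  obtain ⟨i₀, hi₀, hmax⟩ := Finset.exists_max_image _ (fun i => o.toSyn (o.degree (x i))) hne'
  set δ := o.degree (x i₀) with hδ
  have hle : ∀ i, o.toSyn (o.degree (x i)) ≤ o.toSyn δ := by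
    intro i
    by_cases hi : x i = 0
    · rw [hi, MonomialOrder.degree_zero, map_zero]; exact bot_le
    · exact hmax i (by simpa using hi)
  have hc : ∀ i j, (MvPolynomial.C (φ i j) * x i * x j).coeff (δ + δ) =
      φ i j * (x i).coeff δ * (x j).coeff δ := by
    intro i j
    rw [mul_assoc, MvPolynomial.coeff_C_mul, o.coeff_mul_of_add_of_degree_le (hle i) (hle j), mul_assoc]
  have h0 : eval φ (fun i => (x i).coeff δ) = 0 := by
    have := congrArg (MvPolynomial.coeff (δ + δ)) hx
    simp only [MvPolynomial.coeff_sum, hc, MvPolynomial.coeff_zero] at this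
    exact this
  have h1 := congrFun (h _ h0) i₀
  have h2 : x i₀ ≠ 0 := by simpa using hi₀
  exact h2 (o.coeff_degree_eq_zero_iff.1 h1)

lemma Anisotropic.ratfun {M : Type} [Field M] {m : ℕ} (k : ℕ) {φ : QF M m} (h : Anisotropic φ) :
    Anisotropic (φ.map (algebraMap M (FractionRing (MvPolynomial (Fin k) M))) :
      QF (FractionRing (MvPolynomial (Fin k) M)) m) := by
  intro x hx
  obtain ⟨b, hb⟩ := IsLocalization.exist_integer_multiples_of_finite
    (nonZeroDivisors (MvPolynomial (Fin k) M)) x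
  choose y hy using hb
  have hb0 : algebraMap _ (FractionRing (MvPolynomial (Fin k) M)) (b : MvPolynomial (Fin k) M) ≠ 0 := by
    simp
  have hy' : ∀ i, algebraMap _ (FractionRing (MvPolynomial (Fin k) M)) (y i) =
      algebraMap _ _ (b : MvPolynomial (Fin k) M) * x i := by
    intro i
    rw [hy, Algebra.smul_def]
  have h1 : y = 0 := by
    apply h.poly
    apply FaithfulSMul.algebraMap_injective _ (FractionRing (MvPolynomial (Fin k) M))
    have h2 : ∀ a : M, algebraMap _ (FractionRing (MvPolynomial (Fin k) M)) (MvPolynomial.C a) =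
      algebraMap M _ a := fun a =>
        (IsScalarTower.algebraMap_apply M (MvPolynomial (Fin k) M) _ a).symm
    simp only [map_sum, map_mul, hy', h2, map_zero]
    have : eval (φ.map (algebraMap M (FractionRing (MvPolynomial (Fin k) M))) :
      QF (FractionRing (MvPolynomial (Fin k) M)) m)
        ((algebraMap _ (FractionRing (MvPolynomial (Fin k) M)) (b : MvPolynomial (Fin k) M)) • x) = 0 := by
      rw [eval_smul, hx, mul_zero]
    exact this
  ext i
  have := hy' i
  rw [h1] at this
  simpa using this

end PT
end QF

namespace QF
open scoped TensorProduct

section Gen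

lemma lift_frac {R E N : Type} [CommRing R] [Field E] [Field N] (f : R →+* E) (ψ : R →+* N)
    (hk : ∀ g, f g = 0 ↔ ψ g = 0) (hf : ∀ e : E, ∃ a b, f b ≠ 0 ∧ e * f b = f a) :
    ∃ γ : E →+* N, ∀ g, γ (f g) = ψ g := by
  let A := f.range
  have hs : Function.Surjective f.rangeRestrict := f.rangeRestrict_surjective
  let ψ' : f.range →+* N := RingHom.liftOfSurjective f.rangeRestrict hs ⟨ψ, by
    intro x hx
    rw [RingHom.mem_ker] at hx ⊢
    rw [← hk]
    exact congrArg Subtype.val hx⟩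
  have hψ' : ∀ g, ψ' (f.rangeRestrict g) = ψ g := fun g =>
    RingHom.liftOfRightInverse_comp_apply _ _ _ _ _
  have hinj : Function.Injective ψ' := by
    rw [injective_iff_map_eq_zero]
    intro a ha
    obtain ⟨g, rfl⟩ := hs a
    rw [hψ', ← hk] at ha
    exact Subtype.ext ha
  have : IsFractionRing f.range E := by
    apply IsFractionRing.of_field
    intro e
    obtain ⟨a, b, hb, hab⟩ := hf e
    refine ⟨f.rangeRestrict a, f.rangeRestrict b, ?_⟩
    change e = f a / f b
    rw [← hab]; field_simp
  refine ⟨IsFractionRing.lift hinj, fun g => ?_⟩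
  rw [← hψ']
  exact IsFractionRing.lift_algebraMap hinj (f.rangeRestrict g)

lemma polar_sum {M : Type} [Field M] {m : ℕ} (φ : QF M m) (x y : Fin m → M) :
    polar φ x y = ∑ i, ∑ j, φ i j * (x i * y j + y i * x j) := by
  rw [polar_eq_bl, Matrix.toBilin'_apply, Matrix.toBilin'_apply]
  rw [← Finset.sum_add_distrib]
  refine Finset.sum_congr rfl fun i _ => ?_
  rw [← Finset.sum_add_distrib]
  refine Finset.sum_congr rfl fun j _ => ?_
  ring

/-- the generic reflected point -/
noncomputable def xp {M : Type} [Field M] {m : ℕ} (φ : QF M m) (v : Fin m → M) (k : Fin m) :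
    MvPolynomial (Fin m) M :=
  (∑ i, ∑ j, MvPolynomial.C (φ i j) * MvPolynomial.X i * MvPolynomial.X j) * MvPolynomial.C (v k) +
  (∑ i, ∑ j, MvPolynomial.C (φ i j) *
    (MvPolynomial.X i * MvPolynomial.C (v j) + MvPolynomial.C (v i) * MvPolynomial.X j)) *
      MvPolynomial.X k

lemma xp_eval {M : Type} [Field M] {m : ℕ} (φ : QF M m) (v : Fin m → M) (k : Fin m)
    {N : Type} [Field N] (σ : M →+* N) (u : Fin m → N) :
    MvPolynomial.eval₂Hom σ u (xp φ v k) = eval (φ.map σ : QF N m) u * σ (v k) +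
      polar (φ.map σ : QF N m) u (fun i => σ (v i)) * u k := by
  rw [polar_sum]
  simp [xp, eval, map_sum]

lemma eval_reflect {N : Type} [Field N] [CharP N 2] {m : ℕ} (φ : QF N m) (u v : Fin m → N)
    (hv : eval φ v = 0) : eval φ (fun k => eval φ u * v k + polar φ u v * u k) = 0 := by
  have : (fun k => eval φ u * v k + polar φ u v * u k) = eval φ u • v + polar φ u v • u := rfl
  rw [this, eval_add, eval_smul, eval_smul, polar_smul_left, polar_smul_right, polar_comm φ v u, hv]
  linear_combination (eval φ u * polar φ u v ^ 2) * (CharTwo.two_eq_zero (R := N))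

lemma generic_step {F : Type} [Field F] [CharP F 2] {m : ℕ} (hm : 2 ≤ m) {φ : QF F m}
    (hφ : Anisotropic φ) {E : Type} [Field E] [Algebra F E] (hE : IsFunctionField φ E)
    {M : Type} [Field M] [Algebra F M] (v : Fin m → M)
    (hv : eval (φ.map (algebraMap F M) : QF M m) v = 0)
    (y : Fin m → M) (hy : polar (φ.map (algebraMap F M) : QF M m) v y ≠ 0) :
    ∃ γ : E →+* FractionRing (MvPolynomial (Fin m) M), ∀ a, γ (algebraMap F E a) =
      algebraMap M _ (algebraMap F M a) := by
  obtain ⟨f, hker, hadj⟩ := hE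
  have hcM : CharP M 2 := charP_of_injective_algebraMap (algebraMap F M).injective 2
  set φM : QF M m := φ.map (algebraMap F M) with hφM
  have hred : IsReduced (M ⊗[F] E) := reduced_tensor M hker hadj ⟨v, y, hy⟩
  have hfz : f (affinePoly φ) = 0 := by
    have : affinePoly φ ∈ RingHom.ker f := by rw [hker]; exact Ideal.mem_span_singleton_self _
    exact this
  -- the element b(ξ, v)
  let a : Fin m → M := fun i => ∑ j, (φM i j * v j + φM j i * v j)
  have hpa : ∀ {N : Type} [Field N] (σ : M →+* N) (u : Fin m → N),
      polar (φM.map σ : QF N m) u (fun i => σ (v i)) = ∑ i, σ (a i) * u i := by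
    intro N _ σ u
    rw [polar_sum]
    simp only [mul_add, Finset.sum_add_distrib, a, map_add, map_sum, map_mul, add_mul, Finset.sum_mul]
    congr 1
    · refine Finset.sum_congr rfl fun i _ => Finset.sum_congr rfl fun j _ => ?_
      simp; ring
    · rw [Finset.sum_comm]
      refine Finset.sum_congr rfl fun i _ => Finset.sum_congr rfl fun j _ => ?_
      simp; ring
  have ha : a ≠ 0 := by
    intro h0
    apply hy
    rw [polar_comm]
    have := hpa (RingHom.id M) y
    rw [h0] at this
    simpa using this
  have h00 : φ ⟨0, by omega⟩ ⟨0, by omega⟩ ≠ 0 := by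
    intro h0
    have h1 : eval φ (Pi.single ⟨0, by omega⟩ 1) = 0 := by
      rw [eval_eq_bl, Matrix.toBilin'_single, h0]
    have := congrFun (hφ _ h1) ⟨0, by omega⟩
    simp at this
  have hb0 : Phi f M (lf a) ≠ 0 := by
    rw [Ne, Phi_eq_zero M hker]
    rintro ⟨c, hc⟩
    have hne := lf_ne_zero a ha
    have hdeg := lf_totalDegree a
    rw [hc] at hne hdeg
    rw [MvPolynomial.totalDegree_mul_of_isDomain (left_ne_zero_of_mul hne)
      (right_ne_zero_of_mul hne)] at hdeg
    have := affinePoly_totalDegree hm φM (by simpa [φM] using h00)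
    rw [hφM] at this
    omega
  have hnil : ¬ IsNilpotent (Phi f M (lf a)) := fun h => hb0 h.eq_zero
  rw [nilpotent_iff_mem_prime] at hnil
  push Not at hnil
  obtain ⟨P, hP, hbP⟩ := hnil
  let E' := FractionRing ((M ⊗[F] E) ⧸ P)
  let ι : M ⊗[F] E →+* E' := (algebraMap ((M ⊗[F] E) ⧸ P) E').comp (Ideal.Quotient.mk P)
  have hι : ι (Phi f M (lf a)) ≠ 0 := by
    intro h0
    apply hbP
    rw [← Ideal.Quotient.eq_zero_iff_mem]
    exact (FaithfulSMul.algebraMap_injective _ E') (by rw [map_zero]; exact h0)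
  let σ : M →+* E' := ι.comp (Algebra.TensorProduct.includeLeftRingHom)
  let τ : E →+* E' := ι.comp (Algebra.TensorProduct.includeRight (R := F) (A := M) (B := E)).toRingHom
  have hστ : ∀ c : F, σ (algebraMap F M c) = τ (algebraMap F E c) := by
    intro c
    change ι (algebraMap F M c ⊗ₜ 1) = ι (1 ⊗ₜ algebraMap F E c)
    rw [Algebra.algebraMap_eq_smul_one, Algebra.algebraMap_eq_smul_one, TensorProduct.smul_tmul]
  let ξ : Fin m → E' := fun i => τ (f (gp F m i))
  have hξ : eval (φM.map σ : QF E' m) ξ = 0 := by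
    have : τ (f (affinePoly φ)) = eval (φM.map σ : QF E' m) ξ := by
      rw [affinePoly_eq_s2]
      simp only [map_sum, map_mul, eval]
      refine Finset.sum_congr rfl fun i _ => Finset.sum_congr rfl fun j _ => ?_
      simp only [ξ, φM, Matrix.map_apply, hστ]
      congr 3
      exact f.commutes (φ i j)
    rw [← this, hfz, map_zero]
  set bb := polar (φM.map σ : QF E' m) ξ (fun i => σ (v i)) with hbb
  have hbb0 : bb ≠ 0 := by
    rw [hbb, hpa]
    convert hι using 1
    unfold lf
    simp only [map_sum, map_mul]
    refine Finset.sum_congr rfl fun i _ => ?_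
    have : gp M m i = MvPolynomial.map (algebraMap F M) (gp F m i) := by simp [gp_eq]
    rw [Phi_C, this, Phi_map]
    rfl
  -- the evaluation
  let ev : MvPolynomial (Fin m) M →+* E' := MvPolynomial.eval₂Hom σ ξ
  have hev : ∀ k, ev (xp φM v k) = bb * ξ k := by
    intro k
    rw [show ev (xp φM v k) = _ from xp_eval φM v k σ ξ, hξ, zero_mul, zero_add]
  let l : Fin m := ⟨m - 1, by omega⟩
  have hξl : ξ l = 1 := by simp [ξ, gp, l]
  let M' := FractionRing (MvPolynomial (Fin m) M)
  let al : MvPolynomial (Fin m) M →+* M' := algebraMap _ _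
  have hal : Function.Injective al := FaithfulSMul.algebraMap_injective _ _
  let x : Fin m → M' := fun k => al (xp φM v k)
  have hxl : x l ≠ 0 := by
    intro h0
    have h1 : xp φM v l = 0 := hal (by rw [map_zero]; exact h0)
    have := hev l
    rw [h1, map_zero, hξl, mul_one] at this
    exact hbb0 this.symm
  let ρ : M →+* M' := al.comp MvPolynomial.C
  have hρ : ∀ a, ρ a = algebraMap M M' a := fun a =>
    (IsScalarTower.algebraMap_apply M (MvPolynomial (Fin m) M) _ a).symm
  have hcM' : CharP M' 2 := charP_of_injective_algebraMap (algebraMap M M').injective 2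
  have hx0 : eval (φM.map ρ : QF M' m) x = 0 := by
    have h1 : al = MvPolynomial.eval₂Hom ρ (fun i => al (MvPolynomial.X i)) := by
      apply MvPolynomial.ringHom_ext
      · intro r; simp [ρ]
      · intro i; simp
    have h2 : x = fun k => _ := funext fun k => (show x k = _ by
      change al (xp φM v k) = _
      rw [h1, xp_eval])
    rw [h2]
    apply eval_reflect
    rw [eval_map, hv, map_zero]
  let ψ : MvPolynomial (Fin (m - 1)) F →+* M' :=
    MvPolynomial.eval₂Hom (ρ.comp (algebraMap F M)) (fun i => x ⟨i, by omega⟩ / x l)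
  have hψgp : ∀ i, ψ (gp F m i) = x i / x l := by
    intro i
    unfold gp
    split_ifs with h
    · simp [ψ]
    · have : i = l := by ext; simp [l]; omega
      rw [this, map_one, div_self hxl]
  have hψ0 : ψ (affinePoly φ) = 0 := by
    rw [affinePoly_eq_s2]
    simp only [map_sum, map_mul, hψgp]
    have h1 : eval (φM.map ρ : QF M' m) ((x l)⁻¹ • x) = 0 := by
      rw [eval_smul, hx0, mul_zero]
    rw [← h1, eval]
    refine Finset.sum_congr rfl fun i _ => Finset.sum_congr rfl fun j _ => ?_
    simp [ψ, φM, div_eq_inv_mul]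
  have hgen : ∀ g, ∃ (d : ℕ) (G : MvPolynomial (Fin m) M), al G = x l ^ d * ψ g ∧
      ev G = bb ^ d * τ (f g) := by
    intro g
    induction g using MvPolynomial.induction_on with
    | C c =>
      refine ⟨0, MvPolynomial.C (algebraMap F M c), ?_, ?_⟩
      · simp [ψ, ρ]
      · simp only [pow_zero, one_mul, ev, MvPolynomial.eval₂Hom_C, hστ]
        exact congrArg τ (f.commutes c).symm
    | add p q hp hq =>
      obtain ⟨d, G, h1, h2⟩ := hp
      obtain ⟨d', G', h1', h2'⟩ := hq
      refine ⟨d + d', xp φM v l ^ d' * G + xp φM v l ^ d * G', ?_, ?_⟩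
      · simp only [map_add, map_mul, map_pow, h1, h1']
        change x l ^ d' * _ + x l ^ d * _ = _
        ring
      · simp only [map_add, map_mul, map_pow, h2, h2', hev, hξl]
        ring
    | mul_X p i hp =>
      obtain ⟨d, G, h1, h2⟩ := hp
      refine ⟨d + 1, G * xp φM v ⟨i, by omega⟩, ?_, ?_⟩
      · rw [map_mul, map_mul, h1]
        have : ψ (MvPolynomial.X i) = x ⟨i, by omega⟩ / x l := by simp [ψ]
        rw [this]
        have h3 : x l * (x ⟨i, by omega⟩ / x l) = x ⟨i, by omega⟩ := mul_div_cancel₀ _ hxl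
        change _ * x _ = _
        generalize x ⟨i, by omega⟩ / x l = z at h3 ⊢
        linear_combination (-(x l ^ d * ψ p)) * h3
      · rw [map_mul, map_mul, map_mul, h2, hev]
        have : ξ ⟨i, by omega⟩ = τ (f (MvPolynomial.X i)) := by simp [ξ, gp]
        rw [this]; ring
  have hk : ∀ g, f g = 0 ↔ ψ g = 0 := by
    intro g
    constructor
    · intro h
      have : g ∈ RingHom.ker f := h
      rw [hker, Ideal.mem_span_singleton] at this
      obtain ⟨c, rfl⟩ := this
      rw [map_mul, hψ0, zero_mul]
    · intro h
      obtain ⟨d, G, h1, h2⟩ := hgen g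
      have hG : G = 0 := hal (by rw [h1, h, mul_zero, map_zero])
      rw [hG, map_zero] at h2
      have := (mul_eq_zero.1 h2.symm).resolve_left (pow_ne_zero _ hbb0)
      exact (map_eq_zero τ).1 this
  obtain ⟨γ, hγ⟩ := lift_frac f.toRingHom ψ hk (exists_frac hadj)
  refine ⟨γ, fun c => ?_⟩
  have h1 := hγ (MvPolynomial.C c)
  have h2 : f.toRingHom (MvPolynomial.C c) = algebraMap F E c := f.commutes c
  rw [h2] at h1
  rw [h1, ← hρ]
  simp [ψ]

end Gen
end QF

namespace QF
open scoped TensorProduct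

section Main
variable {F : Type} [Field F]

lemma decomp_map {n m w d : ℕ} {q : QF F n} {qa : QF F m}
    (h : Isom q (orthSum (orthSum qa (hyper w)) (zeroForm d))) {K : Type} [Field K] (σ : F →+* K) :
    Isom (q.map σ : QF K n) (orthSum (orthSum (qa.map σ : QF K m) (hyper w)) (zeroForm d)) := by
  have := h.map σ
  rwa [map_orthSum, map_orthSum, map_hyper, map_zeroForm] at this

lemma IsFunctionField.isotropic {m : ℕ} (hm : 2 ≤ m) {φ : QF F m} {E : Type} [Field E] [Algebra F E]
    (h : IsFunctionField φ E) : Isotropic (φ.map (algebraMap F E) : QF E m) := by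
  obtain ⟨f, hker, hadj⟩ := h
  have hfz : f (affinePoly φ) = 0 := by
    have : affinePoly φ ∈ RingHom.ker f := by rw [hker]; exact Ideal.mem_span_singleton_self _
    exact this
  refine ⟨fun i => f (gp F m i), ?_, ?_⟩
  · intro h0
    have := congrFun h0 ⟨m - 1, by omega⟩
    simp [gp] at this
  · rw [← hfz, affinePoly_eq_s2]
    simp only [map_sum, map_mul, eval]
    refine Finset.sum_congr rfl fun i _ => Finset.sum_congr rfl fun j _ => ?_
    congr 2
    exact (f.commutes (φ i j)).symm

lemma baseChange_tower {n : ℕ} (q : QF F n) (K K' : Type) [Field K] [Field K'] [Algebra F K]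
    [Algebra F K'] [Algebra K K'] [IsScalarTower F K K'] :
    baseChange q K' = ((baseChange q K).map (algebraMap K K') : QF K' n) := by
  ext i j
  simp only [baseChange, Matrix.map_apply]
  exact IsScalarTower.algebraMap_apply F K K' _

variable {n r s : ℕ} {q : QF F n}

lemma tower_lt (T : KnebuschTower q) {t : ℕ} (ht : t < T.h) :
    i0 (baseChange q (T.Fld t)) < i0 (baseChange q (T.Fld (t + 1))) := by
  obtain ⟨ha, w, d, hd⟩ := T.kern_spec t ht.le
  have h1 := i0_le_decomp ha hd
  have h2 := decomp_map hd (algebraMap (T.Fld t) (T.Fld (t + 1)))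
  have h3 := le_i0_decomp_iso ((T.step_ff t ht).isotropic (T.dims_ge t ht)) h2
  rw [baseChange_tower q (T.Fld t) (T.Fld (t + 1))]
  omega

lemma tower_strict (T : KnebuschTower q) {t t' : ℕ} (h : t < t') (ht' : t' ≤ T.h) :
    i0 (baseChange q (T.Fld t)) < i0 (baseChange q (T.Fld t')) := by
  induction t' with
  | zero => omega
  | succ k ih =>
    have h1 := tower_lt T (t := k) (by omega)
    rcases Nat.lt_succ_iff_lt_or_eq.1 h with h2 | h2
    · exact (ih h2 (by omega)).trans h1
    · rw [h2]; exact h1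

lemma sep_nd [CharP F 2] {c : Fin s → F} (hc : HasTypeWith q r s c) (hq : ND q) {K : Type} [Field K]
    [Algebra F K] (hK : IsSepExt F K) : ND (baseChange q K) := by
  have hcK : CharP K 2 := charP_of_injective_algebraMap (algebraMap F K).injective 2
  rw [hc.nd_iff] at hq
  exact (hc.map (algebraMap F K)).nd_iff.2 (hK.diag_aniso hq)

lemma tower_dims [CharP F 2] {c : Fin s → F} (hc : HasTypeWith q r s c)
    (T : KnebuschTower q) {t : ℕ} (ht : t ≤ T.h) (hnd : ND (baseChange q (T.Fld t))) :
    T.dims t + 2 * i0 (baseChange q (T.Fld t)) = r + r + s := by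
  obtain ⟨ha, w, d, hd⟩ := T.kern_spec t ht
  have h1 := i0_le_decomp ha hd
  have h2 := le_i0_decomp hd
  have h3 := (nd_decomp hnd hd).1
  have h4 := hd.dim_eq
  have h5 := hc.dim
  omega

lemma tower_sep [CharP F 2] {c : Fin s → F} (hc : HasTypeWith q r s c) (hq : ND q)
    (T : KnebuschTower q) {t : ℕ} (ht : t ≤ T.h)
    (h : ∀ t' < t, i0 (baseChange q (T.Fld t')) < r) : IsSepExt F (T.Fld t) := by
  induction t with
  | zero => exact isSepExt_of_bij T.base_bij
  | succ t ih =>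
    have hs := ih (by omega) (fun t' ht' => h t' (by omega))
    have hnd := sep_nd hc hq hs
    have hcK : CharP (T.Fld t) 2 :=
      charP_of_injective_algebraMap (algebraMap F (T.Fld t)).injective 2
    have hdim := tower_dims hc T (t := t) (by omega) hnd
    have hlt := h t (by omega)
    obtain ⟨ha, w, d, hd⟩ := T.kern_spec t (by omega)
    refine IsSepExt.trans' hs ((T.step_ff t (by omega)).isSepExt ?_)
    by_contra hne
    push Not at hne
    have := (hc.map (algebraMap F (T.Fld t))).kern_le hd hne
    omega

lemma tower_exists [CharP F 2] {c : Fin s → F} (hc : HasTypeWith q r s c) (hq : ND q)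
    (T : KnebuschTower q) : ∃ t ≤ T.h, i0 (baseChange q (T.Fld t)) = r := by
  by_contra hne
  push Not at hne
  have key : ∀ t, t ≤ T.h → i0 (baseChange q (T.Fld t)) < r := by
    intro t
    induction t using Nat.strong_induction_on with
    | _ t ih =>
      intro ht
      have hs := tower_sep hc hq T ht (fun t' h' => ih t' h' (by omega))
      have hnd := sep_nd hc hq hs
      have hcK : CharP (T.Fld t) 2 :=
        charP_of_injective_algebraMap (algebraMap F (T.Fld t)).injective 2
      have h1 := (hc.map (algebraMap F (T.Fld t))).i0_le hnd
      exact lt_of_le_of_ne h1 (hne t ht)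
  have hs := tower_sep hc hq T le_rfl (fun t' h' => key t' (by omega))
  have hnd := sep_nd hc hq hs
  have h1 := tower_dims hc T le_rfl hnd
  have h2 := key T.h le_rfl
  have h3 := T.dims_last
  omega

lemma tower_third [CharP F 2] {c : Fin s → F} (hc : HasTypeWith q r s c)
    (T : KnebuschTower q) {t0 : ℕ} (ht0 : t0 ≤ T.h) (hr : i0 (baseChange q (T.Fld t0)) = r)
    {K : Type} [Field K] [Algebra F K] (hK : ND (baseChange q K)) :
    ∃ t ≤ t0, i0 (baseChange q (T.Fld t)) = i0 (baseChange q K) := by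
  have hcK : CharP K 2 := charP_of_injective_algebraMap (algebraMap F K).injective 2
  have hle := (hc.map (algebraMap F K)).i0_le hK
  obtain ⟨mK, qK, haK, hdK⟩ := exists_aniso_split hK
  by_contra hne
  push Not at hne
  have hmap : ∀ (t : ℕ), t ≤ T.h → ∀ (M : Type) [Field M] (α : K →+* M) (β : T.Fld t →+* M)
      (_ : ∀ a, α (algebraMap F K a) = β (algebraMap F (T.Fld t) a)),
      ((baseChange q K).map α : QF M n) = (baseChange q (T.Fld t)).map β := by
    intro t _ M _ α β h
    ext i j
    simp only [baseChange, Matrix.map_apply]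
    exact h _
  have key : ∀ t, t ≤ t0 → ∃ (M : Type) (_ : Field M) (α : K →+* M) (β : T.Fld t →+* M),
      (∀ a, α (algebraMap F K a) = β (algebraMap F (T.Fld t) a)) ∧
      (∀ (m : ℕ) (φ : QF K m), Anisotropic φ → Anisotropic (φ.map α : QF M m)) ∧
      i0 (baseChange q (T.Fld t)) ≤ i0 (baseChange q K) := by
    have fin : ∀ (t : ℕ), t ≤ t0 → ∀ (M : Type) [Field M] (α : K →+* M) (β : T.Fld t →+* M)
      (_ : ∀ a, α (algebraMap F K a) = β (algebraMap F (T.Fld t) a))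
      (_ : ∀ (m : ℕ) (φ : QF K m), Anisotropic φ → Anisotropic (φ.map α : QF M m)),
      i0 (baseChange q (T.Fld t)) ≤ i0 (baseChange q K) := by
      intro t ht M _ α β hαβ hα
      obtain ⟨ha, w, d, hd⟩ := T.kern_spec t (by omega)
      have h1 := le_i0_decomp (decomp_map hd β)
      have h2 := i0_le_decomp (hα _ _ haK) (decomp_map hdK α)
      rw [← hmap t (by omega) M α β hαβ] at h1
      have h3 := i0_le_decomp ha hd
      omega
    intro t
    induction t with
    | zero =>
      intro ht
      let e := RingEquiv.ofBijective (algebraMap F (T.Fld 0)) T.base_bij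
      have h1 : ∀ a, RingHom.id K (algebraMap F K a) =
          ((algebraMap F K).comp e.symm.toRingHom) (algebraMap F (T.Fld 0) a) := by
        intro a
        have : e.symm (algebraMap F (T.Fld 0) a) = a := e.symm_apply_apply a
        simp [this]
      have h2 : ∀ (m : ℕ) (φ : QF K m), Anisotropic φ → Anisotropic (φ.map (RingHom.id K) : QF K m) := by
        intro m φ h
        have : (φ.map (RingHom.id K) : QF K m) = φ := by ext; simp
        rw [this]; exact h
      exact ⟨K, inferInstance, RingHom.id K, _, h1, h2, fin 0 ht K _ _ h1 h2⟩
    | succ t ih =>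
      intro ht
      obtain ⟨M, _, α, β, hαβ, hα, hj⟩ := ih (by omega)
      have hlt := lt_of_le_of_ne hj (hne t (by omega))
      obtain ⟨ha, w, d, hd⟩ := T.kern_spec t (by omega)
      have hcM : CharP M 2 := charP_of_injective_ringHom α.injective 2
      have hcT : CharP (T.Fld t) 2 :=
        charP_of_injective_algebraMap (algebraMap F (T.Fld t)).injective 2
      have heq := hmap t (by omega) M α β hαβ
      have hndM : ND ((baseChange q (T.Fld t)).map β : QF M n) := by
        rw [← heq]
        have hcK' := hc.map (algebraMap F K)
        have hcM' := hcK'.map α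
        have h5 := hα _ _ (hcK'.nd_iff.1 hK)
        rw [map_diag] at h5
        exact hcM'.nd_iff.2 h5
      have hdM := decomp_map hd β
      have hndk := (nd_decomp hndM hdM).2
      have hiso : ¬ Anisotropic ((T.kern t).map β : QF M (T.dims t)) := by
        intro h0
        have h1 := i0_le_decomp h0 hdM
        have h2 := le_i0_decomp (decomp_map hdK α)
        have h3 := le_i0_decomp hd
        rw [heq] at h2
        omega
      have hv : ∃ v, eval ((T.kern t).map β : QF M (T.dims t)) v = 0 ∧ v ≠ 0 := by
        unfold Anisotropic at hiso
        push Not at hiso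
        exact hiso
      obtain ⟨v, hv, hv0⟩ := hv
      have hy : ∃ y, polar ((T.kern t).map β : QF M (T.dims t)) v y ≠ 0 := by
        by_contra h0
        push Not at h0
        exact hv0 (hndk v hv h0)
      obtain ⟨y, hy⟩ := hy
      letI := β.toAlgebra
      obtain ⟨γ, hγ⟩ := generic_step (T.dims_ge t (by omega)) ha (T.step_ff t (by omega)) v hv y hy
      let M' := FractionRing (MvPolynomial (Fin (T.dims t)) M)
      have h1 : ∀ a, ((algebraMap M M').comp α) (algebraMap F K a) =
          γ (algebraMap F (T.Fld (t + 1)) a) := by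
        intro a
        rw [IsScalarTower.algebraMap_apply F (T.Fld t) (T.Fld (t + 1)), hγ, RingHom.comp_apply, hαβ]
        rfl
      have h2 : ∀ (m : ℕ) (φ : QF K m), Anisotropic φ →
          Anisotropic (φ.map ((algebraMap M M').comp α) : QF M' m) := by
        intro m φ h
        have h3 := (hα m φ h).ratfun (T.dims t)
        rw [Matrix.map_map] at h3
        exact h3
      exact ⟨M', inferInstance, _, γ, h1, h2, fin (t + 1) ht M' _ _ h1 h2⟩
  obtain ⟨-, -, -, -, -, -, h⟩ := key t0 le_rfl
  have h5 := hne t0 le_rfl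
  have hle' : i0 (baseChange q K) ≤ r := hle
  omega

end Main
end QF

/-- Lemma 2.4: let `φ` be a nondefective quadratic form of type `(r, s)`
over a field `F` of characteristic 2, with Knebusch splitting tower
`F = F₀ ⊆ ⋯ ⊆ F_h`.  Then there is a unique `0 ≤ h_nd ≤ h` with `j_{h_nd}(φ) = r`
(where `j_t(φ) = i₀(φ_{F_t})`), and moreover
`{j_t(φ) : 0 ≤ t ≤ h_nd} = {i_W(φ_K) : K/F separable} = {i₀(φ_K) : K/F with i_d(φ_K) = 0}`. -/
theorem statement2 (F : Type) [Field F] [CharP F 2] {n r s : ℕ} (q : QF F n)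
    (htype : QF.HasType q r s) (hnd : QF.Nondefective q)
    (T : QF.KnebuschTower q) :
    (∃! t : ℕ, t ≤ T.h ∧ QF.i0 (QF.baseChange q (T.Fld t)) = r) ∧
    ∀ t0 : ℕ, t0 ≤ T.h → QF.i0 (QF.baseChange q (T.Fld t0)) = r →
      ({w : ℕ | ∃ t, t ≤ t0 ∧ QF.i0 (QF.baseChange q (T.Fld t)) = w}
          = {w : ℕ | ∃ K : QF.FieldExt F, QF.IsSepExt F K.carrier ∧
              QF.wittIndex (QF.baseChange q K.carrier) = w} ∧
        {w : ℕ | ∃ t, t ≤ t0 ∧ QF.i0 (QF.baseChange q (T.Fld t)) = w}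
          = {w : ℕ | ∃ K : QF.FieldExt F, QF.defect (QF.baseChange q K.carrier) = 0 ∧
              QF.i0 (QF.baseChange q K.carrier) = w}) := by
  obtain ⟨c, hc⟩ := htype
  have hq : QF.ND q := (QF.defect_eq_zero_iff _).1 hnd
  refine ⟨?_, ?_⟩
  · obtain ⟨t, ht, htr⟩ := QF.tower_exists hc hq T
    refine ⟨t, ⟨ht, htr⟩, ?_⟩
    rintro t' ⟨ht', htr'⟩
    rcases lt_trichotomy t t' with h | h | h
    · have := QF.tower_strict T h ht'
      omega
    · exact h.symm
    · have := QF.tower_strict T h ht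
      omega
  · intro t0 ht0 hr
    have hsep : ∀ t, t ≤ t0 → QF.IsSepExt F (T.Fld t) := by
      intro t ht
      apply QF.tower_sep hc hq T (by omega)
      intro t' ht'
      have := QF.tower_strict T (t := t') (t' := t0) (by omega) ht0
      omega
    constructor
    · ext w
      constructor
      · rintro ⟨t, ht, rfl⟩
        exact ⟨⟨T.Fld t⟩, hsep t ht, QF.wittIndex_eq_i0 (QF.sep_nd hc hq (hsep t ht))⟩
      · rintro ⟨K, hK, rfl⟩
        have h1 := QF.sep_nd hc hq hK
        rw [QF.wittIndex_eq_i0 h1]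
        exact QF.tower_third hc T ht0 hr h1
    · ext w
      constructor
      · rintro ⟨t, ht, rfl⟩
        exact ⟨⟨T.Fld t⟩, (QF.defect_eq_zero_iff _).2 (QF.sep_nd hc hq (hsep t ht)), rfl⟩
      · rintro ⟨K, hK, rfl⟩
        exact QF.tower_third hc T ht0 hr ((QF.defect_eq_zero_iff _).1 hK)
end
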